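/- The class of all finite simple graphs that do not contain the gem as an induced minor is well-quasi-ordered by the induced minor relation. -/

import Mathlib

open SimpleGraph

namespace IMWQO

/-- `H` is an induced minor of `G`: there is a family of pairwise disjoint nonempty
connected subsets of `V(G)`, indexed by `V(H)`, such that distinct branch sets are
joined by an edge of `G` iff the corresponding vertices are adjacent in `H`. -/
def IsInducedMinor {α β : Type*} (H : SimpleGraph α) (G : SimpleGraph β) : Prop :=
  ∃ μ : α → Set β,
    (∀ a, (μ a).Nonempty) ∧
    (∀ a b, a ≠ b → Disjoint (μ a) (μ b)) ∧
    (∀ a, (G.induce (μ a)).Connected) ∧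
    (∀ a b, a ≠ b → ((∃ x ∈ μ a, ∃ y ∈ μ b, G.Adj x y) ↔ H.Adj a b))

/-- A bundled finite simple graph. -/
abbrev FinGraph := Σ n : ℕ, SimpleGraph (Fin n)

/-- The induced minor relation on bundled finite graphs. -/
def FinGraph.IM (H G : FinGraph) : Prop := IsInducedMinor H.2 G.2

/-- A class of finite graphs is well-quasi-ordered by the induced minor relation. -/
def WqoClass (P : FinGraph → Prop) : Prop :=
  ∀ f : ℕ → FinGraph, (∀ i, P (f i)) → ∃ i j, i < j ∧ FinGraph.IM (f i) (f j)

/-- `K̂₄`: `K₄` (on vertices `0,1,2,3`) plus a vertex `4` adjacent to `0` and `1`. -/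
def hatK4 : SimpleGraph (Fin 5) :=
  SimpleGraph.fromRel fun a b =>
    (a.val < 4 ∧ b.val < 4) ∨ (a.val = 4 ∧ (b.val = 0 ∨ b.val = 1))

/-- The gem: the path `0 - 1 - 2 - 3` plus a dominating vertex `4`. -/
def gem : SimpleGraph (Fin 5) :=
  SimpleGraph.fromRel fun a b =>
    (b.val = a.val + 1 ∧ b.val ≤ 3) ∨ a.val = 4

/-- The complete graph on four vertices. -/
def K4 : SimpleGraph (Fin 4) := ⊤

/-- The prism, i.e. the Cartesian (box) product `K₃ □ K₂`. -/
def prism : SimpleGraph (Fin 3 × Fin 2) :=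
  (⊤ : SimpleGraph (Fin 3)) □ (⊤ : SimpleGraph (Fin 2))

/-- The complete bipartite graph `K_{3,3}`. -/
def K33 : SimpleGraph (Fin 3 ⊕ Fin 3) := completeBipartiteGraph (Fin 3) (Fin 3)

/-- Subdivide the edge `{u,v}` of `G`, the new vertex being `Fin.last n`. -/
def subdivideEdge {n : ℕ} (G : SimpleGraph (Fin n)) (u v : Fin n) :
    SimpleGraph (Fin (n + 1)) :=
  SimpleGraph.fromRel fun a b =>
    (∃ a' b' : Fin n, a = a'.castSucc ∧ b = b'.castSucc ∧ G.Adj a' b' ∧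
      ¬(a' = u ∧ b' = v) ∧ ¬(a' = v ∧ b' = u))
    ∨ (a = Fin.last n ∧ (b = u.castSucc ∨ b = v.castSucc))

/-- One subdivision step on bundled graphs: the first graph is obtained from the
second one by subdividing one edge. -/
inductive SubdivStep : FinGraph → FinGraph → Prop
  | mk {n : ℕ} (G : SimpleGraph (Fin n)) (u v : Fin n) (h : G.Adj u v) :
      SubdivStep ⟨n + 1, subdivideEdge G u v⟩ ⟨n, G⟩

/-- `G` is (isomorphic to) a subdivision of `H`. -/
def IsSubdivision {α β : Type*} (G : SimpleGraph α) (H : SimpleGraph β) : Prop :=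
  ∃ A B : FinGraph, Nonempty (G ≃g A.2) ∧ Nonempty (H ≃g B.2) ∧
    Relation.ReflTransGen SubdivStep A B

/-- `G` contains a subdivision of `H` as a subgraph. -/
def ContainsSubdivAsSubgraph {α β : Type*} (G : SimpleGraph α) (H : SimpleGraph β) : Prop :=
  ∃ S : G.Subgraph, IsSubdivision S.coe H

/-- `G` has a proper `K₄`-subdivision: for some vertex `v`, `G - v` contains
a subdivision of `K₄` as a subgraph. -/
def HasProperK4Subdivision {α : Type*} (G : SimpleGraph α) : Prop :=
  ∃ v : α, ContainsSubdivAsSubgraph (G.induce {u | u ≠ v}) K4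

/-- `G` is 2-connected: at least 3 vertices, and removing any vertex leaves it connected. -/
def TwoConnected {α : Type*} [Fintype α] (G : SimpleGraph α) : Prop :=
  3 ≤ Fintype.card α ∧ ∀ v : α, (G.induce {u | u ≠ v}).Connected

/-- `G` is complete multipartite: two vertices are adjacent iff they lie in different
classes of some partition (equivalence relation). -/
def IsCompleteMultipartite {α : Type*} (G : SimpleGraph α) : Prop :=
  ∃ s : Setoid α, ∀ u v, G.Adj u v ↔ ¬ s.r u v

/-- `G` is a cograph: it has no induced path on four vertices. -/
def IsCograph {α : Type*} (G : SimpleGraph α) : Prop :=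
  ∀ f : Fin 4 → α, Function.Injective f →
    ¬ (∀ a b : Fin 4, G.Adj (f a) (f b) ↔ (pathGraph 4).Adj a b)

/-- `G` is a linear forest: acyclic with maximum degree at most 2,
i.e. a disjoint union of paths. -/
def IsLinearForest {α : Type*} (G : SimpleGraph α) : Prop :=
  G.IsAcyclic ∧ ∀ v, (G.neighborSet v).ncard ≤ 2

/-- The set `C` induces an (induced) cycle in `G`. -/
def InducesCycle {α : Type*} (G : SimpleGraph α) (C : Set α) : Prop :=
  ∃ n : ℕ, 3 ≤ n ∧ Nonempty ((G.induce C) ≃g cycleGraph n)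

/-- The set `S` induces a path in `G` all of whose internal vertices have degree two
in `G`. -/
def IsBasicPath {α : Type*} (G : SimpleGraph α) (S : Set α) : Prop :=
  ∃ (n : ℕ) (φ : (G.induce S) ≃g pathGraph n),
    ∀ v : S, (φ v).val ≠ 0 → (φ v).val ≠ n - 1 → (G.neighborSet v.val).ncard = 2

/-- The wheel with cycle `0, …, n-1` and center adjacent to the vertices of `T`. -/
def wheelGraph (n : ℕ) (T : Finset (Fin n)) : SimpleGraph (Fin n ⊕ Unit) :=
  SimpleGraph.fromRel fun a b =>
    (∃ x y : Fin n, a = Sum.inl x ∧ b = Sum.inl y ∧ (cycleGraph n).Adj x y)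
    ∨ (∃ x ∈ T, a = Sum.inr () ∧ b = Sum.inl x)

/-- `G` is a `k`-wheel: a cycle of order at least `max k 3` plus a center adjacent to
exactly `k` distinct vertices of the cycle. -/
def IsWheel {α : Type*} (k : ℕ) (G : SimpleGraph α) : Prop :=
  ∃ n : ℕ, 3 ≤ n ∧ k ≤ n ∧ ∃ T : Finset (Fin n), T.card = k ∧
    Nonempty (G ≃g wheelGraph n T)

/-- A 3-wheel subgraph of `G`: a cycle of `G` together with a center outside the cycle
joined to (at least) three distinct vertices of the cycle by edges of `G`. -/
structure ThreeWheelSub {α : Type*} (G : SimpleGraph α) where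
  base : α
  cyc : G.Walk base base
  cyc_isCycle : cyc.IsCycle
  center : α
  center_not_mem : center ∉ cyc.support
  spokes : Finset α
  spokes_card : spokes.card = 3
  spokes_sub : ∀ x ∈ spokes, x ∈ cyc.support
  spokes_adj : ∀ x ∈ spokes, G.Adj center x

/-- The number of vertices of a 3-wheel subgraph. -/
def ThreeWheelSub.order {α : Type*} [DecidableEq α] {G : SimpleGraph α}
    (W : ThreeWheelSub G) : ℕ :=
  W.cyc.support.toFinset.card + 1

/-- `G` has a cycle-multipartite decomposition. -/
def HasCycleMultipartiteDecomp {α : Type*} (G : SimpleGraph α) : Prop :=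
  ∃ C R : Set α, C ∪ R = Set.univ ∧ Disjoint C R ∧
    InducesCycle G C ∧ IsCompleteMultipartite (G.induce R) ∧
    ∀ u ∈ R, ∀ v ∈ R, ∀ c ∈ C, (G.Adj u c ↔ G.Adj v c)

/-- A bundled finite simple graph whose vertices are labeled by finite subsets of `S`. -/
structure LabGraph (S : Type*) where
  n : ℕ
  graph : SimpleGraph (Fin n)
  label : Fin n → Finset S

/-- The domination order on finite subsets of a quasi-order: `A ≤^P B` iff there is an
injection `φ : A → B` with `r a (φ a)` for all `a ∈ A`. -/
def FinsetLE {S : Type*} (r : S → S → Prop) (A B : Finset S) : Prop :=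
  ∃ φ : {x // x ∈ A} → {x // x ∈ B}, Function.Injective φ ∧ ∀ a, r a.val (φ a).val

/-- The union of the labels of the vertices in `A`. -/
noncomputable def labelUnion {S : Type*} {n : ℕ} (lab : Fin n → Finset S)
    (A : Finset (Fin n)) : Finset S :=
  letI := Classical.decEq S
  A.biUnion lab

/-- Label-respecting induced minor relation on labeled graphs. -/
def LabIM {S : Type*} (r : S → S → Prop) (H G : LabGraph S) : Prop :=
  ∃ μ : Fin H.n → Finset (Fin G.n),
    (∀ a, (μ a).Nonempty) ∧
    (∀ a b, a ≠ b → Disjoint (μ a) (μ b)) ∧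
    (∀ a, (G.graph.induce (↑(μ a) : Set (Fin G.n))).Connected) ∧
    (∀ a b, a ≠ b → ((∃ x ∈ μ a, ∃ y ∈ μ b, G.graph.Adj x y) ↔ H.graph.Adj a b)) ∧
    (∀ a, FinsetLE r (H.label a) (labelUnion G.label (μ a)))

/-- Label-respecting contraction relation on labeled graphs: an induced minor model
whose branch sets cover all vertices. -/
def LabContraction {S : Type*} (r : S → S → Prop) (H G : LabGraph S) : Prop :=
  ∃ μ : Fin H.n → Finset (Fin G.n),
    (∀ a, (μ a).Nonempty) ∧
    (∀ a b, a ≠ b → Disjoint (μ a) (μ b)) ∧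
    (∀ x : Fin G.n, ∃ a, x ∈ μ a) ∧
    (∀ a, (G.graph.induce (↑(μ a) : Set (Fin G.n))).Connected) ∧
    (∀ a b, a ≠ b → ((∃ x ∈ μ a, ∃ y ∈ μ b, G.graph.Adj x y) ↔ H.graph.Adj a b)) ∧
    (∀ a, FinsetLE r (H.label a) (labelUnion G.label (μ a)))

/-- Label-respecting induced subgraph relation on labeled graphs. -/
def LabISub {S : Type*} (r : S → S → Prop) (H G : LabGraph S) : Prop :=
  ∃ φ : Fin H.n → Fin G.n, Function.Injective φ ∧
    (∀ a b, H.graph.Adj a b ↔ G.graph.Adj (φ a) (φ b)) ∧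
    (∀ a, FinsetLE r (H.label a) (G.label (φ a)))

/-- A relation is a well-quasi-order: every infinite sequence contains a good pair. -/
def IsWqo {S : Type*} (r : S → S → Prop) : Prop :=
  ∀ g : ℕ → S, ∃ i j, i < j ∧ r (g i) (g j)

section Sets

variable {V : Type*} {G : SimpleGraph V}

/-- Two vertex sets are joined by an edge. -/
def Touch (G : SimpleGraph V) (S T : Set V) : Prop := ∃ x ∈ S, ∃ y ∈ T, G.Adj x y

/-- A vertex set is connected: it is nonempty and every cut of it is crossed by an edge. -/
def Conn (G : SimpleGraph V) (S : Set V) : Prop :=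
  S.Nonempty ∧ ∀ A ⊆ S, A.Nonempty → A ≠ S → Touch G A (S \ A)

lemma Touch.symm {S T : Set V} (h : Touch G S T) : Touch G T S := by
  obtain ⟨x, hx, y, hy, h⟩ := h
  exact ⟨y, hy, x, hx, h.symm⟩

lemma touch_comm {S T : Set V} : Touch G S T ↔ Touch G T S := ⟨Touch.symm, Touch.symm⟩

lemma Touch.mono {S T S' T' : Set V} (h : Touch G S T) (hS : S ⊆ S') (hT : T ⊆ T') :
    Touch G S' T' := by
  obtain ⟨x, hx, y, hy, h⟩ := h
  exact ⟨x, hS hx, y, hT hy, h⟩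

@[simp] lemma touch_union_left {S T U : Set V} :
    Touch G (S ∪ T) U ↔ Touch G S U ∨ Touch G T U := by
  unfold Touch; grind

@[simp] lemma touch_union_right {S T U : Set V} :
    Touch G U (S ∪ T) ↔ Touch G U S ∨ Touch G U T := by
  unfold Touch; grind

@[simp] lemma touch_singleton {x y : V} : Touch G {x} {y} ↔ G.Adj x y := by
  simp [Touch]

lemma touch_singleton_left {x : V} {S : Set V} : Touch G {x} S ↔ ∃ y ∈ S, G.Adj x y := by
  simp [Touch]

lemma touch_singleton_right {x : V} {S : Set V} : Touch G S {x} ↔ ∃ y ∈ S, G.Adj y x := by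
  simp [Touch]

lemma conn_singleton (x : V) : Conn G {x} := by
  refine ⟨⟨x, rfl⟩, fun A hA hne hA' => ?_⟩
  exact absurd (hne.subset_singleton_iff.mp hA) hA'

lemma Conn.union {S T : Set V} (hS : Conn G S) (hT : Conn G T) (h : Touch G S T) :
    Conn G (S ∪ T) := by
  refine ⟨hS.1.mono Set.subset_union_left, fun A hA hne hA' => ?_⟩
  by_cases h1 : (A ∩ S).Nonempty ∧ A ∩ S ≠ S
  · exact (hS.2 _ Set.inter_subset_right h1.1 h1.2).mono Set.inter_subset_left (by grind)
  by_cases h2 : (A ∩ T).Nonempty ∧ A ∩ T ≠ T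
  · exact (hT.2 _ Set.inter_subset_right h2.1 h2.2).mono Set.inter_subset_left (by grind)
  obtain ⟨x, hx, y, hy, hxy⟩ := h
  by_cases hxA : x ∈ A
  · by_cases hyA : y ∈ A
    · exact absurd (Set.Subset.antisymm hA (by
        have hxn : (A ∩ S).Nonempty := ⟨x, hxA, hx⟩
        have hyn : (A ∩ T).Nonempty := ⟨y, hyA, hy⟩
        grind)) hA'
    · exact ⟨x, hxA, y, ⟨Or.inr hy, hyA⟩, hxy⟩
  · by_cases hyA : y ∈ A
    · exact ⟨y, hyA, x, ⟨Or.inl hx, hxA⟩, hxy.symm⟩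
    · exfalso
      obtain ⟨z, hz⟩ := hne
      rcases hA hz with hzS | hzT
      · have hzn : (A ∩ S).Nonempty := ⟨z, hz, hzS⟩
        grind
      · have hzn : (A ∩ T).Nonempty := ⟨z, hz, hzT⟩
        grind

lemma Conn.sUnion {𝒞 : Set (Set V)} {x : V} (hne : 𝒞.Nonempty)
    (h : ∀ C ∈ 𝒞, Conn G C ∧ x ∈ C) : Conn G (⋃₀ 𝒞) := by
  obtain ⟨C₀, hC₀⟩ := hne
  refine ⟨⟨x, C₀, hC₀, (h _ hC₀).2⟩, fun A hA hAne hA' => ?_⟩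
  have key : ∃ C ∈ 𝒞, (A ∩ C).Nonempty ∧ A ∩ C ≠ C := by
    by_cases hx : x ∈ A
    · obtain ⟨y, hy, hyA⟩ : ∃ y ∈ ⋃₀ 𝒞, y ∉ A := by
        by_contra hcon
        push Not at hcon
        exact hA' (Set.Subset.antisymm hA hcon)
      obtain ⟨C, hC, hyC⟩ := hy
      exact ⟨C, hC, ⟨x, hx, (h C hC).2⟩, by grind⟩
    · obtain ⟨y, hy⟩ := hAne
      obtain ⟨C, hC, hyC⟩ := hA hy
      refine ⟨C, hC, ⟨y, hy, hyC⟩, ?_⟩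
      have := (h C hC).2
      grind
  obtain ⟨C, hC, h1, h2⟩ := key
  exact ((h C hC).1.2 _ Set.inter_subset_right h1 h2).mono Set.inter_subset_left
    fun y hy => ⟨⟨C, hC, hy.1⟩, by grind⟩

lemma Conn.insert {S : Set V} {x : V} (hS : Conn G S) (h : Touch G {x} S) :
    Conn G ({x} ∪ S) := (conn_singleton x).union hS h

/-- `C` is a connected component of the subgraph induced by `D`. -/
def IsComp (G : SimpleGraph V) (D C : Set V) : Prop :=
  C ⊆ D ∧ Conn G C ∧ ¬ Touch G C (D \ C)

lemma exists_isComp {D : Set V} {x : V} (hx : x ∈ D) : ∃ C, IsComp G D C ∧ x ∈ C := by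
  have hne : {C | C ⊆ D ∧ Conn G C ∧ x ∈ C}.Nonempty :=
    ⟨{x}, by simpa using hx, conn_singleton x, rfl⟩
  have hconn : Conn G (⋃₀ {C | C ⊆ D ∧ Conn G C ∧ x ∈ C}) :=
    Conn.sUnion (x := x) hne fun C hC => hC.2
  have hsub : ⋃₀ {C | C ⊆ D ∧ Conn G C ∧ x ∈ C} ⊆ D := Set.sUnion_subset fun C hC => hC.1
  have hxm : x ∈ ⋃₀ {C | C ⊆ D ∧ Conn G C ∧ x ∈ C} :=
    ⟨{x}, ⟨by simpa using hx, conn_singleton x, rfl⟩, rfl⟩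
  refine ⟨_, ⟨hsub, hconn, ?_⟩, hxm⟩
  rintro ⟨y, hy, z, hz, hyz⟩
  refine hz.2 ⟨_, ⟨?_, hconn.union (conn_singleton z) ⟨y, hy, z, rfl, hyz⟩, Or.inl hxm⟩,
    Or.inr rfl⟩
  exact Set.union_subset hsub (by simpa using hz.1)

lemma IsComp.subset_of_conn {D C S : Set V} (hC : IsComp G D C) (hS : Conn G S) (hSD : S ⊆ D)
    (h : (S ∩ C).Nonempty) : S ⊆ C := by
  by_contra hcon
  refine hC.2.2 ((hS.2 (S ∩ C) Set.inter_subset_left h (by grind)).mono Set.inter_subset_right ?_)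
  grind

lemma IsComp.eq_of_mem {D C C' : Set V} (hC : IsComp G D C) (hC' : IsComp G D C') {x : V}
    (hx : x ∈ C) (hx' : x ∈ C') : C = C' :=
  Set.Subset.antisymm (hC'.subset_of_conn hC.2.1 hC.1 ⟨x, hx, hx'⟩)
    (hC.subset_of_conn hC'.2.1 hC'.1 ⟨x, hx', hx⟩)

lemma IsComp.disjoint_of_ne {D C C' : Set V} (hC : IsComp G D C) (hC' : IsComp G D C')
    (h : C ≠ C') : Disjoint C C' :=
  Set.disjoint_left.mpr fun _ hx hx' => h (hC.eq_of_mem hC' hx hx')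

lemma IsComp.not_touch_of_ne {D C C' : Set V} (hC : IsComp G D C) (hC' : IsComp G D C')
    (h : C ≠ C') : ¬ Touch G C C' := fun ht =>
  hC.2.2 (ht.mono subset_rfl fun _ hx =>
    ⟨hC'.1 hx, fun hx' => Set.disjoint_left.mp (hC.disjoint_of_ne hC' h) hx' hx⟩)

lemma IsComp.mem_of_adj {D C : Set V} (hC : IsComp G D C) {x y : V} (hx : x ∈ C) (hy : y ∈ D)
    (h : G.Adj x y) : y ∈ C := by
  by_contra hyC
  exact hC.2.2 ⟨x, hx, y, ⟨hy, hyC⟩, h⟩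

/-- In a connected set, each component of what remains after deleting a nonempty part touches
that part. -/
lemma Conn.touch_of_isComp {S A C : Set V} (hS : Conn G S) (hA : (A ∩ S).Nonempty)
    (hC : IsComp G (S \ A) C) : Touch G C (A ∩ S) := by
  have := hS.2 C (hC.1.trans Set.sdiff_subset) hC.2.1.1 (by
    rintro rfl
    obtain ⟨x, hx⟩ := hA
    exact (hC.1 hx.2).2 hx.1)
  obtain ⟨x, hx, y, hy, h⟩ := this
  refine ⟨x, hx, y, ?_, h⟩
  by_contra hcon
  exact hC.2.2 ⟨x, hx, y, ⟨⟨hy.1, fun hyA => hcon ⟨hyA, hy.1⟩⟩, hy.2⟩, h⟩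

/-- A connected set with two distinguished vertices splits into two connected parts, each
containing one of them. -/
lemma Conn.exists_split {S : Set V} (hS : Conn G S) {a b : V} (ha : a ∈ S) (hb : b ∈ S)
    (hab : a ≠ b) : ∃ A B, Conn G A ∧ Conn G B ∧ a ∈ A ∧ b ∈ B ∧ A ∪ B = S ∧ Disjoint A B ∧
      Touch G A B := by
  obtain ⟨B, hB, hbB⟩ := exists_isComp (G := G) (D := S \ {a}) (x := b) ⟨hb, fun h => hab h.symm⟩
  have hBS : B ⊆ S := hB.1.trans Set.sdiff_subset
  have haB : a ∉ B := fun h => (hB.1 h).2 rfl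
  have hconn : Conn G (S \ B) := by
    have : S \ B = ⋃₀ ({C | ∃ E, IsComp G (S \ {a}) E ∧ E ≠ B ∧ C = {a} ∪ E} ∪ {{a}}) := by
      ext x
      constructor
      · intro hx
        by_cases hxa : x = a
        · exact ⟨{a}, Or.inr rfl, hxa⟩
        · obtain ⟨E, hE, hxE⟩ := exists_isComp (G := G) (D := S \ {a}) (x := x) ⟨hx.1, hxa⟩
          exact ⟨{a} ∪ E, Or.inl ⟨E, hE, by grind, rfl⟩, Or.inr hxE⟩
      · rintro ⟨C, ⟨E, hE, hEB, rfl⟩ | hC, hx⟩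
        · rcases hx with hx | hx
          · rw [Set.mem_singleton_iff] at hx; subst hx; exact ⟨ha, haB⟩
          · exact ⟨(hE.1 hx).1, Set.disjoint_left.mp (hE.disjoint_of_ne hB hEB) hx⟩
        · rw [Set.mem_singleton_iff] at hC; subst hC
          rw [Set.mem_singleton_iff] at hx; subst hx; exact ⟨ha, haB⟩
    rw [this]
    refine Conn.sUnion (x := a) ⟨{a}, Or.inr rfl⟩ ?_
    rintro C (⟨E, hE, hEB, rfl⟩ | hC)
    · refine ⟨Conn.insert hE.2.1 ?_, Or.inl rfl⟩
      have := hS.touch_of_isComp (A := {a}) ⟨a, rfl, ha⟩ hE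
      exact this.symm.mono Set.inter_subset_left subset_rfl
    · rw [Set.mem_singleton_iff] at hC; subst hC
      exact ⟨conn_singleton a, rfl⟩
  refine ⟨S \ B, B, hconn, hB.2.1, ⟨ha, haB⟩, hbB, by simpa using hBS, Set.disjoint_sdiff_left, ?_⟩
  have := hS.touch_of_isComp (A := {a}) ⟨a, rfl, ha⟩ hB
  exact this.symm.mono (fun x hx => by
    rw [Set.mem_singleton_iff.mp hx.1]; exact ⟨ha, haB⟩) subset_rfl

lemma conn_iff_induce_connected {S : Set V} : Conn G S ↔ (G.induce S).Connected := by
  constructor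
  · intro h
    obtain ⟨x, hx⟩ := h.1
    have : Nonempty S := ⟨⟨x, hx⟩⟩
    rw [connected_iff_exists_forall_reachable]
    refine ⟨⟨x, hx⟩, fun w => ?_⟩
    set A : Set V := {y | ∃ hy : y ∈ S, (G.induce S).Reachable ⟨x, hx⟩ ⟨y, hy⟩} with hA
    by_contra hw
    have hAS : A ⊆ S := fun y hy => hy.1
    have hne : A ≠ S := by
      intro hAS
      have : (w : V) ∈ A := by rw [hAS]; exact w.2
      exact hw this.2
    obtain ⟨y, hy, z, hz, hyz⟩ := h.2 A hAS ⟨x, hx, Reachable.refl _⟩ hne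
    exact hz.2 ⟨hz.1, hy.2.trans (Adj.reachable (by simpa using hyz))⟩
  · intro h
    obtain ⟨⟨x, hx⟩⟩ := h.nonempty
    refine ⟨⟨x, hx⟩, fun A hAS ⟨a, ha⟩ hne => ?_⟩
    obtain ⟨b, hbS, hbA⟩ : ∃ b ∈ S, b ∉ A := by
      by_contra hcon
      push Not at hcon
      exact hne (Set.Subset.antisymm hAS hcon)
    obtain ⟨p⟩ := h.preconnected ⟨a, hAS ha⟩ ⟨b, hbS⟩
    obtain ⟨d, -, hd1, hd2⟩ := p.exists_boundary_dart {y | (y : V) ∈ A} ha hbA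
    exact ⟨d.fst, hd1, d.snd, ⟨d.snd.2, hd2⟩, by simpa using d.adj⟩

/-- Five connected sets forming a gem pattern. -/
lemma isInducedMinor_gem {H A B C D : Set V} (hH : Conn G H) (hA : Conn G A) (hB : Conn G B)
    (hC : Conn G C) (hD : Conn G D)
    (dHA : Disjoint H A) (dHB : Disjoint H B) (dHC : Disjoint H C) (dHD : Disjoint H D)
    (dAB : Disjoint A B) (dAC : Disjoint A C) (dAD : Disjoint A D) (dBC : Disjoint B C)
    (dBD : Disjoint B D) (dCD : Disjoint C D)
    (tHA : Touch G H A) (tHB : Touch G H B) (tHC : Touch G H C) (tHD : Touch G H D)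
    (tAB : Touch G A B) (tBC : Touch G B C) (tCD : Touch G C D)
    (nAC : ¬ Touch G A C) (nAD : ¬ Touch G A D) (nBD : ¬ Touch G B D) :
    IsInducedMinor gem G := by
  refine ⟨![A, B, C, D, H], ?_, ?_, ?_, ?_⟩
  · intro a
    fin_cases a
    exacts [hA.1, hB.1, hC.1, hD.1, hH.1]
  · intro a b hab
    fin_cases a <;> fin_cases b <;> first | exact absurd rfl hab | skip
    all_goals first | assumption | (symm; assumption)
  · intro a
    rw [← conn_iff_induce_connected]
    fin_cases a
    exacts [hA, hB, hC, hD, hH]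
  · intro a b hab
    change Touch G _ _ ↔ _
    fin_cases a <;> fin_cases b <;> first | exact absurd rfl hab | skip
    all_goals
      simp only [gem, fromRel_adj]
      first
      | exact iff_of_true (by first | assumption | (apply Touch.symm; assumption)) (by decide)
      | exact iff_of_false (by first | assumption | (rw [touch_comm]; assumption)) (by decide)

end Sets

section Paths

variable {V : Type*} {G : SimpleGraph V}

lemma Conn.union_of_inter {S T : Set V} (hS : Conn G S) (hT : Conn G T) {x : V} (hx : x ∈ S)
    (hx' : x ∈ T) : Conn G (S ∪ T) := by
  have := Conn.sUnion (G := G) (𝒞 := {S, T}) (x := x) ⟨S, by simp⟩ (by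
    rintro C (rfl | rfl) <;> constructor <;> assumption)
  simpa using this

/-- The vertices of the sequence `q` with indices in the interval from `a` to `b`. -/
def seg (q : ℕ → V) (a b : ℕ) : Set V := q '' Set.Icc a b

lemma mem_seg {q : ℕ → V} {a b : ℕ} {x : V} : x ∈ seg q a b ↔ ∃ i, a ≤ i ∧ i ≤ b ∧ q i = x := by
  simp [seg, and_assoc]

lemma seg_self (q : ℕ → V) (a : ℕ) : seg q a a = {q a} := by
  simp [seg]

lemma mem_seg_of_le {q : ℕ → V} {a b i : ℕ} (ha : a ≤ i) (hb : i ≤ b) : q i ∈ seg q a b :=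
  mem_seg.mpr ⟨i, ha, hb, rfl⟩

lemma touch_seg_left {q : ℕ → V} {a b : ℕ} {S : Set V} :
    Touch G (seg q a b) S ↔ ∃ i, a ≤ i ∧ i ≤ b ∧ Touch G {q i} S := by
  constructor
  · rintro ⟨x, hx, y, hy, h⟩
    obtain ⟨i, hi, hi', rfl⟩ := mem_seg.mp hx
    exact ⟨i, hi, hi', q i, rfl, y, hy, h⟩
  · rintro ⟨i, hi, hi', h⟩
    exact h.mono (by simpa using mem_seg_of_le hi hi') subset_rfl

lemma conn_seg {q : ℕ → V} {a b : ℕ} (hab : a ≤ b)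
    (h : ∀ i, a ≤ i → i < b → G.Adj (q i) (q (i + 1))) : Conn G (seg q a b) := by
  induction b, hab using Nat.le_induction with
  | base => rw [seg_self]; exact conn_singleton _
  | succ b hab ih =>
    have : seg q a (b + 1) = seg q a b ∪ {q (b + 1)} := by
      ext x
      simp only [mem_seg, Set.mem_union, Set.mem_singleton_iff]
      constructor
      · rintro ⟨i, h1, h2, rfl⟩
        rcases Nat.lt_or_ge b i with h3 | h3
        · right; congr 1; omega
        · exact Or.inl ⟨i, h1, h3, rfl⟩
      · rintro (⟨i, h1, h2, rfl⟩ | rfl)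
        · exact ⟨i, h1, by omega, rfl⟩
        · exact ⟨b + 1, by omega, le_rfl, rfl⟩
    rw [this]
    exact (ih fun i h1 h2 => h i h1 (by omega)).union (conn_singleton _)
      ⟨q b, mem_seg_of_le hab le_rfl, _, rfl, h b hab (by omega)⟩

/-- `q 0 = u, q 1, …, q k, q (k + 1) = v` is a path with interior in `D`, all of whose chords
join `u` to `v`. -/
structure IndPath (G : SimpleGraph V) (D : Set V) (u v : V) (k : ℕ) (q : ℕ → V) : Prop where
  pos : 1 ≤ k
  zero : q 0 = u
  last : q (k + 1) = v
  mem : ∀ i, 1 ≤ i → i ≤ k → q i ∈ D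
  left_notMem : u ∉ D
  right_notMem : v ∉ D
  adj : ∀ i j, i < j → j ≤ k + 1 → (i ≠ 0 ∨ j ≠ k + 1) → (G.Adj (q i) (q j) ↔ j = i + 1)
  inj : ∀ i j, i < j → j ≤ k + 1 → q i ≠ q j

lemma exists_indPath {D : Set V} {u v : V} (hD : Conn G D) (hu : u ∉ D) (hv : v ∉ D) (huv : u ≠ v)
    (hDu : Touch G {u} D) (hDv : Touch G {v} D) : ∃ k q, IndPath G D u v k q := by
  classical
  let P : ℕ → Prop := fun n => ∃ q : ℕ → V, 1 ≤ n ∧ q 0 = u ∧ q (n + 1) = v ∧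
    (∀ i, 1 ≤ i → i ≤ n → q i ∈ D) ∧ ∀ i, i ≤ n → G.Adj (q i) (q (i + 1))
  have hreach : ∀ y ∈ D, ∃ (n : ℕ) (q : ℕ → V), 1 ≤ n ∧ q 0 = u ∧ q n = y ∧
      (∀ i, 1 ≤ i → i ≤ n → q i ∈ D) ∧ ∀ i, i < n → G.Adj (q i) (q (i + 1)) := by
    by_contra hcon
    set R : Set V := {y ∈ D | ∃ (n : ℕ) (q : ℕ → V), 1 ≤ n ∧ q 0 = u ∧ q n = y ∧
      (∀ i, 1 ≤ i → i ≤ n → q i ∈ D) ∧ ∀ i, i < n → G.Adj (q i) (q (i + 1))} with hR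
    have hRD : R ⊆ D := fun y hy => hy.1
    obtain ⟨x, hx, hux⟩ := touch_singleton_left.mp hDu
    have hxR : x ∈ R := by
      refine ⟨hx, 1, fun i => if i = 0 then u else x, le_rfl, by simp, by simp, ?_, ?_⟩
      · intro i h1 h2
        have : i ≠ 0 := by omega
        simpa [this] using hx
      · intro i hi
        have : i = 0 := by omega
        subst this
        simpa using hux
    have hne : R ≠ D := by
      intro h
      apply hcon
      intro y hy
      rw [← h] at hy
      exact hy.2
    obtain ⟨y, ⟨hyD, n, q, hn, h0, hny, hmem, hadj⟩, z, ⟨hz, hzR⟩, hyz⟩ := hD.2 R hRD ⟨x, hxR⟩ hne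
    refine hzR ⟨hz, n + 1, fun i => if i ≤ n then q i else z, by omega, by simpa using h0, by simp,
      ?_, ?_⟩
    · intro i h1 h2
      by_cases h3 : i ≤ n
      · simpa [h3] using hmem i h1 h3
      · simpa [h3] using hz
    · intro i hi
      rcases Nat.lt_or_ge i n with h3 | h3
      · have h4 : i + 1 ≤ n := h3
        simpa [h3.le, h4] using hadj i h3
      · have : i = n := by omega
        subst this
        simpa [hny] using hyz
  have hP : ∃ n, P n := by
    obtain ⟨y, hy, hvy⟩ := touch_singleton_left.mp hDv
    obtain ⟨n, q, hn, h0, hny, hmem, hadj⟩ := hreach y hy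
    refine ⟨n, fun i => if i ≤ n then q i else v, hn, by simpa using h0, by simp, ?_, ?_⟩
    · intro i h1 h2
      simpa [h2] using hmem i h1 h2
    · intro i hi
      rcases Nat.lt_or_ge i n with h3 | h3
      · have h4 : i + 1 ≤ n := h3
        simpa [h3.le, h4] using hadj i h3
      · have : i = n := by omega
        subst this
        simpa [hny] using hvy.symm
  obtain ⟨q, hk, h0, hlast, hmem, hadj⟩ := Nat.find_spec hP
  set k := Nat.find hP with hkdef
  have hmin : ∀ m, m < k → ¬ P m := fun m hm => Nat.find_min hP hm
  have hch : ∀ i j, i < j → j ≤ k + 1 → (i ≠ 0 ∨ j ≠ k + 1) → G.Adj (q i) (q j) → j = i + 1 := by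
    intro i j hij hj hne h
    by_contra hj'
    refine hmin (k - (j - i - 1)) (by omega)
      ⟨fun t => if t ≤ i then q t else q (t + (j - i - 1)), by omega, by simpa using h0, ?_, ?_, ?_⟩
    · have h1 : ¬ (k - (j - i - 1) + 1 ≤ i) := by omega
      have h2 : k - (j - i - 1) + 1 + (j - i - 1) = k + 1 := by omega
      simp only [h1, if_false, h2, hlast]
    · intro t h1 h2
      by_cases h3 : t ≤ i
      · simpa [h3] using hmem t h1 (by omega)
      · simpa [h3] using hmem (t + (j - i - 1)) (by omega) (by omega)
    · intro t ht
      rcases Nat.lt_trichotomy t i with h3 | h3 | h3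
      · have h4 : t + 1 ≤ i := h3
        simpa [h3.le, h4] using hadj t (by omega)
      · subst h3
        have h4 : t + 1 + (j - t - 1) = j := by omega
        simpa [h4] using h
      · have h4 : ¬ t ≤ i := by omega
        have h5 : ¬ t + 1 ≤ i := by omega
        have h6 : t + 1 + (j - i - 1) = t + (j - i - 1) + 1 := by omega
        simpa [h4, h5, h6] using hadj (t + (j - i - 1)) (by omega)
  refine ⟨k, q, hk, h0, hlast, hmem, hu, hv, ?_, ?_⟩
  · intro i j hij hj hne
    refine ⟨hch i j hij hj hne, ?_⟩
    rintro rfl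
    exact hadj i (by omega)
  · intro i j hij hj heq
    rcases Nat.eq_zero_or_pos i with rfl | hi
    · rcases Nat.lt_or_ge k j with hjk | hjk
      · have : j = k + 1 := by omega
        subst this
        exact huv (by rw [← h0, heq, hlast])
      · exact hu (by rw [← h0, heq]; exact hmem j (by omega) hjk)
    · rcases Nat.lt_or_ge k j with hjk | hjk
      · have : j = k + 1 := by omega
        subst this
        exact hv (by rw [← hlast, ← heq]; exact hmem i (by omega) (by omega))
      · have h1 := hadj j hjk
        rw [← heq] at h1
        have := hch i (j + 1) (by omega) (by omega) (by omega) h1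
        omega

namespace IndPath

variable {D : Set V} {u v : V} {k : ℕ} {q : ℕ → V}

lemma ne (h : IndPath G D u v k q) : u ≠ v := by
  rw [← h.zero, ← h.last]; exact h.inj 0 (k + 1) (by omega) le_rfl

lemma rev (h : IndPath G D u v k q) : IndPath G D v u k (fun i => q (k + 1 - i)) where
  pos := h.pos
  zero := by simpa using h.last
  last := by simpa using h.zero
  mem := fun i h1 h2 => h.mem _ (by omega) (by omega)
  left_notMem := h.right_notMem
  right_notMem := h.left_notMem
  adj := fun i j hij hj hne => by
    rw [adj_comm, h.adj _ _ (by omega) (by omega) (by omega)]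
    omega
  inj := fun i j hij hj => (h.inj _ _ (by omega) (by omega)).symm

lemma seg_rev {a b : ℕ} (ha : a ≤ k + 1) (hb : b ≤ k + 1) :
    seg (fun i => q (k + 1 - i)) a b = seg q (k + 1 - b) (k + 1 - a) := by
  ext x
  simp only [mem_seg]
  constructor
  · rintro ⟨i, h1, h2, rfl⟩
    exact ⟨k + 1 - i, by omega, by omega, rfl⟩
  · rintro ⟨i, h1, h2, rfl⟩
    exact ⟨k + 1 - i, by omega, by omega, by congr 1; omega⟩

lemma adj_succ (h : IndPath G D u v k q) {i : ℕ} (hi : i ≤ k) : G.Adj (q i) (q (i + 1)) :=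
  (h.adj i (i + 1) (by omega) (by omega) (by have := h.pos; omega)).mpr rfl

lemma conn (h : IndPath G D u v k q) {a b : ℕ} (hab : a ≤ b) (hb : b ≤ k + 1) :
    Conn G (seg q a b) := conn_seg hab fun _ _ hi => h.adj_succ (by omega)

lemma seg_subset (h : IndPath G D u v k q) {a b : ℕ} (ha : 1 ≤ a) (hb : b ≤ k) :
    seg q a b ⊆ D := by
  intro x hx
  obtain ⟨i, h1, h2, rfl⟩ := mem_seg.mp hx
  exact h.mem i (by omega) (by omega)

lemma disjoint (h : IndPath G D u v k q) {a b c d : ℕ} (hbc : b < c) (hd : d ≤ k + 1) :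
    Disjoint (seg q a b) (seg q c d) := by
  rw [Set.disjoint_left]
  intro x hx hx'
  obtain ⟨i, h1, h2, rfl⟩ := mem_seg.mp hx
  obtain ⟨j, h3, h4, h5⟩ := mem_seg.mp hx'
  exact h.inj i j (by omega) (by omega) h5.symm

lemma touch (h : IndPath G D u v k q) {a b c d : ℕ} (hab : a ≤ b) (hbc : c = b + 1)
    (hcd : c ≤ d) (hd : d ≤ k + 1) : Touch G (seg q a b) (seg q c d) :=
  ⟨q b, mem_seg_of_le hab le_rfl, q c, mem_seg_of_le le_rfl hcd,
    by rw [hbc]; exact h.adj_succ (by omega)⟩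

lemma not_touch (h : IndPath G D u v k q) {a b c d : ℕ} (hbc : b + 1 < c) (hd : d ≤ k + 1)
    (hne : a ≠ 0 ∨ d ≠ k + 1) : ¬ Touch G (seg q a b) (seg q c d) := by
  rintro ⟨x, hx, y, hy, hxy⟩
  obtain ⟨i, h1, h2, rfl⟩ := mem_seg.mp hx
  obtain ⟨j, h3, h4, rfl⟩ := mem_seg.mp hy
  rw [h.adj i j (by omega) (by omega) (by omega)] at hxy
  omega

lemma left_mem (h : IndPath G D u v k q) (b : ℕ) : u ∈ seg q 0 b := by
  rw [← h.zero]; exact mem_seg_of_le le_rfl (Nat.zero_le _)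

lemma right_mem (h : IndPath G D u v k q) {a : ℕ} (ha : a ≤ k + 1) : v ∈ seg q a (k + 1) := by
  rw [← h.last]; exact mem_seg_of_le ha le_rfl

lemma singleton_left (h : IndPath G D u v k q) : {u} = seg q 0 0 := by
  rw [seg_self, h.zero]

lemma singleton_right (h : IndPath G D u v k q) : {v} = seg q (k + 1) (k + 1) := by
  rw [seg_self, h.last]

lemma seg_zero (h : IndPath G D u v k q) (b : ℕ) : seg q 0 b = {u} ∪ seg q 1 b := by
  ext x
  simp only [mem_seg, Set.mem_union, Set.mem_singleton_iff, ← h.zero]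
  constructor
  · rintro ⟨i, -, h2, rfl⟩
    rcases Nat.eq_zero_or_pos i with rfl | hi
    · exact Or.inl rfl
    · exact Or.inr ⟨i, hi, h2, rfl⟩
  · rintro (rfl | ⟨i, -, h2, rfl⟩)
    · exact ⟨0, le_rfl, Nat.zero_le _, rfl⟩
    · exact ⟨i, Nat.zero_le _, h2, rfl⟩

end IndPath

/-- A connected graph without cutvertices. -/
def Biconn (G : SimpleGraph V) : Prop :=
  Conn G Set.univ ∧ ∀ (x : V) (A : Set V), A.Nonempty → x ∉ A → (∃ y, y ∉ A ∧ y ≠ x) →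
    ∃ a ∈ A, ∃ b, b ∉ A ∧ b ≠ x ∧ G.Adj a b

lemma Biconn.touch_left (hG : Biconn G) {u v : V} (huv : u ≠ v) {D : Set V}
    (hD : IsComp G {u, v}ᶜ D) : Touch G {u} D := by
  have hu : u ∉ D := fun h => hD.1 h (by simp)
  have hv : v ∉ D := fun h => hD.1 h (by simp)
  obtain ⟨a, ha, b, hb, hbv, hab⟩ := hG.2 v D hD.2.1.1 hv ⟨u, hu, huv⟩
  by_cases hbu : b = u
  · exact ⟨u, rfl, a, ha, by rw [← hbu]; exact hab.symm⟩
  · exact absurd (hD.mem_of_adj ha (by simp [hbu, hbv]) hab) hb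

lemma Biconn.touch_right (hG : Biconn G) {u v : V} (huv : u ≠ v) {D : Set V}
    (hD : IsComp G {u, v}ᶜ D) : Touch G {v} D :=
  hG.touch_left huv.symm (by rwa [Set.pair_comm])

lemma IndPath.exists_ne_touch {D E : Set V} {u v : V} {k : ℕ} {q : ℕ → V} (hG : Biconn G)
    (hD : IsComp G {u, v}ᶜ D) (h : IndPath G D u v k q) (hE : IsComp G (D \ seg q 1 k) E) (m : ℕ)
    (hm : m ≤ k + 1) : ∃ i, i ≤ k + 1 ∧ i ≠ m ∧ Touch G {q i} E := by
  have hnot : ∀ i ≤ k + 1, q i ∉ E := by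
    intro i hi hiE
    have h1 := hE.1 hiE
    rcases Nat.eq_zero_or_pos i with rfl | h0
    · exact h.left_notMem (by rw [← h.zero]; exact h1.1)
    · rcases Nat.lt_or_ge k i with h2 | h2
      · have : i = k + 1 := by omega
        subst this
        exact h.right_notMem (by rw [← h.last]; exact h1.1)
      · exact h1.2 (mem_seg_of_le h0 h2)
  obtain ⟨a, ha, b, hb, hbm, hab⟩ := hG.2 (q m) E hE.2.1.1 (hnot m hm) (by
    rcases Nat.eq_zero_or_pos m with rfl | h0
    · exact ⟨q 1, hnot 1 (by omega), (h.inj 0 1 (by omega) (by omega)).symm⟩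
    · exact ⟨q 0, hnot 0 (by omega), h.inj 0 m (by omega) (by omega)⟩)
  have hb' : ∃ i, i ≤ k + 1 ∧ b = q i := by
    by_cases hbu : b = u
    · exact ⟨0, by omega, by rw [h.zero, hbu]⟩
    by_cases hbv : b = v
    · exact ⟨k + 1, by omega, by rw [h.last, hbv]⟩
    have hbD := hD.mem_of_adj (hE.1 ha).1 (by simp [hbu, hbv]) hab
    by_contra hcon
    refine hb (hE.mem_of_adj ha ⟨hbD, fun hbs => hcon ?_⟩ hab)
    obtain ⟨i, h1, h2, rfl⟩ := mem_seg.mp hbs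
    exact ⟨i, by omega, rfl⟩
  obtain ⟨i, hi, rfl⟩ := hb'
  exact ⟨i, hi, by rintro rfl; exact hbm rfl, q i, rfl, a, ha, hab.symm⟩

lemma IndPath.exists_touch {D E : Set V} {u v : V} {k : ℕ} {q : ℕ → V}
    (hD : Conn G D) (h : IndPath G D u v k q) (hE : IsComp G (D \ seg q 1 k) E) :
    ∃ i, 1 ≤ i ∧ i ≤ k ∧ Touch G {q i} E := by
  have h1 : q 1 ∈ seg q 1 k := mem_seg_of_le le_rfl h.pos
  have := hD.touch_of_isComp ⟨q 1, h1, h.mem 1 le_rfl h.pos⟩ hE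
  obtain ⟨i, h2, h3, h4⟩ := touch_seg_left.mp (this.symm.mono Set.inter_subset_left subset_rfl)
  exact ⟨i, h2, h3, h4⟩

end Paths

section TwoCut

variable {V : Type*} {G : SimpleGraph V}

lemma IndPath.exists_extremal {D E : Set V} {u v : V} {k : ℕ} {q : ℕ → V} (hG : Biconn G)
    (hD : IsComp G {u, v}ᶜ D) (h : IndPath G D u v k q) (hE : IsComp G (D \ seg q 1 k) E) :
    ∃ i j, i < j ∧ j ≤ k + 1 ∧ Touch G {q i} E ∧ Touch G {q j} E ∧
      ∀ m ≤ k + 1, Touch G {q m} E → i ≤ m ∧ m ≤ j := by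
  classical
  obtain ⟨a, ha, -, hta⟩ := h.exists_ne_touch hG hD hE 0 (by omega)
  have hex : ∃ i, Touch G {q i} E := ⟨a, hta⟩
  set i := Nat.find hex with hi
  have hti : Touch G {q i} E := Nat.find_spec hex
  have hmin : ∀ m, Touch G {q m} E → i ≤ m := fun m hm => Nat.find_min' hex hm
  obtain ⟨b, hb, hbi, htb⟩ := h.exists_ne_touch hG hD hE i (by have := hmin a hta; omega)
  set j := Nat.findGreatest (fun m => Touch G {q m} E) (k + 1) with hj
  have htj : Touch G {q j} E := Nat.findGreatest_spec (P := fun m => Touch G {q m} E) hb htb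
  have hjk : j ≤ k + 1 := Nat.findGreatest_le _
  have hmax : ∀ m ≤ k + 1, Touch G {q m} E → m ≤ j :=
    fun m hm hmt => Nat.le_findGreatest (P := fun m => Touch G {q m} E) hm hmt
  have h1 := hmin b htb
  have h2 := hmax b hb htb
  exact ⟨i, j, by omega, hjk, hti, htj, fun m hm hmt => ⟨hmin m hmt, hmax m hm hmt⟩⟩

/-- `D` is the interior of an induced path from `u` to `v`. -/
def IsPathComp (G : SimpleGraph V) (D : Set V) (u v : V) : Prop :=
  ∃ k q, IndPath G D u v k q ∧ D = seg q 1 k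

/-- `D` is complete to `u` and to `v`. -/
def IsCompleteComp (G : SimpleGraph V) (D : Set V) (u v : V) : Prop :=
  ∀ x ∈ D, G.Adj u x ∧ G.Adj v x

/-- The admissible shapes of a component of the complement of a good 2-cut. -/
def GoodComp (G : SimpleGraph V) (D : Set V) (u v : V) : Prop :=
  IsPathComp G D u v ∨ IsCompleteComp G D u v

lemma IsPathComp.symm {D : Set V} {u v : V} (h : IsPathComp G D u v) : IsPathComp G D v u := by
  obtain ⟨k, q, h, hD⟩ := h
  refine ⟨k, _, h.rev, ?_⟩
  have := h.pos
  rw [IndPath.seg_rev (by omega) (by omega), hD,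
    Nat.add_sub_cancel_left, Nat.add_sub_cancel]

/-- Three connected sets outside `D` that, together with the attachments `u` and `v` of `D`,
form a triangle. -/
structure Thick (G : SimpleGraph V) (D : Set V) (u v : V) (U W A : Set V) : Prop where
  memU : u ∈ U
  memW : v ∈ W
  connU : Conn G U
  connW : Conn G W
  connA : Conn G A
  disjUD : Disjoint U D
  disjWD : Disjoint W D
  disjAD : Disjoint A D
  disjUW : Disjoint U W
  disjUA : Disjoint U A
  disjWA : Disjoint W A
  touchUW : Touch G U W
  touchUA : Touch G U A
  touchWA : Touch G W A
  notA : ¬ Touch G A D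
  onlyU : ∀ x ∈ D, ∀ y ∈ U, G.Adj x y → y = u
  onlyW : ∀ x ∈ D, ∀ y ∈ W, G.Adj x y → y = v

lemma Thick.symm {D : Set V} {u v : V} {U W A : Set V} (h : Thick G D u v U W A) :
    Thick G D v u W U A where
  memU := h.memW
  memW := h.memU
  connU := h.connW
  connW := h.connU
  connA := h.connA
  disjUD := h.disjWD
  disjWD := h.disjUD
  disjAD := h.disjAD
  disjUW := h.disjUW.symm
  disjUA := h.disjWA
  disjWA := h.disjUA
  touchUW := h.touchUW.symm
  touchUA := h.touchWA
  touchWA := h.touchUA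
  notA := h.notA
  onlyU := h.onlyW
  onlyW := h.onlyU

lemma Thick.elim {D : Set V} {u v : V} {U W A X c d : Set V} (hG : ¬ IsInducedMinor gem G)
    (h : Thick G D u v U W A) (hXD : X ⊆ D) (hcD : c ⊆ D) (hdD : d ⊆ D)
    (hUX : Conn G ({u} ∪ X)) (hc : Conn G c) (hd : Conn G d)
    (hXc : Disjoint X c) (hXd : Disjoint X d) (hcd : Disjoint c d) (tcd : Touch G c d)
    (tcU : Touch G ({u} ∪ X) c) (tcv : Touch G {v} c) (tdU : Touch G ({u} ∪ X) d)
    (ndv : ¬ Touch G {v} d) : False := by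
  have hsub : {u} ∪ X ⊆ U ∪ X := Set.union_subset_union_left _ (by simpa using h.memU)
  have hsubv : {v} ⊆ W := by simpa using h.memW
  have hUX' : Conn G (U ∪ X) := by
    have := h.connU.union_of_inter hUX h.memU (Or.inl rfl)
    rwa [← Set.union_assoc, Set.union_singleton, Set.insert_eq_of_mem h.memU] at this
  refine hG (isInducedMinor_gem (H := U ∪ X) (A := d) (B := c) (C := W) (D := A) hUX' hd hc h.connW
    h.connA ?_ ?_ ?_ ?_ hcd.symm (h.disjWD.mono_right hdD).symm (h.disjAD.mono_right hdD).symm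
    (h.disjWD.mono_right hcD).symm (h.disjAD.mono_right hcD).symm h.disjWA
    (tdU.mono hsub subset_rfl) (tcU.mono hsub subset_rfl) (touch_union_left.mpr (Or.inl h.touchUW))
    (touch_union_left.mpr (Or.inl h.touchUA)) tcd.symm (tcv.mono hsubv subset_rfl).symm h.touchWA
    ?_ ?_ ?_)
  · exact Set.disjoint_union_left.mpr ⟨h.disjUD.mono_right hdD, hXd⟩
  · exact Set.disjoint_union_left.mpr ⟨h.disjUD.mono_right hcD, hXc⟩
  · exact Set.disjoint_union_left.mpr ⟨h.disjUW, (h.disjWD.mono_right hXD).symm⟩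
  · exact Set.disjoint_union_left.mpr ⟨h.disjUA, (h.disjAD.mono_right hXD).symm⟩
  · rintro ⟨x, hx, y, hy, hxy⟩
    have := h.onlyW x (hdD hx) y hy hxy
    exact ndv ⟨v, rfl, x, hx, by rw [← this]; exact hxy.symm⟩
  · exact fun ht => h.notA (ht.symm.mono subset_rfl hdD)
  · exact fun ht => h.notA (ht.symm.mono subset_rfl hcD)

/-- If `max ≤ k` for the attachments of a component off the path, there is a gem. -/
lemma Thick.elim_of_not_touch_right {D E : Set V} {u v : V} {U W A : Set V} {k : ℕ} {q : ℕ → V}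
    (hG : ¬ IsInducedMinor gem G) (hB : Biconn G) (hD : IsComp G {u, v}ᶜ D)
    (h : Thick G D u v U W A) (hq : IndPath G D u v k q) (hE : IsComp G (D \ seg q 1 k) E)
    (hEv : ¬ Touch G {v} E) : False := by
  obtain ⟨i, j, hij, hj, hti, htj, hm⟩ := hq.exists_extremal hB hD hE
  have hjk : j ≤ k := by
    by_contra hcon
    have : j = k + 1 := by omega
    subst this
    rw [hq.last] at htj
    exact hEv htj
  refine h.elim hG (X := seg q 1 i) (c := seg q (i + 1) k) (d := E)
    (hq.seg_subset le_rfl (by omega)) (hq.seg_subset (by omega) le_rfl)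
    (hE.1.trans Set.sdiff_subset) ?_ (hq.conn (by omega) (by omega))
    hE.2.1 (hq.disjoint (by omega) (by omega)) ?_ ?_ ?_ ?_ ?_ ?_ hEv
  · rw [← hq.seg_zero]; exact hq.conn (by omega) (by omega)
  · exact Set.disjoint_left.mpr fun x hx hx' => (hE.1 hx').2 (by
      obtain ⟨t, h1, h2, rfl⟩ := mem_seg.mp hx; exact mem_seg_of_le h1 (by omega))
  · exact Set.disjoint_left.mpr fun x hx hx' => (hE.1 hx').2 (by
      obtain ⟨t, h1, h2, rfl⟩ := mem_seg.mp hx; exact mem_seg_of_le (by omega) h2)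
  · exact touch_seg_left.mpr ⟨j, by omega, hjk, htj⟩
  · rw [← hq.seg_zero]; exact hq.touch (by omega) rfl (by omega) (by omega)
  · rw [hq.singleton_right]; exact (hq.touch (by omega) rfl le_rfl le_rfl).symm
  · rw [← hq.seg_zero]; exact touch_seg_left.mpr ⟨i, by omega, le_rfl, hti⟩

/-- A component attached to both ends and to an inner vertex `q m` with `m < k` gives a gem. -/
lemma Thick.elim_of_touch_lt {D E : Set V} {u v : V} {U W A : Set V} {k m : ℕ} {q : ℕ → V}
    (hG : ¬ IsInducedMinor gem G)
    (h : Thick G D u v U W A) (hq : IndPath G D u v k q) (hE : IsComp G (D \ seg q 1 k) E)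
    (hEu : Touch G {u} E) (hEv : Touch G {v} E) (hm : 1 ≤ m) (hmk : m < k)
    (htm : Touch G {q m} E) : False := by
  refine h.elim hG (X := ∅) (c := E) (d := seg q 1 m) (Set.empty_subset _)
    (hE.1.trans Set.sdiff_subset) (hq.seg_subset le_rfl (by omega)) ?_ hE.2.1
    (hq.conn (by omega) (by omega)) (by simp) (by simp) ?_ ?_ ?_ hEv ?_ ?_
  · simpa using conn_singleton u
  · exact Set.disjoint_left.mpr fun x hx' hx => (hE.1 hx').2 (by
      obtain ⟨t, h1, h2, rfl⟩ := mem_seg.mp hx; exact mem_seg_of_le h1 (by omega))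
  · exact (touch_seg_left.mpr ⟨m, hm, le_rfl, htm⟩).symm
  · simpa using hEu
  · simp only [Set.union_empty, hq.singleton_left]
    exact hq.touch le_rfl rfl hm (by omega)
  · rw [hq.singleton_right, touch_comm]
    exact hq.not_touch (by omega) le_rfl (by omega)

lemma IsComp.of_seg_rev {D E : Set V} {k : ℕ} {q : ℕ → V} (hk : 1 ≤ k)
    (hE : IsComp G (D \ seg q 1 k) E) :
    IsComp G (D \ seg (fun i => q (k + 1 - i)) 1 k) E := by
  rwa [IndPath.seg_rev (by omega) (by omega), Nat.add_sub_cancel_left, Nat.add_sub_cancel]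

lemma Thick.isPathComp_of_two_le {D : Set V} {u v : V} {U W A : Set V} {k : ℕ} {q : ℕ → V}
    (hG : ¬ IsInducedMinor gem G) (hB : Biconn G) (hD : IsComp G {u, v}ᶜ D)
    (h : Thick G D u v U W A) (hq : IndPath G D u v k q) (hk : 2 ≤ k) : IsPathComp G D u v := by
  refine ⟨k, q, hq, Set.Subset.antisymm ?_ (hq.seg_subset le_rfl le_rfl)⟩
  by_contra hcon
  obtain ⟨x, hxD, hxq⟩ := Set.not_subset.mp hcon
  obtain ⟨E, hE, hxE⟩ := exists_isComp (G := G) (D := D \ seg q 1 k) ⟨hxD, hxq⟩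
  have hD' : IsComp G {v, u}ᶜ D := by rwa [Set.pair_comm]
  have hE' := hE.of_seg_rev hq.pos
  by_cases hEv : Touch G {v} E
  swap
  · exact h.elim_of_not_touch_right hG hB hD hq hE hEv
  by_cases hEu : Touch G {u} E
  swap
  · exact h.symm.elim_of_not_touch_right hG hB hD' hq.rev hE' hEu
  obtain ⟨m, hm, hmk, htm⟩ := hq.exists_touch hD.2.1 hE
  rcases Nat.lt_or_ge m k with hlt | hge
  · exact h.elim_of_touch_lt hG hq hE hEu hEv hm hlt htm
  · refine h.symm.elim_of_touch_lt (m := 1) hG hq.rev hE' hEv hEu le_rfl (by omega) ?_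
    have : m = k := by omega
    subst this
    simpa using htm

lemma Thick.elim_of_left_only {D : Set V} {u v : V} {U W A Z : Set V} {q : V}
    (hG : ¬ IsInducedMinor gem G) (h : Thick G D u v U W A) (hqD : q ∈ D) (hqu : G.Adj u q)
    (hqv : G.Adj v q) (hZ : Conn G Z) (hZD : Z ⊆ D) (hqZ : q ∉ Z) (htq : Touch G {q} Z)
    (hZu : Touch G {u} Z) (hZv : ¬ Touch G {v} Z) : False := by
  refine h.elim hG (X := ∅) (c := {q}) (d := Z) (Set.empty_subset _) (by simpa using hqD) hZD ?_
    (conn_singleton q) hZ (by simp) (by simp) (by simpa using hqZ) htq ?_ ?_ ?_ hZv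
  · simpa using conn_singleton u
  · simpa using hqu
  · simpa using hqv
  · simpa using hZu

lemma Thick.isCompleteComp_of_adj {D : Set V} {u v : V} {U W A : Set V} {p : V}
    (hG : ¬ IsInducedMinor gem G) (hB : Biconn G) (hD : IsComp G {u, v}ᶜ D)
    (h : Thick G D u v U W A) (hpD : p ∈ D) (hpu : G.Adj u p) (hpv : G.Adj v p) :
    IsCompleteComp G D u v := by
  by_contra hcon
  have huD : u ∉ D := fun hu => hD.1 hu (by simp)
  have hvD : v ∉ D := fun hv => hD.1 hv (by simp)
  set F : Set V := {x ∈ D | G.Adj u x ∧ G.Adj v x} with hF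
  have hne : F ≠ D := fun hFD => hcon fun x hx => by
    rw [← hFD] at hx; exact hx.2
  obtain ⟨q, ⟨hqD, hqu, hqv⟩, z, ⟨hzD, hzF⟩, hqz⟩ :=
    hD.2.1.2 F (fun x hx => hx.1) ⟨p, hpD, hpu, hpv⟩ hne
  have hzF' : ¬ (G.Adj u z ∧ G.Adj v z) := fun hz => hzF ⟨hzD, hz⟩
  have hqz' : q ≠ z := hqz.ne
  by_cases hzu : G.Adj u z
  · exact h.elim_of_left_only hG (Z := {z}) hqD hqu hqv (conn_singleton z) (by simpa using hzD)
      (by simpa using hqz') (by simpa using hqz) (by simpa using hzu) (by simp; tauto)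
  by_cases hzv : G.Adj v z
  · exact h.symm.elim_of_left_only hG (Z := {z}) hqD hqv hqu (conn_singleton z) (by simpa using hzD)
      (by simpa using hqz') (by simpa using hqz) (by simpa using hzv) (by simp; tauto)
  obtain ⟨Z, hZ, hzZ⟩ := exists_isComp (G := G) (D := {x ∈ D | ¬ G.Adj u x ∧ ¬ G.Adj v x})
    ⟨hzD, hzu, hzv⟩
  have hZD : Z ⊆ D := fun x hx => (hZ.1 hx).1
  have hqZ : q ∉ Z := fun hq => (hZ.1 hq).2.1 hqu
  have hZu : ¬ Touch G {u} Z := by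
    rintro ⟨x, hx, y, hy, hxy⟩
    rw [Set.mem_singleton_iff.mp hx] at hxy
    exact (hZ.1 hy).2.1 hxy
  have hZv : ¬ Touch G {v} Z := by
    rintro ⟨x, hx, y, hy, hxy⟩
    rw [Set.mem_singleton_iff.mp hx] at hxy
    exact (hZ.1 hy).2.2 hxy
  have hqZt : Touch G {q} Z := ⟨q, rfl, z, hzZ, hqz⟩
  by_cases hT : Touch G Z (D \ (F ∪ Z))
  · obtain ⟨s, hs, t, ⟨htD, htn⟩, hst⟩ := hT
    rw [Set.mem_union, not_or] at htn
    have ht : ¬ (G.Adj u t ∧ G.Adj v t) := fun ht => htn.1 ⟨htD, ht⟩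
    have ht' : G.Adj u t ∨ G.Adj v t := by
      by_contra hno
      rw [not_or] at hno
      exact htn.2 (hZ.mem_of_adj hs ⟨htD, hno⟩ hst)
    have hconn : Conn G (Z ∪ {t}) := hZ.2.1.union (conn_singleton t) ⟨s, hs, t, rfl, hst⟩
    have hsub : Z ∪ {t} ⊆ D := Set.union_subset hZD (by simpa using htD)
    have hqt : q ∉ Z ∪ {t} := by
      rintro (hq | hq)
      · exact hqZ hq
      · rw [Set.mem_singleton_iff.mp hq] at hqu hqv
        exact ht ⟨hqu, hqv⟩
    rcases ht' with htu | htv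
    · exact h.elim_of_left_only hG hqD hqu hqv hconn hsub hqt
        (touch_union_right.mpr (Or.inl hqZt)) (touch_union_right.mpr (Or.inr (by simpa using htu)))
        (by rw [touch_union_right, touch_singleton]; tauto)
    · exact h.symm.elim_of_left_only hG hqD hqv hqu hconn hsub hqt
        (touch_union_right.mpr (Or.inl hqZt)) (touch_union_right.mpr (Or.inr (by simpa using htv)))
        (by rw [touch_union_right, touch_singleton]; tauto)
  · obtain ⟨a, ha, b, hbZ, hbq, hab⟩ := hB.2 q Z hZ.2.1.1 hqZ
      ⟨u, fun hu => huD (hZD hu), fun hu => huD (hu ▸ hqD)⟩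
    have hbu : b ≠ u := by rintro rfl; exact hZu ⟨b, rfl, a, ha, hab.symm⟩
    have hbv : b ≠ v := by rintro rfl; exact hZv ⟨b, rfl, a, ha, hab.symm⟩
    have hbD : b ∈ D := hD.mem_of_adj (hZD ha) (by simp [hbu, hbv]) hab
    have hbF : b ∈ F := by
      by_contra hbF
      exact hT ⟨a, ha, b, ⟨hbD, by simp [hbF, hbZ]⟩, hab⟩
    refine h.elim hG (X := {b}) (c := {q}) (d := Z) (by simpa using hbD) (by simpa using hqD) hZD ?_
      (conn_singleton q) hZ.2.1 (by simpa using hbq) (by simpa using hbZ)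
      (by simpa using hqZ) hqZt ?_ ?_ ?_ hZv
    · exact (conn_singleton u).union (conn_singleton b) (by simpa using hbF.2.1)
    · exact touch_union_left.mpr (Or.inl (by simpa using hqu))
    · simpa using hqv
    · exact touch_union_left.mpr (Or.inr ⟨b, rfl, a, ha, hab.symm⟩)

lemma Thick.goodComp {D : Set V} {u v : V} {U W A : Set V}
    (hG : ¬ IsInducedMinor gem G) (hB : Biconn G) (huv : u ≠ v) (hD : IsComp G {u, v}ᶜ D)
    (h : Thick G D u v U W A) : GoodComp G D u v := by
  obtain ⟨k, q, hq⟩ := exists_indPath hD.2.1 (fun hu => hD.1 hu (by simp))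
    (fun hv => hD.1 hv (by simp)) huv (hB.touch_left huv hD) (hB.touch_right huv hD)
  rcases Nat.lt_or_ge 1 k with hk | hk
  · exact Or.inl (h.isPathComp_of_two_le hG hB hD hq hk)
  · have hk1 : k = 1 := le_antisymm hk hq.pos
    subst hk1
    have h1 := hq.adj_succ (i := 0) (by omega)
    have h2 := hq.adj_succ (i := 1) (by omega)
    rw [hq.zero] at h1
    have h3 : q (1 + 1) = v := hq.last
    rw [h3] at h2
    exact Or.inr (h.isCompleteComp_of_adj hG hB hD (hq.mem 1 le_rfl le_rfl) h1 h2.symm)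

end TwoCut

section TwoCutBoth

variable {V : Type*} {G : SimpleGraph V}

lemma disjoint_seg_left {q : ℕ → V} {a b : ℕ} {S : Set V} (h : ∀ i, a ≤ i → i ≤ b → q i ∉ S) :
    Disjoint (seg q a b) S := by
  rw [Set.disjoint_left]
  intro x hx
  obtain ⟨i, h1, h2, rfl⟩ := mem_seg.mp hx
  exact h i h1 h2

lemma not_touch_seg_left {q : ℕ → V} {a b : ℕ} {S : Set V}
    (h : ∀ i, a ≤ i → i ≤ b → ¬ Touch G {q i} S) : ¬ Touch G (seg q a b) S := by
  rw [touch_seg_left]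
  rintro ⟨i, h1, h2, h3⟩
  exact h i h1 h2 h3

lemma IndPath.notMem_of_disjoint {D S : Set V} {u v : V} {k : ℕ} {q : ℕ → V}
    (hq : IndPath G D u v k q) (hSD : Disjoint S (seg q 1 k)) (hu : u ∉ S) (hv : v ∉ S) {i : ℕ}
    (hi : i ≤ k + 1) : q i ∉ S := by
  intro h
  rcases Nat.eq_zero_or_pos i with rfl | h0
  · rw [hq.zero] at h; exact hu h
  · rcases Nat.lt_or_ge k i with h2 | h2
    · have : i = k + 1 := by omega
      subst this
      rw [hq.last] at h; exact hv h
    · exact Set.disjoint_left.mp hSD h (mem_seg_of_le h0 h2)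

lemma IndPath.notMem_comp {D E : Set V} {u v : V} {k : ℕ} {q : ℕ → V}
    (hq : IndPath G D u v k q) (hE : IsComp G (D \ seg q 1 k) E) {i : ℕ} (hi : i ≤ k + 1) :
    q i ∉ E :=
  hq.notMem_of_disjoint (Set.disjoint_left.mpr fun _ hx => (hE.1 hx).2)
    (fun h => hq.left_notMem (hE.1 h).1) (fun h => hq.right_notMem (hE.1 h).1) hi

lemma exists_thick_or_isPathComp {D : Set V} {u v o : V} (hB : Biconn G) (huv : u ≠ v)
    (hD : IsComp G {u, v}ᶜ D) (ho : o ∉ D) (hou : o ≠ u) (hov : o ≠ v) :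
    (∃ U W A, Thick G D u v U W A) ∨ (¬ G.Adj u v ∧ ∃ O, IsComp G {u, v}ᶜ O ∧ O ≠ D ∧
      IsPathComp G O u v ∧ ∀ x, x = u ∨ x = v ∨ x ∈ D ∨ x ∈ O) := by
  have huD : u ∉ D := fun hu => hD.1 hu (by simp)
  have hvD : v ∉ D := fun hv => hD.1 hv (by simp)
  obtain ⟨O, hO, hoO⟩ := exists_isComp (G := G) (D := {u, v}ᶜ) (x := o) (by simp [hou, hov])
  have hOD : O ≠ D := by rintro rfl; exact ho hoO
  have huO : u ∉ O := fun hu => hO.1 hu (by simp)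
  have hvO : v ∉ O := fun hv => hO.1 hv (by simp)
  have hOu := hB.touch_left huv hO
  have hOv := hB.touch_right huv hO
  have hnt : ¬ Touch G O D := hO.not_touch_of_ne hD hOD
  have hdj : Disjoint O D := hO.disjoint_of_ne hD hOD
  by_cases hadj : G.Adj u v
  · refine Or.inl ⟨{u}, {v}, O, rfl, rfl, conn_singleton u, conn_singleton v, hO.2.1, ?_, ?_,
      hdj, ?_, ?_, ?_, ?_, hOu, hOv, hnt, ?_, ?_⟩ <;> simp_all
  by_cases hex : ∃ O', IsComp G {u, v}ᶜ O' ∧ O' ≠ D ∧ O' ≠ O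
  · obtain ⟨O', hO', hO'D, hO'O⟩ := hex
    have huO' : u ∉ O' := fun hu => hO'.1 hu (by simp)
    have hvO' : v ∉ O' := fun hv => hO'.1 hv (by simp)
    refine Or.inl ⟨{u} ∪ O, {v}, O', Or.inl rfl, rfl, hO.2.1.insert hOu, conn_singleton v, hO'.2.1,
      ?_, by simpa using hvD, hO'.disjoint_of_ne hD hO'D, ?_, ?_, by simpa using hvO', ?_, ?_,
      hB.touch_right huv hO', hO'.not_touch_of_ne hD hO'D, ?_, ?_⟩
    · rw [Set.disjoint_union_left]; exact ⟨by simpa using huD, hdj⟩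
    · rw [Set.disjoint_union_left]; exact ⟨by simpa using huv, by simpa using hvO⟩
    · rw [Set.disjoint_union_left]
      exact ⟨by simpa using huO', (hO'.disjoint_of_ne hO hO'O).symm⟩
    · rw [touch_union_left]; exact Or.inr hOv.symm
    · rw [touch_union_left]; exact Or.inl (hB.touch_left huv hO')
    · rintro x hx y (hy | hy) hxy
      · exact hy
      · exact absurd ⟨y, hy, x, hx, hxy.symm⟩ hnt
    · rintro x hx y hy hxy
      exact hy
  have hcov : ∀ x, x = u ∨ x = v ∨ x ∈ D ∨ x ∈ O := by
    intro x
    by_cases hxu : x = u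
    · exact Or.inl hxu
    by_cases hxv : x = v
    · exact Or.inr (Or.inl hxv)
    obtain ⟨O', hO', hxO'⟩ := exists_isComp (G := G) (D := {u, v}ᶜ) (x := x) (by simp [hxu, hxv])
    by_cases h1 : O' = D
    · subst h1; tauto
    by_cases h2 : O' = O
    · subst h2; tauto
    exact absurd ⟨O', hO', h1, h2⟩ hex
  obtain ⟨k, q, hq⟩ := exists_indPath hO.2.1 huO hvO huv hOu hOv
  by_cases hpath : O = seg q 1 k
  · exact Or.inr ⟨hadj, O, hO, hOD, ⟨k, q, hq, hpath⟩, hcov⟩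
  left
  obtain ⟨x, hxO, hxq⟩ : ∃ x ∈ O, x ∉ seg q 1 k := by
    by_contra hcon
    push Not at hcon
    exact hpath (Set.Subset.antisymm hcon (hq.seg_subset le_rfl le_rfl))
  obtain ⟨E, hE, hxE⟩ := exists_isComp (G := G) (D := O \ seg q 1 k) ⟨hxO, hxq⟩
  obtain ⟨i, j, hij, hj, hti, htj, -⟩ := hq.exists_extremal hB hO hE
  have hEO : E ⊆ O := hE.1.trans Set.sdiff_subset
  have hqD : ∀ t ≤ k + 1, q t ∉ D := fun t ht => hq.notMem_of_disjoint
    (hdj.symm.mono_right (hq.seg_subset le_rfl le_rfl)) huD hvD ht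
  have honly : ∀ x ∈ D, ∀ t ≤ k + 1, G.Adj x (q t) → t = 0 ∨ t = k + 1 := by
    intro x hx t ht hxt
    by_contra hcon
    exact hnt ⟨q t, hq.mem t (by omega) (by omega), x, hx, hxt.symm⟩
  refine ⟨seg q 0 i, seg q (i + 1) (k + 1), E, hq.left_mem i, hq.right_mem (by omega),
    hq.conn (by omega) (by omega), hq.conn (by omega) (by omega), hE.2.1,
    disjoint_seg_left fun t _ _ => hqD t (by omega),
    disjoint_seg_left fun t _ _ => hqD t (by omega), hdj.mono_left hEO,
    hq.disjoint (by omega) (by omega),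
    disjoint_seg_left fun t _ _ => hq.notMem_comp hE (by omega),
    disjoint_seg_left fun t _ _ => hq.notMem_comp hE (by omega),
    hq.touch (by omega) rfl (by omega) le_rfl, touch_seg_left.mpr ⟨i, by omega, le_rfl, hti⟩,
    touch_seg_left.mpr ⟨j, by omega, hj, htj⟩, fun h => hnt (h.mono hEO subset_rfl), ?_, ?_⟩
  · intro x hx y hy hxy
    obtain ⟨t, h1, h2, rfl⟩ := mem_seg.mp hy
    rcases honly x hx t (by omega) hxy with rfl | h3
    · exact hq.zero
    · omega
  · intro x hx y hy hxy
    obtain ⟨t, h1, h2, rfl⟩ := mem_seg.mp hy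
    rcases honly x hx t (by omega) hxy with rfl | h3
    · omega
    · rw [h3]; exact hq.last

/-- A component `D` of the complement of `{u, v}`, together with another one, `W`, such that both
`u` and `v` have at least two neighbours in `D`. -/
structure DoublyAttached (G : SimpleGraph V) (D W : Set V) (u v : V) : Prop where
  ne : u ≠ v
  comp : IsComp G {u, v}ᶜ D
  comp' : IsComp G {u, v}ᶜ W
  neW : W ≠ D
  left : ∀ x, ∃ y ∈ D, y ≠ x ∧ G.Adj u y
  right : ∀ x, ∃ y ∈ D, y ≠ x ∧ G.Adj v y

lemma DoublyAttached.symm {D W : Set V} {u v : V} (h : DoublyAttached G D W u v) :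
    DoublyAttached G D W v u where
  ne := h.ne.symm
  comp := by rw [Set.pair_comm]; exact h.comp
  comp' := by rw [Set.pair_comm]; exact h.comp'
  neW := h.neW
  left := h.right
  right := h.left

lemma DoublyAttached.exists_comp_right {D W : Set V} {u v : V} {k : ℕ} {q : ℕ → V}
    (h : DoublyAttached G D W u v) (hq : IndPath G D u v k q) :
    ∃ E, IsComp G (D \ seg q 1 k) E ∧ Touch G {v} E := by
  obtain ⟨y, hyD, hyk, hvy⟩ := h.right (q k)
  have hys : y ∉ seg q 1 k := by
    intro hys
    obtain ⟨i, h1, h2, rfl⟩ := mem_seg.mp hys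
    rw [← hq.last, adj_comm, hq.adj i (k + 1) (by omega) le_rfl (by omega)] at hvy
    exact hyk (by congr 1; omega)
  obtain ⟨E, hE, hyE⟩ := exists_isComp (G := G) (D := D \ seg q 1 k) ⟨hyD, hys⟩
  exact ⟨E, hE, v, rfl, y, hyE, hvy⟩

lemma DoublyAttached.touch_right_of_touch_left {D W E : Set V} {u v : V} {k : ℕ} {q : ℕ → V}
    (hG : ¬ IsInducedMinor gem G) (hB : Biconn G) (h : DoublyAttached G D W u v)
    (hq : IndPath G D u v k q) (hE : IsComp G (D \ seg q 1 k) E) (hEu : Touch G {u} E) :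
    Touch G {v} E := by
  by_contra hEv
  obtain ⟨E', hE', hE'v⟩ := h.exists_comp_right hq
  have hEE' : E ≠ E' := by rintro rfl; exact hEv hE'v
  have ntEE' := hE.not_touch_of_ne hE' hEE'
  have djEE' := hE.disjoint_of_ne hE' hEE'
  obtain ⟨i, j, hij, hjk, -, htj, hm⟩ := hq.exists_extremal hB h.comp hE
  obtain ⟨i', j', hij', hjk', hti', -, hm'⟩ := hq.exists_extremal hB h.comp hE'
  have hj : j ≤ k := by
    by_contra hcon
    have : j = k + 1 := by omega
    subst this
    rw [hq.last] at htj
    exact hEv htj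
  have hEu' : Touch G {q 0} E := by rw [hq.zero]; exact hEu
  have hE'v' : Touch G {q (k + 1)} E' := by rw [hq.last]; exact hE'v
  have hi0 := (hm 0 (by omega) hEu').1
  have hi'k := (hm' (k + 1) le_rfl hE'v').1
  have hED : E ⊆ D := hE.1.trans Set.sdiff_subset
  have hE'D : E' ⊆ D := hE'.1.trans Set.sdiff_subset
  have ntWD := h.comp'.not_touch_of_ne h.comp h.neW
  have djWD := h.comp'.disjoint_of_ne h.comp h.neW
  have ntW : ∀ S ⊆ D, ¬ Touch G W S := fun S hS ht => ntWD (ht.mono subset_rfl hS)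
  have djW : ∀ S ⊆ D, Disjoint W S := fun S hS => djWD.mono_right hS
  have hWq : ∀ t ≤ k + 1, q t ∉ W := fun t ht => hq.notMem_of_disjoint
    (djW _ (hq.seg_subset le_rfl le_rfl)) (fun hu => h.comp'.1 hu (by simp))
    (fun hv => h.comp'.1 hv (by simp)) ht
  have tWu : Touch G {q 0} W := by rw [hq.zero]; exact hB.touch_left h.ne h.comp'
  have tWv : Touch G {q (k + 1)} W := by rw [hq.last]; exact hB.touch_right h.ne h.comp'
  have notj : ∀ t, j < t → t ≤ k + 1 → ¬ Touch G {q t} E := fun t h1 h2 h3 => by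
    have := hm t h2 h3; omega
  have noti' : ∀ t, t < i' → ¬ Touch G {q t} E' := fun t h1 h3 => by
    have := hm' t (by omega) h3; omega
  have hqE : ∀ t ≤ k + 1, q t ∉ E := fun t ht => hq.notMem_comp hE ht
  have hqE' : ∀ t ≤ k + 1, q t ∉ E' := fun t ht => hq.notMem_comp hE' ht
  rcases Nat.lt_trichotomy i' j with hlt | heq | hgt
  · apply hG
    apply isInducedMinor_gem (H := seg q 0 i' ∪ E') (A := W) (B := seg q (j + 1) (k + 1))
      (C := seg q (i' + 1) j) (D := E)
    · exact (hq.conn (by omega) (by omega)).union hE'.2.1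
        (touch_seg_left.mpr ⟨i', by omega, le_rfl, hti'⟩)
    · exact h.comp'.2.1
    · exact hq.conn (by omega) (by omega)
    · exact hq.conn (by omega) (by omega)
    · exact hE.2.1
    · exact Set.disjoint_union_left.mpr
        ⟨disjoint_seg_left fun t _ _ => hWq t (by omega), (djW _ hE'D).symm⟩
    · exact Set.disjoint_union_left.mpr ⟨hq.disjoint (by omega) (by omega),
        (disjoint_seg_left fun t _ _ => hqE' t (by omega)).symm⟩
    · exact Set.disjoint_union_left.mpr ⟨hq.disjoint (by omega) (by omega),
        (disjoint_seg_left fun t _ _ => hqE' t (by omega)).symm⟩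
    · exact Set.disjoint_union_left.mpr
        ⟨disjoint_seg_left fun t _ _ => hqE t (by omega), djEE'.symm⟩
    · exact (disjoint_seg_left fun t _ _ => hWq t (by omega)).symm
    · exact (disjoint_seg_left fun t _ _ => hWq t (by omega)).symm
    · exact djW _ hED
    · exact (hq.disjoint (by omega) (by omega)).symm
    · exact disjoint_seg_left fun t _ _ => hqE t (by omega)
    · exact disjoint_seg_left fun t _ _ => hqE t (by omega)
    · exact touch_union_left.mpr (Or.inl (touch_seg_left.mpr ⟨0, le_rfl, by omega, tWu⟩))
    · exact touch_union_left.mpr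
        (Or.inr (touch_seg_left.mpr ⟨k + 1, by omega, le_rfl, hE'v'⟩).symm)
    · exact touch_union_left.mpr (Or.inl (hq.touch (by omega) rfl (by omega) (by omega)))
    · exact touch_union_left.mpr (Or.inl (touch_seg_left.mpr ⟨0, le_rfl, by omega, hEu'⟩))
    · exact (touch_seg_left.mpr ⟨k + 1, by omega, le_rfl, tWv⟩).symm
    · exact (hq.touch (by omega) rfl (by omega) (by omega)).symm
    · exact touch_seg_left.mpr ⟨j, by omega, le_rfl, htj⟩
    · exact ntW _ (hq.seg_subset (by omega) hj)
    · exact ntW _ hED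
    · exact not_touch_seg_left fun t h1 h2 => notj t (by omega) h2
  · apply hG
    apply isInducedMinor_gem (H := seg q j j) (A := E) (B := seg q 0 (j - 1))
      (C := W ∪ seg q (j + 1) (k + 1)) (D := E')
    · exact hq.conn le_rfl hjk
    · exact hE.2.1
    · exact hq.conn (by omega) (by omega)
    · exact h.comp'.2.1.union (hq.conn (by omega) (by omega))
        (touch_seg_left.mpr ⟨k + 1, by omega, le_rfl, tWv⟩).symm
    · exact hE'.2.1
    · exact disjoint_seg_left fun t _ _ => hqE t (by omega)
    · exact (hq.disjoint (by omega) (by omega)).symm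
    · exact Set.disjoint_union_right.mpr
        ⟨disjoint_seg_left fun t _ _ => hWq t (by omega), hq.disjoint (by omega) (by omega)⟩
    · exact disjoint_seg_left fun t _ _ => hqE' t (by omega)
    · exact (disjoint_seg_left fun t _ _ => hqE t (by omega)).symm
    · exact Set.disjoint_union_right.mpr
        ⟨(djW _ hED).symm, (disjoint_seg_left fun t _ _ => hqE t (by omega)).symm⟩
    · exact djEE'
    · exact Set.disjoint_union_right.mpr
        ⟨disjoint_seg_left fun t _ _ => hWq t (by omega), hq.disjoint (by omega) (by omega)⟩
    · exact disjoint_seg_left fun t _ _ => hqE' t (by omega)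
    · exact Set.disjoint_union_left.mpr
        ⟨djW _ hE'D, disjoint_seg_left fun t _ _ => hqE' t (by omega)⟩
    · exact touch_seg_left.mpr ⟨j, le_rfl, le_rfl, htj⟩
    · exact (hq.touch (by omega) (by omega) (by omega) (by omega)).symm
    · exact touch_union_right.mpr (Or.inr (hq.touch (by omega) (by omega) (by omega) (by omega)))
    · exact touch_seg_left.mpr ⟨j, le_rfl, le_rfl, heq ▸ hti'⟩
    · exact (touch_seg_left.mpr ⟨0, le_rfl, by omega, hEu'⟩).symm
    · exact touch_union_right.mpr (Or.inl (touch_seg_left.mpr ⟨0, le_rfl, by omega, tWu⟩))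
    · exact touch_union_left.mpr (Or.inr (touch_seg_left.mpr ⟨k + 1, by omega, le_rfl, hE'v'⟩))
    · rw [touch_union_right, not_or, touch_comm, touch_comm (S := E)]
      exact ⟨ntW _ hED, not_touch_seg_left fun t h1 h2 => notj t (by omega) h2⟩
    · exact ntEE'
    · exact not_touch_seg_left fun t h1 h2 => noti' t (by omega)
  · apply hG
    apply isInducedMinor_gem (H := {q 0} ∪ (W ∪ {q (k + 1)})) (A := E) (B := seg q 1 j)
      (C := seg q (j + 1) k) (D := E')
    · exact (conn_singleton _).union (h.comp'.2.1.union (conn_singleton _) tWv.symm)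
        (touch_union_right.mpr (Or.inl tWu))
    · exact hE.2.1
    · exact hq.conn (by omega) (by omega)
    · exact hq.conn (by omega) (by omega)
    · exact hE'.2.1
    · simp only [Set.disjoint_union_left, Set.disjoint_singleton_left]
      exact ⟨hqE 0 (by omega), djW _ hED, hqE _ le_rfl⟩
    · simp only [Set.disjoint_union_left, ← seg_self]
      exact ⟨hq.disjoint (by omega) (by omega), djW _ (hq.seg_subset le_rfl hj),
        (hq.disjoint (by omega) (by omega)).symm⟩
    · simp only [Set.disjoint_union_left, ← seg_self]
      exact ⟨hq.disjoint (by omega) (by omega), djW _ (hq.seg_subset (by omega) le_rfl),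
        (hq.disjoint (by omega) (by omega)).symm⟩
    · simp only [Set.disjoint_union_left, Set.disjoint_singleton_left]
      exact ⟨hqE' 0 (by omega), djW _ hE'D, hqE' _ le_rfl⟩
    · exact (disjoint_seg_left fun t _ _ => hqE t (by omega)).symm
    · exact (disjoint_seg_left fun t _ _ => hqE t (by omega)).symm
    · exact djEE'
    · exact hq.disjoint (by omega) (by omega)
    · exact disjoint_seg_left fun t _ _ => hqE' t (by omega)
    · exact disjoint_seg_left fun t _ _ => hqE' t (by omega)
    · exact touch_union_left.mpr (Or.inl hEu')
    · rw [← seg_self q 0]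
      exact touch_union_left.mpr (Or.inl (hq.touch (by omega) rfl (by omega) (by omega)))
    · rw [← seg_self q (k + 1)]
      exact touch_union_left.mpr (Or.inr (touch_union_left.mpr
        (Or.inr (hq.touch (by omega) rfl (by omega) (by omega)).symm)))
    · exact touch_union_left.mpr (Or.inr (touch_union_left.mpr (Or.inr hE'v')))
    · exact (touch_seg_left.mpr ⟨j, by omega, le_rfl, htj⟩).symm
    · exact hq.touch (by omega) rfl (by omega) (by omega)
    · exact touch_seg_left.mpr ⟨i', by omega, by omega, hti'⟩
    · rw [touch_comm]; exact not_touch_seg_left fun t h1 h2 => notj t (by omega) (by omega)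
    · exact ntEE'
    · exact not_touch_seg_left fun t h1 h2 => noti' t (by omega)

end TwoCutBoth

section GoodCut

variable {V : Type*} {G : SimpleGraph V}

lemma DoublyAttached.touch_left_of_touch_right {D W E : Set V} {u v : V} {k : ℕ} {q : ℕ → V}
    (hG : ¬ IsInducedMinor gem G) (hB : Biconn G) (h : DoublyAttached G D W u v)
    (hq : IndPath G D u v k q) (hE : IsComp G (D \ seg q 1 k) E) (hEv : Touch G {v} E) :
    Touch G {u} E :=
  h.symm.touch_right_of_touch_left hG hB hq.rev (hE.of_seg_rev hq.pos) hEv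

lemma DoublyAttached.elim_of_two_le {D W E : Set V} {u v : V} {k m : ℕ} {q : ℕ → V}
    (hG : ¬ IsInducedMinor gem G) (hB : Biconn G) (h : DoublyAttached G D W u v)
    (hq : IndPath G D u v k q) (hE : IsComp G (D \ seg q 1 k) E) (hEu : Touch G {u} E)
    (hEv : Touch G {v} E) (hm : 2 ≤ m) (hmk : m ≤ k) (htm : Touch G {q m} E) : False := by
  have hED : E ⊆ D := hE.1.trans Set.sdiff_subset
  have ntWD := h.comp'.not_touch_of_ne h.comp h.neW
  have djWD := h.comp'.disjoint_of_ne h.comp h.neW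
  have hWu : u ∉ W := fun hu => h.comp'.1 hu (by simp)
  have hWq : ∀ t ≤ k + 1, q t ∉ W := fun t ht => hq.notMem_of_disjoint
    (djWD.mono_right (hq.seg_subset le_rfl le_rfl)) hWu (fun hv => h.comp'.1 hv (by simp)) ht
  have hqE : ∀ t ≤ k + 1, q t ∉ E := fun t ht => hq.notMem_comp hE ht
  have hEv' : Touch G {q (k + 1)} E := by rw [hq.last]; exact hEv
  have tWv : Touch G {q (k + 1)} W := by rw [hq.last]; exact hB.touch_right h.ne h.comp'
  apply hG
  apply isInducedMinor_gem (H := {u} ∪ E) (A := W) (B := seg q (m + 1) (k + 1))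
    (C := seg q m m) (D := seg q 1 (m - 1))
  · exact hE.2.1.insert hEu
  · exact h.comp'.2.1
  · exact hq.conn (by omega) (by omega)
  · exact hq.conn (by omega) (by omega)
  · exact hq.conn (by omega) (by omega)
  · exact Set.disjoint_union_left.mpr ⟨by simpa using hWu, (djWD.mono_right hED).symm⟩
  · rw [hq.singleton_left]
    exact Set.disjoint_union_left.mpr ⟨hq.disjoint (by omega) (by omega),
      (disjoint_seg_left fun t _ _ => hqE t (by omega)).symm⟩
  · rw [hq.singleton_left]
    exact Set.disjoint_union_left.mpr ⟨hq.disjoint (by omega) (by omega),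
      (disjoint_seg_left fun t _ _ => hqE t (by omega)).symm⟩
  · rw [hq.singleton_left]
    exact Set.disjoint_union_left.mpr ⟨hq.disjoint (by omega) (by omega),
      (disjoint_seg_left fun t _ _ => hqE t (by omega)).symm⟩
  · exact (disjoint_seg_left fun t _ _ => hWq t (by omega)).symm
  · exact (disjoint_seg_left fun t _ _ => hWq t (by omega)).symm
  · exact (disjoint_seg_left fun t _ _ => hWq t (by omega)).symm
  · exact (hq.disjoint (by omega) (by omega)).symm
  · exact (hq.disjoint (by omega) (by omega)).symm
  · exact (hq.disjoint (by omega) (by omega)).symm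
  · exact touch_union_left.mpr (Or.inl (hB.touch_left h.ne h.comp'))
  · exact touch_union_left.mpr (Or.inr (touch_seg_left.mpr ⟨k + 1, by omega, le_rfl, hEv'⟩).symm)
  · exact touch_union_left.mpr (Or.inr (touch_seg_left.mpr ⟨m, le_rfl, le_rfl, htm⟩).symm)
  · rw [hq.singleton_left]
    exact touch_union_left.mpr (Or.inl (hq.touch le_rfl rfl (by omega) (by omega)))
  · exact (touch_seg_left.mpr ⟨k + 1, by omega, le_rfl, tWv⟩).symm
  · exact (hq.touch le_rfl rfl (by omega) le_rfl).symm
  · exact (hq.touch (by omega) (by omega) le_rfl (by omega)).symm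
  · exact fun ht => ntWD (ht.mono subset_rfl (hq.seg_subset (by omega) hmk))
  · exact fun ht => ntWD (ht.mono subset_rfl (hq.seg_subset le_rfl (by omega)))
  · rw [touch_comm]; exact hq.not_touch (by omega) le_rfl (by omega)

lemma DoublyAttached.length_eq_one {D W : Set V} {u v : V} {k : ℕ} {q : ℕ → V}
    (hG : ¬ IsInducedMinor gem G) (hB : Biconn G) (h : DoublyAttached G D W u v)
    (hq : IndPath G D u v k q) : k = 1 := by
  by_contra hk
  have hk2 : 2 ≤ k := by have := hq.pos; omega
  obtain ⟨E, hE, hEv⟩ := h.exists_comp_right hq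
  have hEu := h.touch_left_of_touch_right hG hB hq hE hEv
  obtain ⟨m, h1, h2, htm⟩ := hq.exists_touch h.comp.2.1 hE
  rcases Nat.lt_or_ge m 2 with hm | hm
  · refine h.symm.elim_of_two_le (m := k) hG hB hq.rev (hE.of_seg_rev hq.pos) hEv hEu hk2 le_rfl ?_
    have : m = 1 := by omega
    subst this
    simpa using htm
  · exact h.elim_of_two_le hG hB hq hE hEu hEv hm h2 htm

lemma indPath_of_adj {D : Set V} {u v q : V} (huv : u ≠ v) (hu : u ∉ D) (hv : v ∉ D) (hq : q ∈ D)
    (hqu : G.Adj u q) (hqv : G.Adj v q) :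
    IndPath G D u v 1 (fun i => if i = 0 then u else if i = 1 then q else v) := by
  refine ⟨le_rfl, by simp, by simp, ?_, hu, hv, ?_, ?_⟩
  · intro i h1 h2
    have : i = 1 := by omega
    subst this
    simpa using hq
  · intro i j hij hj hne
    have : (i = 0 ∧ j = 1) ∨ (i = 1 ∧ j = 2) := by omega
    rcases this with ⟨rfl, rfl⟩ | ⟨rfl, rfl⟩
    · simpa using hqu
    · simpa using hqv.symm
  · intro i j hij hj
    have : (i = 0 ∧ j = 1) ∨ (i = 1 ∧ j = 2) ∨ (i = 0 ∧ j = 2) := by omega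
    rcases this with ⟨rfl, rfl⟩ | ⟨rfl, rfl⟩ | ⟨rfl, rfl⟩
    · simpa using hqu.ne
    · simpa using hqv.ne.symm
    · simpa using huv

/-- A connected part `d` adjacent to the full vertex `q` which sees `u` but not `v`. -/
lemma DoublyAttached.elim_of_left_only {D W E d : Set V} {u v q : V}
    (hG : ¬ IsInducedMinor gem G) (hB : Biconn G) (h : DoublyAttached G D W u v) (hqD : q ∈ D)
    (hqu : G.Adj u q) (hqv : G.Adj v q) (hE : IsComp G (D \ {q}) E) (hEv : Touch G {v} E)
    (hd : Conn G d) (hdE : d ⊆ E) (hdq : Touch G {q} d) (hdu : Touch G {u} d)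
    (hdv : ¬ Touch G {v} d) : False := by
  have hED : E ⊆ D := hE.1.trans Set.sdiff_subset
  have hqE : q ∉ E := fun hq => (hE.1 hq).2 rfl
  have ntWD := h.comp'.not_touch_of_ne h.comp h.neW
  have djWD := h.comp'.disjoint_of_ne h.comp h.neW
  have huW : u ∉ W := fun hu => h.comp'.1 hu (by simp)
  have hvW : v ∉ W := fun hu => h.comp'.1 hu (by simp)
  have huD : u ∉ D := fun hu => h.comp.1 hu (by simp)
  have hvD : v ∉ D := fun hu => h.comp.1 hu (by simp)
  have hqW : q ∉ W := fun hq => Set.disjoint_left.mp djWD hq hqD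
  have tWu := hB.touch_left h.ne h.comp'
  have tWv := hB.touch_right h.ne h.comp'
  obtain ⟨y, hy, hvy⟩ := touch_singleton_left.mp hEv
  have hyd : y ∉ d := fun hyd => hdv ⟨v, rfl, y, hyd, hvy⟩
  obtain ⟨K, hK, hyK⟩ := exists_isComp (G := G) (D := E \ d) ⟨hy, hyd⟩
  have hKE : K ⊆ E := hK.1.trans Set.sdiff_subset
  have hKd : Touch G K d := by
    obtain ⟨x, hx⟩ := hd.1
    exact (hE.2.1.touch_of_isComp ⟨x, hx, hdE hx⟩ hK).mono subset_rfl Set.inter_subset_left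
  have djKd : Disjoint K d := Set.disjoint_left.mpr fun x hx => (hK.1 hx).2
  have hKv : Touch G {v} K := ⟨v, rfl, y, hyK, hvy⟩
  have ntW : ∀ S ⊆ E, ¬ Touch G W S := fun S hS ht => ntWD (ht.mono subset_rfl (hS.trans hED))
  have djW : ∀ S ⊆ E, Disjoint W S := fun S hS => djWD.mono_right (hS.trans hED)
  have hub : ∀ S ⊆ E, ∀ x, x ∉ D → Disjoint ({x} ∪ {q}) S := fun S hS x hx =>
    Set.disjoint_union_left.mpr ⟨by simpa using fun h => hx (hED (hS h)),
      by simpa using fun h => hqE (hS h)⟩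
  have hqu' : q ≠ u := fun h => huD (h ▸ hqD)
  have hqv' : q ≠ v := fun h => hvD (h ▸ hqD)
  by_cases hKu : Touch G {u} K
  · apply hG
    apply isInducedMinor_gem (H := {u} ∪ {q}) (A := W) (B := {v}) (C := K) (D := d)
    · exact (conn_singleton u).union (conn_singleton q) (by simpa using hqu)
    · exact h.comp'.2.1
    · exact conn_singleton v
    · exact hK.2.1
    · exact hd
    · exact Set.disjoint_union_left.mpr ⟨by simpa using huW, by simpa using hqW⟩
    · exact Set.disjoint_union_left.mpr ⟨by simpa using h.ne, by simpa using hqv'⟩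
    · exact hub K hKE u huD
    · exact hub d hdE u huD
    · simpa using hvW
    · exact djW K hKE
    · exact djW d hdE
    · simpa using fun hv => hvD (hED (hKE hv))
    · simpa using fun hv => hvD (hED (hdE hv))
    · exact djKd
    · exact touch_union_left.mpr (Or.inl tWu)
    · exact touch_union_left.mpr (Or.inr (by simpa using hqv.symm))
    · exact touch_union_left.mpr (Or.inl hKu)
    · exact touch_union_left.mpr (Or.inl hdu)
    · exact tWv.symm
    · exact hKv
    · exact hKd
    · exact ntW K hKE
    · exact ntW d hdE
    · exact hdv
  · apply hG
    apply isInducedMinor_gem (H := {v} ∪ {q}) (A := W) (B := {u}) (C := d) (D := K)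
    · exact (conn_singleton v).union (conn_singleton q) (by simpa using hqv)
    · exact h.comp'.2.1
    · exact conn_singleton u
    · exact hd
    · exact hK.2.1
    · exact Set.disjoint_union_left.mpr ⟨by simpa using hvW, by simpa using hqW⟩
    · exact Set.disjoint_union_left.mpr ⟨by simpa using h.ne.symm, by simpa using hqu'⟩
    · exact hub d hdE v hvD
    · exact hub K hKE v hvD
    · simpa using huW
    · exact djW d hdE
    · exact djW K hKE
    · simpa using fun hv => huD (hED (hdE hv))
    · simpa using fun hv => huD (hED (hKE hv))
    · exact djKd.symm
    · exact touch_union_left.mpr (Or.inl tWv)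
    · exact touch_union_left.mpr (Or.inr (by simpa using hqu.symm))
    · exact touch_union_left.mpr (Or.inr hdq)
    · exact touch_union_left.mpr (Or.inl hKv)
    · exact tWu.symm
    · exact hdu
    · exact hKd.symm
    · exact ntW d hdE
    · exact ntW K hKE
    · exact hKu

lemma DoublyAttached.isCompleteComp {D W : Set V} {u v : V}
    (hG : ¬ IsInducedMinor gem G) (hB : Biconn G) (h : DoublyAttached G D W u v) :
    IsCompleteComp G D u v := by
  have huD : u ∉ D := fun hu => h.comp.1 hu (by simp)
  have hvD : v ∉ D := fun hu => h.comp.1 hu (by simp)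
  obtain ⟨p, hpD, hpu, hpv⟩ : ∃ p ∈ D, G.Adj u p ∧ G.Adj v p := by
    obtain ⟨k, q, hq⟩ := exists_indPath h.comp.2.1 huD hvD h.ne (hB.touch_left h.ne h.comp)
      (hB.touch_right h.ne h.comp)
    have hk1 := h.length_eq_one hG hB hq
    subst hk1
    have h1 := hq.adj_succ (i := 0) (by omega)
    have h2 := hq.adj_succ (i := 1) (by omega)
    rw [hq.zero] at h1
    have h3 : q (1 + 1) = v := hq.last
    rw [h3] at h2
    exact ⟨q 1, hq.mem 1 le_rfl le_rfl, h1, h2.symm⟩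
  by_contra hcon
  set F : Set V := {x ∈ D | G.Adj u x ∧ G.Adj v x} with hF
  have hne : F ≠ D := fun hFD => hcon fun x hx => by
    rw [← hFD] at hx; exact hx.2
  obtain ⟨q, ⟨hqD, hqu, hqv⟩, z, ⟨hzD, hzF⟩, hqz⟩ :=
    h.comp.2.1.2 F (fun x hx => hx.1) ⟨p, hpD, hpu, hpv⟩ hne
  have hzF' : ¬ (G.Adj u z ∧ G.Adj v z) := fun hz => hzF ⟨hzD, hz⟩
  have hpath := indPath_of_adj h.ne huD hvD hqD hqu hqv
  obtain ⟨E, hE, hzE⟩ := exists_isComp (G := G) (D := D \ {q}) (x := z) ⟨hzD, hqz.ne.symm⟩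
  have hE' : IsComp G (D \ seg (fun i => if i = 0 then u else if i = 1 then q else v) 1 1) E := by
    rw [seg_self]; simpa using hE
  have hEuv : Touch G {u} E ∧ Touch G {v} E := by
    obtain ⟨i, hi, hi1, hti⟩ := hpath.exists_ne_touch hB h.comp hE' 1 (by omega)
    have : i = 0 ∨ i = 2 := by omega
    rcases this with rfl | rfl
    · have hu : Touch G {u} E := by simpa using hti
      exact ⟨hu, h.touch_right_of_touch_left hG hB hpath hE' hu⟩
    · have hv : Touch G {v} E := by simpa using hti
      exact ⟨h.touch_left_of_touch_right hG hB hpath hE' hv, hv⟩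
  obtain ⟨hEu, hEv⟩ := hEuv
  have key : ∀ d ⊆ E, Conn G d → Touch G {q} d → ¬ (Touch G {u} d ∧ Touch G {v} d) →
      (Touch G {u} d ∨ Touch G {v} d) → False := by
    intro d hdE hd hdq hn ho
    by_cases hdu : Touch G {u} d
    · exact h.elim_of_left_only hG hB hqD hqu hqv hE hEv hd hdE hdq hdu fun hv => hn ⟨hdu, hv⟩
    · exact h.symm.elim_of_left_only hG hB hqD hqv hqu hE hEu hd hdE hdq (ho.resolve_left hdu) hdu
  by_cases hz : G.Adj u z ∨ G.Adj v z
  · exact key {z} (by simpa using hzE) (conn_singleton z) (by simpa using hqz)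
      (by simpa using fun h1 h2 => hzF' ⟨h1, h2⟩) (by simpa using hz)
  rw [not_or] at hz
  obtain ⟨Z, hZ, hzZ⟩ := exists_isComp (G := G) (D := {x ∈ E | ¬ G.Adj u x ∧ ¬ G.Adj v x})
    ⟨hzE, hz⟩
  have hZE : Z ⊆ E := fun x hx => (hZ.1 hx).1
  have hED : E ⊆ D := hE.1.trans Set.sdiff_subset
  have hZu : ¬ Touch G {u} Z := by
    rintro ⟨x, hx, y, hy, hxy⟩
    rw [Set.mem_singleton_iff.mp hx] at hxy
    exact (hZ.1 hy).2.1 hxy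
  have hZv : ¬ Touch G {v} Z := by
    rintro ⟨x, hx, y, hy, hxy⟩
    rw [Set.mem_singleton_iff.mp hx] at hxy
    exact (hZ.1 hy).2.2 hxy
  have hqZt : Touch G {q} Z := ⟨q, rfl, z, hzZ, hqz⟩
  obtain ⟨s, hs, t, ⟨htE, htZ⟩, hst⟩ := hE.2.1.2 Z hZE hZ.2.1.1 (by rintro rfl; exact hZu hEu)
  have ht' : G.Adj u t ∨ G.Adj v t := by
    by_contra hno
    rw [not_or] at hno
    exact htZ (hZ.mem_of_adj hs ⟨htE, hno⟩ hst)
  have htZ' : Touch G Z {t} := ⟨s, hs, t, rfl, hst⟩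
  by_cases ht : G.Adj u t ∧ G.Adj v t
  swap
  · refine key (Z ∪ {t}) (Set.union_subset hZE (by simpa using htE))
      (hZ.2.1.union (conn_singleton t) htZ') (touch_union_right.mpr (Or.inl hqZt)) ?_ ?_
    · simp only [touch_union_right, touch_singleton]; tauto
    · simp only [touch_union_right, touch_singleton]; tauto
  have ntWD := h.comp'.not_touch_of_ne h.comp h.neW
  have djWD := h.comp'.disjoint_of_ne h.comp h.neW
  have huW : u ∉ W := fun hu => h.comp'.1 hu (by simp)
  have hvW : v ∉ W := fun hu => h.comp'.1 hu (by simp)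
  have hqW : q ∉ W := fun hq => Set.disjoint_left.mp djWD hq hqD
  have htD := hED htE
  have hqE : q ∉ E := fun hq => (hE.1 hq).2 rfl
  apply hG
  apply isInducedMinor_gem (H := {u} ∪ {q}) (A := W) (B := {v}) (C := {t}) (D := Z)
  · exact (conn_singleton u).union (conn_singleton q) (by simpa using hqu)
  · exact h.comp'.2.1
  · exact conn_singleton v
  · exact conn_singleton t
  · exact hZ.2.1
  · exact Set.disjoint_union_left.mpr ⟨by simpa using huW, by simpa using hqW⟩
  · exact Set.disjoint_union_left.mpr ⟨by simpa using h.ne, by simpa using hqv.ne.symm⟩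
  · exact Set.disjoint_union_left.mpr ⟨by simpa using ht.1.ne,
      by simpa using fun h : q = t => hqE (h ▸ htE)⟩
  · exact Set.disjoint_union_left.mpr ⟨by simpa using fun h => huD (hED (hZE h)),
      by simpa using fun h => hqE (hZE h)⟩
  · simpa using hvW
  · simpa using fun h => Set.disjoint_left.mp djWD h htD
  · exact djWD.mono_right (hZE.trans hED)
  · simpa using ht.2.ne
  · simpa using fun h => hvD (hED (hZE h))
  · simpa using htZ
  · exact touch_union_left.mpr (Or.inl (hB.touch_left h.ne h.comp'))
  · exact touch_union_left.mpr (Or.inr (by simpa using hqv.symm))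
  · exact touch_union_left.mpr (Or.inl (by simpa using ht.1))
  · exact touch_union_left.mpr (Or.inr hqZt)
  · exact (hB.touch_right h.ne h.comp').symm
  · simpa using ht.2
  · exact htZ'.symm
  · exact fun ht => ntWD (ht.mono subset_rfl (by simpa using htD))
  · exact fun ht => ntWD (ht.mono subset_rfl (hZE.trans hED))
  · exact hZv

end GoodCut

section GoodCut

variable {V : Type*} {G : SimpleGraph V}

/-- Every component of the complement of `{u, v}` is good. -/
def IsGoodCut (G : SimpleGraph V) (u v : V) : Prop :=
  u ≠ v ∧ ∀ D, IsComp G {u, v}ᶜ D → GoodComp G D u v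

lemma IsPathComp.cons {O : Set V} {u v w : V} (hO : IsPathComp G O u v) (huv : ¬ G.Adj u v)
    (hwO : w ∉ O) (hwv : w ≠ v) (huw : G.Adj w u) (hw : ∀ x ∈ O, ¬ G.Adj w x) :
    IsPathComp G (O ∪ {u}) w v := by
  obtain ⟨k, q, hq, rfl⟩ := hO
  have hwu : w ≠ u := huw.ne
  refine ⟨k + 1, fun i => if i = 0 then w else q (i - 1), ⟨by omega, by simp, by simp [hq.last],
    fun i h1 h2 => ?_, ?_, ?_, fun i j hij hj hne => ?_, fun i j hij hj => ?_⟩, ?_⟩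
  · rw [if_neg (by omega)]
    rcases Nat.lt_or_ge 1 i with h | h
    · exact Or.inl (mem_seg_of_le (by omega) (by omega))
    · obtain rfl : i = 1 := by omega
      exact Or.inr (by simp [hq.zero])
  · rintro (h | h)
    · exact hwO h
    · exact hwu h
  · rintro (h | h)
    · exact hq.right_notMem h
    · exact hq.ne h.symm
  · rw [if_neg (by omega : j ≠ 0)]
    by_cases hi : i = 0
    · subst hi
      rw [if_pos rfl]
      by_cases hj1 : j = 1
      · subst hj1; simpa [hq.zero] using huw
      · have := hw (q (j - 1)) (mem_seg_of_le (by omega) (by omega))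
        simp only [this, false_iff]; omega
    · rw [if_neg hi]
      by_cases h : i - 1 ≠ 0 ∨ j - 1 ≠ k + 1
      · rw [hq.adj _ _ (by omega) (by omega) h]; omega
      · have h1 : i - 1 = 0 := by omega
        have h2 : j - 1 = k + 1 := by omega
        rw [h1, h2, hq.zero, hq.last]
        have := hq.pos
        simp only [huv, false_iff]; omega
  · rw [if_neg (by omega : j ≠ 0)]
    by_cases hi : i = 0
    · rw [if_pos hi]
      by_cases hj1 : j = 1
      · subst hj1; simpa [hq.zero] using hwu
      · by_cases hj2 : j = k + 2
        · subst hj2; simpa [hq.last] using hwv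
        · exact fun h => hwO (h ▸ mem_seg_of_le (by omega) (by omega))
    · rw [if_neg hi]
      exact hq.inj _ _ (by omega) (by omega)
  · ext x
    simp only [Set.mem_union, mem_seg, Set.mem_singleton_iff]
    constructor
    · rintro (⟨i, h1, h2, rfl⟩ | rfl)
      · exact ⟨i + 1, by omega, by omega, by simp⟩
      · exact ⟨1, by omega, by omega, by simp [hq.zero]⟩
    · rintro ⟨i, h1, h2, rfl⟩
      rw [if_neg (by omega)]
      by_cases hi : i = 1
      · subst hi; exact Or.inr (by simp [hq.zero])
      · exact Or.inl ⟨i - 1, by omega, by omega, rfl⟩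

lemma isGoodCut_of_single_attachment {D O : Set V} {u v w : V} (huv : u ≠ v) (hnuv : ¬ G.Adj u v)
    (hD : IsComp G {u, v}ᶜ D) (hO : IsComp G {u, v}ᶜ O) (hOD : O ≠ D) (hp : IsPathComp G O u v)
    (hcov : ∀ x, x = u ∨ x = v ∨ x ∈ D ∨ x ∈ O) (hw : w ∈ D) (huw : G.Adj u w)
    (huniq : ∀ y ∈ D, G.Adj u y → y = w) (hOu : Touch G {u} O)
    (ih : ∀ C, IsComp G {w, v}ᶜ C → C ⊂ D → GoodComp G C w v) : IsGoodCut G w v := by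
  have huD : u ∉ D := fun h => hD.1 h (by simp)
  have hvD : v ∉ D := fun h => hD.1 h (by simp)
  have huO : u ∉ O := fun h => hO.1 h (by simp)
  have hvO : v ∉ O := fun h => hO.1 h (by simp)
  have hdisj := hD.disjoint_of_ne hO hOD.symm
  have hnt := hD.not_touch_of_ne hO hOD.symm
  have hwO : w ∉ O := fun h => Set.disjoint_left.mp hdisj hw h
  have hwv : w ≠ v := by rintro rfl; exact hvD hw
  refine ⟨hwv, fun C hC => ?_⟩
  have hsub : O ∪ {u} ⊆ {w, v}ᶜ := by
    rintro x (hx | rfl) (rfl | rfl)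
    · exact hwO hx
    · exact hvO hx
    · exact huD hw
    · exact huv rfl
  have hconn : Conn G (O ∪ {u}) := hO.2.1.union (conn_singleton u) hOu.symm
  by_cases huC : u ∈ C
  · have hcomp : IsComp G {w, v}ᶜ (O ∪ {u}) := by
      refine ⟨hsub, hconn, ?_⟩
      rintro ⟨x, hx, y, ⟨hy, hy'⟩, hxy⟩
      have hyD : y ∈ D := by
        simp only [Set.mem_compl_iff, Set.mem_insert_iff, Set.mem_singleton_iff, not_or] at hy
        rcases hcov y with h | h | h | h
        · exact absurd (Or.inr h) hy'
        · exact absurd h hy.2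
        · exact h
        · exact absurd (Or.inl h) hy'
      rcases hx with hx | rfl
      · exact hnt ⟨y, hyD, x, hx, hxy.symm⟩
      · exact hy (Or.inl (huniq y hyD hxy))
    have := hC.eq_of_mem hcomp huC (Or.inr rfl)
    subst this
    exact Or.inl (hp.cons hnuv hwO hwv huw.symm fun x hx h => hnt ⟨w, hw, x, hx, h⟩)
  · refine ih C hC ⟨fun x hx => ?_, fun h => hC.1 (h hw) (by simp)⟩
    have hxc := hC.1 hx
    simp only [Set.mem_compl_iff, Set.mem_insert_iff, Set.mem_singleton_iff, not_or] at hxc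
    rcases hcov x with h | h | h | h
    · exact absurd (h ▸ hx) huC
    · exact absurd h hxc.2
    · exact h
    · exact absurd (hC.subset_of_conn hconn hsub ⟨x, Or.inl h, hx⟩ (Or.inr rfl)) huC

lemma exists_isGoodCut [Finite V] (hG : ¬ IsInducedMinor gem G) (hB : Biconn G) {u v o : V}
    {D : Set V} (huv : u ≠ v) (hD : IsComp G {u, v}ᶜ D) (ho : o ∉ D) (hou : o ≠ u) (hov : o ≠ v) :
    ∃ u v, IsGoodCut G u v := by
  by_contra hno
  have key : ∀ n : ℕ, ∀ (u v o : V) (D : Set V), u ≠ v → IsComp G {u, v}ᶜ D → o ∉ D → o ≠ u →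
      o ≠ v → D.ncard = n → GoodComp G D u v := by
    intro n
    induction n using Nat.strong_induction_on with
    | _ n ih =>
    intro u v o D huv hD ho hou hov hn
    by_contra hbad
    obtain ⟨U, W, A, h⟩ | ⟨hnuv, O, hO, hOD, hp, hcov⟩ :=
      exists_thick_or_isPathComp hB huv hD ho hou hov
    · exact hbad (h.goodComp hG hB huv hD)
    have step : ∀ u v, u ≠ v → ¬ G.Adj u v → IsComp G {u, v}ᶜ D → IsComp G {u, v}ᶜ O →
        IsPathComp G O u v → (∀ x, x = u ∨ x = v ∨ x ∈ D ∨ x ∈ O) →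
        ∀ x, ∃ y ∈ D, y ≠ x ∧ G.Adj u y := by
      intro u v huv hnuv hD hO hp hcov x
      by_contra hx
      push Not at hx
      obtain ⟨w, hw, huw⟩ := touch_singleton_left.mp (hB.touch_left huv hD)
      have hwx : w = x := by by_contra h; exact hx w hw h huw
      subst hwx
      refine hno ⟨w, v, isGoodCut_of_single_attachment huv hnuv hD hO hOD hp hcov hw huw
        (fun y hy hy' => by by_contra h; exact hx y hy h hy') (hB.touch_left huv hO)
        fun C hC hCD => ?_⟩
      have huD : u ∉ D := fun h => hD.1 h (by simp)
      have hvD : v ∉ D := fun h => hD.1 h (by simp)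
      exact ih _ (hn ▸ Set.ncard_lt_ncard hCD) w v u C (by rintro rfl; exact hvD hw) hC
        (fun h => huD (hCD.1 h)) huw.ne huv rfl
    have hpair : ({v, u} : Set V) = {u, v} := Set.pair_comm v u
    exact hbad (Or.inr (DoublyAttached.isCompleteComp hG hB ⟨huv, hD, hO, hOD,
      step u v huv hnuv hD hO hp hcov,
      step v u huv.symm (fun h => hnuv h.symm) (hpair ▸ hD) (hpair ▸ hO) hp.symm
        (fun x => by rcases hcov x with h | h | h | h <;> simp [h])⟩))
  obtain ⟨E, hE, hoE⟩ := exists_isComp (G := G) (D := {u, v}ᶜ) (x := o) (by simp [hou, hov])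
  have hDE : D ≠ E := by rintro rfl; exact ho hoE
  refine hno ⟨u, v, huv, fun C hC => ?_⟩
  by_cases hCD : C = D
  · subst hCD; exact key _ u v o C huv hC ho hou hov rfl
  · obtain ⟨d, hd⟩ := hD.2.1.1
    have hdc := hD.1 hd
    simp only [Set.mem_compl_iff, Set.mem_insert_iff, Set.mem_singleton_iff, not_or] at hdc
    exact key _ u v d C huv hC (fun h => Set.disjoint_left.mp (hC.disjoint_of_ne hD hCD) h hd)
      hdc.1 hdc.2 rfl

end GoodCut

section PathModel

variable {V : Type*} {G : SimpleGraph V}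

/-- Four connected sets forming an induced-minor model of the path on four vertices. -/
structure PathModel (G : SimpleGraph V) (a b c d : Set V) : Prop where
  conn_a : Conn G a
  conn_b : Conn G b
  conn_c : Conn G c
  conn_d : Conn G d
  disj_ab : Disjoint a b
  disj_ac : Disjoint a c
  disj_ad : Disjoint a d
  disj_bc : Disjoint b c
  disj_bd : Disjoint b d
  disj_cd : Disjoint c d
  ab : Touch G a b
  bc : Touch G b c
  cd : Touch G c d
  ac : ¬ Touch G a c
  ad : ¬ Touch G a d
  bd : ¬ Touch G b d

lemma PathModel.symm {a b c d : Set V} (h : PathModel G a b c d) : PathModel G d c b a where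
  conn_a := h.conn_d
  conn_b := h.conn_c
  conn_c := h.conn_b
  conn_d := h.conn_a
  disj_ab := h.disj_cd.symm
  disj_ac := h.disj_bd.symm
  disj_ad := h.disj_ad.symm
  disj_bc := h.disj_bc.symm
  disj_bd := h.disj_ac.symm
  disj_cd := h.disj_ab.symm
  ab := h.cd.symm
  bc := h.bc.symm
  cd := h.ab.symm
  ac := fun h' => h.bd h'.symm
  ad := fun h' => h.ad h'.symm
  bd := fun h' => h.ac h'.symm

lemma PathModel.gem_of_hub {a b c d H : Set V} (h : PathModel G a b c d) (hH : Conn G H)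
    (ha : Disjoint H a) (hb : Disjoint H b) (hc : Disjoint H c) (hd : Disjoint H d)
    (ta : Touch G H a) (tb : Touch G H b) (tc : Touch G H c) (td : Touch G H d) :
    IsInducedMinor gem G :=
  isInducedMinor_gem hH h.conn_a h.conn_b h.conn_c h.conn_d ha hb hc hd h.disj_ab h.disj_ac
    h.disj_ad h.disj_bc h.disj_bd h.disj_cd ta tb tc td h.ab h.bc h.cd h.ac h.ad h.bd

/-- A connected set disjoint from the four sets of a path model. -/
structure OffPath (G : SimpleGraph V) (D a b c d : Set V) : Prop where
  conn : Conn G D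
  disj_a : Disjoint D a
  disj_b : Disjoint D b
  disj_c : Disjoint D c
  disj_d : Disjoint D d

lemma OffPath.symm {D a b c d : Set V} (h : OffPath G D a b c d) : OffPath G D d c b a :=
  ⟨h.conn, h.disj_d, h.disj_c, h.disj_b, h.disj_a⟩

variable {a b c d D E F : Set V}

lemma PathModel.gem_of_abc_bcd (h : PathModel G a b c d) (hD : OffPath G D a b c d)
    (hE : OffPath G E a b c d) (hDE : Disjoint D E) (hnt : ¬ Touch G D E)
    (Da : Touch G D a) (Db : Touch G D b) (Dc : Touch G D c)
    (Ea : ¬ Touch G E a) (Eb : Touch G E b) (Ec : Touch G E c) : IsInducedMinor gem G := by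
  obtain ⟨_, _, _, _, _, _, _, _, _, _, _, _, _, _, _, _⟩ := h
  obtain ⟨_, _, _, _, _⟩ := hD
  obtain ⟨_, _, _, _, _⟩ := hE
  refine isInducedMinor_gem (H := b) (A := a) (B := D) (C := c) (D := E) ?_ ?_ ?_ ?_ ?_ ?_ ?_ ?_ ?_
    ?_ ?_ ?_ ?_ ?_ ?_ ?_ ?_ ?_ ?_ ?_ ?_ ?_ ?_ ?_ ?_ <;> grind [touch_comm]

lemma PathModel.gem_of_abc_abd (h : PathModel G a b c d) (hD : OffPath G D a b c d)
    (hE : OffPath G E a b c d) (hDE : Disjoint D E) (hnt : ¬ Touch G D E)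
    (Da : Touch G D a) (Db : Touch G D b) (Dc : Touch G D c)
    (Ea : Touch G E a) (Eb : Touch G E b) (Ec : ¬ Touch G E c) : IsInducedMinor gem G := by
  obtain ⟨_, _, _, _, _, _, _, _, _, _, _, _, _, _, _, _⟩ := h
  obtain ⟨_, _, _, _, _⟩ := hD
  obtain ⟨_, _, _, _, _⟩ := hE
  refine isInducedMinor_gem (H := b) (A := c) (B := D) (C := a) (D := E) ?_ ?_ ?_ ?_ ?_ ?_ ?_ ?_ ?_
    ?_ ?_ ?_ ?_ ?_ ?_ ?_ ?_ ?_ ?_ ?_ ?_ ?_ ?_ ?_ ?_ <;> grind [touch_comm]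

lemma PathModel.gem_of_abc_acd (h : PathModel G a b c d) (hD : OffPath G D a b c d)
    (hE : OffPath G E a b c d) (hDE : Disjoint D E)
    (Da : Touch G D a) (Dc : Touch G D c)
    (Ea : Touch G E a) (Eb : ¬ Touch G E b) (Ec : Touch G E c) (Ed : Touch G E d) :
    IsInducedMinor gem G := by
  have hcD := h.conn_c.union hD.conn Dc.symm
  obtain ⟨_, _, _, _, _, _, _, _, _, _, _, _, _, _, _, _⟩ := h
  obtain ⟨_, _, _, _, _⟩ := hD
  obtain ⟨_, _, _, _, _⟩ := hE
  refine isInducedMinor_gem (H := c ∪ D) (A := d) (B := E) (C := a) (D := b) ?_ ?_ ?_ ?_ ?_ ?_ ?_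
    ?_ ?_ ?_ ?_ ?_ ?_ ?_ ?_ ?_ ?_ ?_ ?_ ?_ ?_ ?_ ?_ ?_ ?_ <;>
    grind [touch_comm, touch_union_left, Set.disjoint_union_left]

lemma PathModel.gem_of_abd_abd_acd (h : PathModel G a b c d) (hD : OffPath G D a b c d)
    (hF : OffPath G F a b c d) (hE : OffPath G E a b c d) (hDE : Disjoint D E)
    (hDF : Disjoint D F) (hFE : Disjoint F E) (hnt : ¬ Touch G F E)
    (Da : Touch G D a) (Dd : Touch G D d)
    (Fa : Touch G F a) (Fb : Touch G F b) (Fd : Touch G F d)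
    (Ea : Touch G E a) (Eb : ¬ Touch G E b) (Ed : Touch G E d) :
    IsInducedMinor gem G := by
  have hcD := h.conn_a.union hD.conn Da.symm
  obtain ⟨_, _, _, _, _, _, _, _, _, _, _, _, _, _, _, _⟩ := h
  obtain ⟨_, _, _, _, _⟩ := hD
  obtain ⟨_, _, _, _, _⟩ := hE
  obtain ⟨_, _, _, _, _⟩ := hF
  refine isInducedMinor_gem (H := a ∪ D) (A := b) (B := F) (C := d) (D := E) ?_ ?_ ?_ ?_ ?_ ?_ ?_
    ?_ ?_ ?_ ?_ ?_ ?_ ?_ ?_ ?_ ?_ ?_ ?_ ?_ ?_ ?_ ?_ ?_ ?_ <;>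
    grind [touch_comm, touch_union_left, Set.disjoint_union_left]

/-- Two adjacent disjoint connected sets `S`, `T` avoiding a path model and a set `E` attached
to its first, third and last sets, which is not attached to `S` and `T`. -/
structure SplitModel (G : SimpleGraph V) (a b c d E S T : Set V) : Prop where
  path : PathModel G a b c d
  offE : OffPath G E a b c d
  offS : OffPath G S a b c d
  offT : OffPath G T a b c d
  disj_ES : Disjoint E S
  disj_ET : Disjoint E T
  disj_ST : Disjoint S T
  ES : ¬ Touch G E S
  ET : ¬ Touch G E T
  ST : Touch G S T
  Ea : Touch G E a
  Eb : ¬ Touch G E b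
  Ec : Touch G E c
  Ed : Touch G E d
  Sc : ¬ Touch G S c
  Tc : ¬ Touch G T c

variable {S T : Set V}

lemma SplitModel.symm (h : SplitModel G a b c d E S T) : SplitModel G a b c d E T S where
  path := h.path
  offE := h.offE
  offS := h.offT
  offT := h.offS
  disj_ES := h.disj_ET
  disj_ET := h.disj_ES
  disj_ST := h.disj_ST.symm
  ES := h.ET
  ET := h.ES
  ST := h.ST.symm
  Ea := h.Ea
  Eb := h.Eb
  Ec := h.Ec
  Ed := h.Ed
  Sc := h.Tc
  Tc := h.Sc

lemma SplitModel.types (h : SplitModel G a b c d E S T) (hG : ¬ IsInducedMinor gem G) :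
    ¬ (Touch G S a ∧ Touch G S b ∧ ¬ Touch G S d) ∧
    ¬ (Touch G S a ∧ Touch G S d ∧ Touch G T b ∧ Touch G T d) ∧
    ¬ (Touch G S a ∧ Touch G S b ∧ Touch G T a ∧ ¬ Touch G T b) ∧
    ¬ (Touch G S a ∧ Touch G S b ∧ Touch G T b ∧ ¬ Touch G T a) ∧
    ¬ (Touch G S a ∧ Touch G S d ∧ Touch G T d ∧ ¬ Touch G T b) ∧
    ¬ (Touch G S a ∧ Touch G S d ∧ Touch G T b ∧ ¬ Touch G T d) ∧
    ¬ (Touch G S b ∧ Touch G S d ∧ Touch G T a ∧ ¬ Touch G T d) := by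
  have hcE := h.path.conn_c.union h.offE.conn h.Ec.symm
  have haE := h.path.conn_a.union h.offE.conn h.Ea.symm
  have haS := fun t : Touch G S a => h.path.conn_a.union h.offS.conn t.symm
  have hbS := fun t : Touch G S b => h.path.conn_b.union h.offS.conn t.symm
  obtain ⟨⟨_, _, _, _, _, _, _, _, _, _, _, _, _, _, _, _⟩, ⟨_, _, _, _, _⟩, ⟨_, _, _, _, _⟩,
    ⟨_, _, _, _, _⟩, _, _, _, _, _, _, _, _, _, _, _, _⟩ := h
  refine ⟨?_, ?_, ?_, ?_, ?_, ?_, ?_⟩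
  · rintro ⟨h1, h2, h3⟩
    refine hG (isInducedMinor_gem (H := a ∪ E) (A := S) (B := b) (C := c) (D := d)
      ?_ ?_ ?_ ?_ ?_ ?_ ?_ ?_ ?_ ?_ ?_ ?_ ?_ ?_ ?_ ?_ ?_ ?_ ?_ ?_ ?_ ?_ ?_ ?_ ?_) <;>
    grind [touch_comm, touch_union_left, Set.disjoint_union_left]
  · rintro ⟨h1, h2, h3, h4⟩
    refine hG (isInducedMinor_gem (H := a ∪ S) (A := b) (B := T) (C := d) (D := E)
      ?_ ?_ ?_ ?_ ?_ ?_ ?_ ?_ ?_ ?_ ?_ ?_ ?_ ?_ ?_ ?_ ?_ ?_ ?_ ?_ ?_ ?_ ?_ ?_ ?_) <;>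
    grind [touch_comm, touch_union_left, Set.disjoint_union_left]
  · rintro ⟨h1, h2, h3, h4⟩
    refine hG (isInducedMinor_gem (H := a) (A := c ∪ E) (B := b) (C := S) (D := T)
      ?_ ?_ ?_ ?_ ?_ ?_ ?_ ?_ ?_ ?_ ?_ ?_ ?_ ?_ ?_ ?_ ?_ ?_ ?_ ?_ ?_ ?_ ?_ ?_ ?_) <;>
    grind [touch_comm, touch_union_left, Set.disjoint_union_left]
  · rintro ⟨h1, h2, h3, h4⟩
    refine hG (isInducedMinor_gem (H := b) (A := c ∪ E) (B := a) (C := S) (D := T)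
      ?_ ?_ ?_ ?_ ?_ ?_ ?_ ?_ ?_ ?_ ?_ ?_ ?_ ?_ ?_ ?_ ?_ ?_ ?_ ?_ ?_ ?_ ?_ ?_ ?_) <;>
    grind [touch_comm, touch_union_left, Set.disjoint_union_left]
  · rintro ⟨h1, h2, h3, h4⟩
    refine hG (isInducedMinor_gem (H := a ∪ S) (A := T) (B := d) (C := c ∪ E) (D := b)
      ?_ ?_ ?_ ?_ ?_ ?_ ?_ ?_ ?_ ?_ ?_ ?_ ?_ ?_ ?_ ?_ ?_ ?_ ?_ ?_ ?_ ?_ ?_ ?_ ?_) <;>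
    grind [touch_comm, touch_union_left, Set.disjoint_union_left]
  · rintro ⟨h1, h2, h3, h4⟩
    refine hG (isInducedMinor_gem (H := a ∪ S) (A := T) (B := b) (C := c ∪ E) (D := d)
      ?_ ?_ ?_ ?_ ?_ ?_ ?_ ?_ ?_ ?_ ?_ ?_ ?_ ?_ ?_ ?_ ?_ ?_ ?_ ?_ ?_ ?_ ?_ ?_ ?_) <;>
    grind [touch_comm, touch_union_left, Set.disjoint_union_left]
  · rintro ⟨h1, h2, h3, h4⟩
    refine hG (isInducedMinor_gem (H := b ∪ S) (A := T) (B := a) (C := c ∪ E) (D := d)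
      ?_ ?_ ?_ ?_ ?_ ?_ ?_ ?_ ?_ ?_ ?_ ?_ ?_ ?_ ?_ ?_ ?_ ?_ ?_ ?_ ?_ ?_ ?_ ?_ ?_) <;>
    grind [touch_comm, touch_union_left, Set.disjoint_union_left]

lemma SplitModel.false (h : SplitModel G a b c d E S T) (hG : ¬ IsInducedMinor gem G)
    (hS : Touch G S a ∨ Touch G S b ∨ Touch G S d) (hT : Touch G T a ∨ Touch G T b ∨ Touch G T d)
    (ha : Touch G S a ∨ Touch G T a) (hb : Touch G S b ∨ Touch G T b)
    (hd : Touch G S d ∨ Touch G T d) : False := by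
  have h1 := h.types hG
  have h2 := h.symm.types hG
  grind

end PathModel

section Triconnected

variable {V : Type*} {G : SimpleGraph V}

/-- Deleting at most two vertices does not disconnect the graph. -/
def Triconn (G : SimpleGraph V) : Prop :=
  ∀ (u v : V) (A : Set V), A.Nonempty → u ∉ A → v ∉ A → (∃ o, o ∉ A ∧ o ≠ u ∧ o ≠ v) →
    ∃ a ∈ A, ∃ b, b ∉ A ∧ b ≠ u ∧ b ≠ v ∧ G.Adj a b

lemma Biconn.triconn (hB : Biconn G)
    (h : ∀ (u v o : V) (D : Set V), u ≠ v → IsComp G {u, v}ᶜ D → o ∉ D → o ≠ u → o = v) :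
    Triconn G := by
  rintro u v A ⟨x, hx⟩ hu hv ⟨o, ho, hou, hov⟩
  by_cases huv : u = v
  · subst huv
    obtain ⟨a, ha, b, hb⟩ := hB.2 u A ⟨x, hx⟩ hu ⟨o, ho, hou⟩
    exact ⟨a, ha, b, hb.1, hb.2.1, hb.2.1, hb.2.2⟩
  have hA : A ⊆ {u, v}ᶜ := by
    rintro y hy (rfl | rfl)
    · exact hu hy
    · exact hv hy
  obtain ⟨C, hC, hxC⟩ := exists_isComp (G := G) (hA hx)
  have hoC : o ∈ C := by
    by_contra hoC
    exact hov (h u v o C huv hC hoC hou)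
  have hAC : A ⊆ C := fun y hy => by
    by_contra hyC
    have := hA hy
    exact this (Or.inr (h u v y C huv hC hyC fun h => this (Or.inl h)))
  obtain ⟨a, ha, b, hb, hab⟩ := hC.2.1.2 A hAC ⟨x, hx⟩ (by rintro rfl; exact ho hoC)
  have := hC.1 hb.1
  exact ⟨a, ha, b, hb.2, fun h => this (Or.inl h), fun h => this (Or.inr h), hab⟩

variable {p₁ p₂ p₃ p₄ : V}

/-- The set of the vertices `p₁`, `p₂`, `p₃`, `p₄`. -/
def quad (p₁ p₂ p₃ p₄ : V) : Set V := {p₁, p₂, p₃, p₄}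

lemma quad_symm : quad p₄ p₃ p₂ p₁ = quad p₁ p₂ p₃ p₄ := by
  ext x; simp only [quad, Set.mem_insert_iff, Set.mem_singleton_iff]; tauto

lemma mem_quad {x : V} : x ∈ quad p₁ p₂ p₃ p₄ ↔ x = p₁ ∨ x = p₂ ∨ x = p₃ ∨ x = p₄ := Iff.rfl

lemma IsComp.offPath {D : Set V} (hD : IsComp G (quad p₁ p₂ p₃ p₄)ᶜ D) :
    OffPath G D {p₁} {p₂} {p₃} {p₄} := by
  refine ⟨hD.2.1, ?_, ?_, ?_, ?_⟩ <;>
  · rw [Set.disjoint_singleton_right]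
    exact fun h => hD.1 h (by simp [quad])

lemma PathModel.pairwise_ne (h : PathModel G {p₁} {p₂} {p₃} {p₄}) :
    p₁ ≠ p₂ ∧ p₁ ≠ p₃ ∧ p₁ ≠ p₄ ∧ p₂ ≠ p₃ ∧ p₂ ≠ p₄ ∧ p₃ ≠ p₄ := by
  refine ⟨?_, ?_, ?_, ?_, ?_, ?_⟩
  · simpa using h.disj_ab
  · simpa using h.disj_ac
  · simpa using h.disj_ad
  · simpa using h.disj_bc
  · simpa using h.disj_bd
  · simpa using h.disj_cd

lemma Triconn.exists_touch_quad (hT : Triconn G) {D : Set V}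
    (hD : IsComp G (quad p₁ p₂ p₃ p₄)ᶜ D) {u v o : V} (hu : u ∈ quad p₁ p₂ p₃ p₄)
    (hv : v ∈ quad p₁ p₂ p₃ p₄) (ho : o ∈ quad p₁ p₂ p₃ p₄) (hou : o ≠ u) (hov : o ≠ v) :
    ∃ p ∈ quad p₁ p₂ p₃ p₄, p ≠ u ∧ p ≠ v ∧ Touch G D {p} := by
  obtain ⟨a, ha, b, hb, hbu, hbv, hab⟩ := hT u v D hD.2.1.1 (fun h => hD.1 h hu)
    (fun h => hD.1 h hv) ⟨o, fun h => hD.1 h ho, hou, hov⟩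
  refine ⟨b, ?_, hbu, hbv, a, ha, b, rfl, hab⟩
  by_contra hbP
  exact hb (hD.mem_of_adj ha hbP hab)

/-- A component of the complement of an induced path on four vertices is attached to exactly
three of them. -/
lemma Triconn.attachment (hT : Triconn G) (hG : ¬ IsInducedMinor gem G)
    (hP : PathModel G {p₁} {p₂} {p₃} {p₄}) {D : Set V} (hD : IsComp G (quad p₁ p₂ p₃ p₄)ᶜ D) :
    (Touch G D {p₁} ∨ Touch G D {p₂}) ∧ (Touch G D {p₁} ∨ Touch G D {p₃}) ∧
    (Touch G D {p₁} ∨ Touch G D {p₄}) ∧ (Touch G D {p₂} ∨ Touch G D {p₃}) ∧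
    (Touch G D {p₂} ∨ Touch G D {p₄}) ∧ (Touch G D {p₃} ∨ Touch G D {p₄}) ∧
    ¬ (Touch G D {p₁} ∧ Touch G D {p₂} ∧ Touch G D {p₃} ∧ Touch G D {p₄}) := by
  obtain ⟨h12, h13, h14, h23, h24, h34⟩ := hP.pairwise_ne
  have m1 : p₁ ∈ quad p₁ p₂ p₃ p₄ := by simp [quad]
  have m2 : p₂ ∈ quad p₁ p₂ p₃ p₄ := by simp [quad]
  have m3 : p₃ ∈ quad p₁ p₂ p₃ p₄ := by simp [quad]
  have m4 : p₄ ∈ quad p₁ p₂ p₃ p₄ := by simp [quad]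
  have key := fun u v o => hT.exists_touch_quad hD (u := u) (v := v) (o := o)
  refine ⟨?_, ?_, ?_, ?_, ?_, ?_, ?_⟩
  · have := key p₃ p₄ p₁ m3 m4 m1 h13 h14; grind [mem_quad]
  · have := key p₂ p₄ p₁ m2 m4 m1 h12 h14; grind [mem_quad]
  · have := key p₂ p₃ p₁ m2 m3 m1 h12 h13; grind [mem_quad]
  · have := key p₁ p₄ p₂ m1 m4 m2 h12.symm h24; grind [mem_quad]
  · have := key p₁ p₃ p₂ m1 m3 m2 h12.symm h23; grind [mem_quad]
  · have := key p₁ p₂ p₃ m1 m2 m3 h13.symm h23.symm; grind [mem_quad]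
  · rintro ⟨h1, h2, h3, h4⟩
    have ho := hD.offPath
    exact hG (hP.gem_of_hub ho.conn ho.disj_a ho.disj_b ho.disj_c ho.disj_d h1 h2 h3 h4)

lemma Triconn.touch_last (hT : Triconn G) (hG : ¬ IsInducedMinor gem G)
    (hP : PathModel G {p₁} {p₂} {p₃} {p₄}) {D : Set V} (hD : IsComp G (quad p₁ p₂ p₃ p₄)ᶜ D) :
    Touch G D {p₄} := by
  by_contra h4
  obtain ⟨h12, h13, h14, h23, h24, h34⟩ := hP.pairwise_ne
  obtain ⟨z, hz, x, hx, hx1, hx3, hadj⟩ := hT p₁ p₃ {p₄} ⟨p₄, rfl⟩ h14 h34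
    ⟨p₂, h24, h12.symm, h23⟩
  rw [Set.mem_singleton_iff.mp hz] at hadj
  have hx2 : x ≠ p₂ := by
    rintro rfl
    exact hP.bd (touch_singleton.mpr hadj.symm)
  have hxP : x ∈ (quad p₁ p₂ p₃ p₄)ᶜ := fun h => by
    rcases h with h | h | h | h
    · exact hx1 h
    · exact hx2 h
    · exact hx3 h
    · exact hx h
  obtain ⟨E, hE, hxE⟩ := exists_isComp (G := G) hxP
  have hE4 : Touch G E {p₄} := ⟨x, hxE, p₄, rfl, hadj.symm⟩
  have hDE : D ≠ E := by rintro rfl; exact h4 hE4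
  have hdisj := hD.disjoint_of_ne hE hDE
  have hnt := hD.not_touch_of_ne hE hDE
  obtain ⟨-, -, d1, -, d2, d3, -⟩ := hT.attachment hG hP hD
  replace d1 := d1.resolve_right h4
  replace d2 := d2.resolve_right h4
  replace d3 := d3.resolve_right h4
  obtain ⟨e1, e2, e3, e4, e5, e6, e7⟩ := hT.attachment hG hP hE
  by_cases h1 : Touch G E {p₁}
  · by_cases h2 : Touch G E {p₂}
    · exact hG (hP.gem_of_abc_abd hD.offPath hE.offPath hdisj hnt d1 d2 d3
        h1 h2 fun h3 => e7 ⟨h1, h2, h3, hE4⟩)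
    · exact hG (hP.gem_of_abc_acd hD.offPath hE.offPath hdisj d1 d3
        h1 h2 (e4.resolve_left h2) hE4)
  · exact hG (hP.gem_of_abc_bcd hD.offPath hE.offPath hdisj hnt d1 d2 d3
      h1 (e1.resolve_left h1) (e2.resolve_left h1))

lemma Triconn.exists_touch_second (hT : Triconn G)
    (hP : PathModel G {p₁} {p₂} {p₃} {p₄}) :
    ∃ D, IsComp G (quad p₁ p₂ p₃ p₄)ᶜ D ∧ Touch G D {p₂} := by
  obtain ⟨h12, h13, h14, h23, h24, h34⟩ := hP.pairwise_ne
  obtain ⟨z, hz, x, hx, hx1, hx3, hadj⟩ := hT p₁ p₃ {p₂} ⟨p₂, rfl⟩ h12 h23.symm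
    ⟨p₄, h24.symm, h14.symm, h34.symm⟩
  rw [Set.mem_singleton_iff.mp hz] at hadj
  have hx4 : x ≠ p₄ := by
    rintro rfl
    exact hP.bd (touch_singleton.mpr hadj)
  have hxP : x ∈ (quad p₁ p₂ p₃ p₄)ᶜ := fun h => by
    rcases h with h | h | h | h
    · exact hx1 h
    · exact hx h
    · exact hx3 h
    · exact hx4 h
  obtain ⟨D, hD, hxD⟩ := exists_isComp (G := G) hxP
  exact ⟨D, hD, x, hxD, _, rfl, hadj.symm⟩

/-- The component attached to `p₁`, `p₂`, `p₄` is a single vertex. -/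
lemma Triconn.subsingleton_comp (hT : Triconn G) (hG : ¬ IsInducedMinor gem G)
    (hP : PathModel G {p₁} {p₂} {p₃} {p₄}) {D E : Set V}
    (hD : IsComp G (quad p₁ p₂ p₃ p₄)ᶜ D) (hE : IsComp G (quad p₁ p₂ p₃ p₄)ᶜ E)
    (D1 : Touch G D {p₁}) (D2 : Touch G D {p₂}) (D3 : ¬ Touch G D {p₃}) (D4 : Touch G D {p₄})
    (E1 : Touch G E {p₁}) (E2 : ¬ Touch G E {p₂}) (E3 : Touch G E {p₃}) (E4 : Touch G E {p₄}) :
    ∃ x, D = {x} := by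
  have hDE : E ≠ D := by rintro rfl; exact E2 D2
  obtain ⟨x, hx, y, hy, hxy⟩ := D1
  refine ⟨x, ?_⟩
  by_contra hne
  have hne' : (D \ {x}).Nonempty := by
    rw [Set.nonempty_iff_ne_empty]
    intro h
    exact hne (Set.Subset.antisymm (Set.sdiff_eq_empty.mp h) (by simpa using hx))
  have hyP : y ∈ quad p₁ p₂ p₃ p₄ := Or.inl hy
  obtain ⟨z, hz, w, hw, hwx, -, hzw⟩ := hT x x (D \ {x}) hne' (by simp) (by simp)
    ⟨y, fun h => hD.1 h.1 hyP, hxy.ne.symm, hxy.ne.symm⟩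
  have hwP : w ∈ quad p₁ p₂ p₃ p₄ := by
    by_contra hwP
    exact hw ⟨hD.mem_of_adj hz.1 hwP hzw, hwx⟩
  obtain ⟨S, T, hS, hTc, hxS, hzT, rfl, hdisj, hST⟩ := hD.2.1.exists_split hx hz.1
    (by rintro rfl; exact hz.2 rfl)
  have off := hD.offPath
  have hEST := hE.disjoint_of_ne hD hDE
  have hnt := hE.not_touch_of_ne hD hDE
  simp only [touch_union_left, touch_union_right, Set.disjoint_union_right, not_or]
    at D2 D3 D4 hnt hEST
  obtain ⟨-, o1, o2, o3, o4⟩ := off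
  simp only [Set.disjoint_union_left] at o1 o2 o3 o4
  have hmodel : SplitModel G {p₁} {p₂} {p₃} {p₄} E S T :=
    ⟨hP, hE.offPath, ⟨hS, o1.1, o2.1, o3.1, o4.1⟩, ⟨hTc, o1.2, o2.2, o3.2, o4.2⟩,
      hEST.1, hEST.2, hdisj, hnt.1, hnt.2, hST, E1, E2, E3, E4, D3.1, D3.2⟩
  have S1 : Touch G S {p₁} := ⟨x, hxS, y, hy, hxy⟩
  have Tw : Touch G T {w} := ⟨z, hzT, w, rfl, hzw⟩
  refine hmodel.false hG (Or.inl S1) ?_ (Or.inl S1) D2 D4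
  rcases hwP with rfl | rfl | rfl | rfl
  · exact Or.inl Tw
  · exact Or.inr (Or.inl Tw)
  · exact absurd Tw D3.2
  · exact Or.inr (Or.inr Tw)

lemma Triconn.card_le_six (hT : Triconn G) (hG : ¬ IsInducedMinor gem G)
    (hP : PathModel G {p₁} {p₂} {p₃} {p₄}) : Nat.card V ≤ 6 := by
  classical
  have hP' := hP.symm
  have t4 : ∀ D, IsComp G (quad p₁ p₂ p₃ p₄)ᶜ D → Touch G D {p₄} := fun D hD =>
    hT.touch_last hG hP hD
  have t1 : ∀ D, IsComp G (quad p₁ p₂ p₃ p₄)ᶜ D → Touch G D {p₁} := fun D hD =>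
    hT.touch_last hG hP' (quad_symm ▸ hD)
  obtain ⟨D, hD, D2⟩ := hT.exists_touch_second hP
  obtain ⟨E, hE, E3⟩ := hT.exists_touch_second hP'
  rw [quad_symm] at hE
  have tt : ∀ D, IsComp G (quad p₁ p₂ p₃ p₄)ᶜ D → (Touch G D {p₂} ↔ ¬ Touch G D {p₃}) := by
    intro D hD
    have := hT.attachment hG hP hD
    have := t1 D hD
    have := t4 D hD
    tauto
  have D3 : ¬ Touch G D {p₃} := (tt D hD).mp D2
  have E2 : ¬ Touch G E {p₂} := fun h => (tt E hE).mp h E3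
  obtain ⟨x, rfl⟩ := hT.subsingleton_comp hG hP hD hE (t1 D hD) D2 D3 (t4 D hD) (t1 E hE) E2 E3
    (t4 E hE)
  obtain ⟨y, rfl⟩ := hT.subsingleton_comp hG hP' (quad_symm ▸ hE) (quad_symm ▸ hD) (t4 _ hE) E3 E2
    (t1 _ hE) (t4 _ hD) D3 D2 (t1 _ hD)
  have hDE : ({x} : Set V) ≠ {y} := fun h => E2 (h ▸ D2)
  have hcov : ∀ z : V, z ∈ ({p₁, p₂, p₃, p₄, x, y} : Finset V) := by
    intro z
    by_cases hz : z ∈ quad p₁ p₂ p₃ p₄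
    · rcases hz with rfl | rfl | rfl | rfl <;> simp
    obtain ⟨C, hC, hzC⟩ := exists_isComp (G := G) (D := (quad p₁ p₂ p₃ p₄)ᶜ) (x := z) hz
    by_cases hCx : C = {x}
    · subst hCx; rw [Set.mem_singleton_iff.mp hzC]; simp
    by_cases hCy : C = {y}
    · subst hCy; rw [Set.mem_singleton_iff.mp hzC]; simp
    exfalso
    by_cases h2 : Touch G C {p₂}
    · exact hG (hP.gem_of_abd_abd_acd hD.offPath hC.offPath hE.offPath (hD.disjoint_of_ne hE hDE)
        (hD.disjoint_of_ne hC (Ne.symm hCx)) (hC.disjoint_of_ne hE hCy)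
        (hC.not_touch_of_ne hE hCy) (t1 _ hD) (t4 _ hD) (t1 _ hC) h2 (t4 _ hC) (t1 _ hE) E2
        (t4 _ hE))
    · have h3 : Touch G C {p₃} := by have := tt C hC; tauto
      exact hG (hP'.gem_of_abd_abd_acd hE.offPath.symm hC.offPath.symm hD.offPath.symm
        (hE.disjoint_of_ne hD hDE.symm)
        (hE.disjoint_of_ne hC (Ne.symm hCy)) (hC.disjoint_of_ne hD hCx)
        (hC.not_touch_of_ne hD hCx) (t4 _ hE) (t1 _ hE) (t4 _ hC) h3 (t1 _ hC) (t4 _ hD) D3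
        (t1 _ hD))
  have : Nat.card V ≤ Nat.card ({p₁, p₂, p₃, p₄, x, y} : Finset V) :=
    Nat.card_le_card_of_injective (fun z => ⟨z, hcov z⟩) fun a b h => congrArg Subtype.val h
  have hcard := Nat.card_eq_fintype_card (α := ({p₁, p₂, p₃, p₄, x, y} : Finset V))
  rw [hcard, Fintype.card_coe] at this
  exact this.trans Finset.card_le_six

/-- Structure of gem-free graphs without cutvertices. -/
theorem Biconn.structure [Finite V] (hB : Biconn G) (hG : ¬ IsInducedMinor gem G) :
    IsCograph G ∨ Nat.card V ≤ 6 ∨ ∃ u v, IsGoodCut G u v := by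
  by_cases hcut : ∃ (u v o : V) (D : Set V), u ≠ v ∧ IsComp G {u, v}ᶜ D ∧ o ∉ D ∧ o ≠ u ∧ o ≠ v
  · obtain ⟨u, v, o, D, huv, hD, ho, hou, hov⟩ := hcut
    exact Or.inr (Or.inr (exists_isGoodCut hG hB huv hD ho hou hov))
  have hT : Triconn G := hB.triconn fun u v o D huv hD ho hou => by
    by_contra hov
    exact hcut ⟨u, v, o, D, huv, hD, ho, hou, hov⟩
  by_cases hco : IsCograph G
  · exact Or.inl hco
  right; left
  unfold IsCograph at hco
  push Not at hco
  obtain ⟨f, hf, hadj⟩ := hco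
  have hne : ∀ i j, i ≠ j → Disjoint ({f i} : Set V) {f j} := fun i j h => by
    rw [Set.disjoint_singleton]; exact fun h' => h (hf h')
  refine hT.card_le_six hG (p₁ := f 0) (p₂ := f 1) (p₃ := f 2) (p₄ := f 3)
    ⟨conn_singleton _, conn_singleton _, conn_singleton _, conn_singleton _, hne _ _ (by decide),
      hne _ _ (by decide), hne _ _ (by decide), hne _ _ (by decide), hne _ _ (by decide),
      hne _ _ (by decide), ?_, ?_, ?_, ?_, ?_, ?_⟩ <;>
  simp [hadj, pathGraph_adj]

end Triconnected

section WellQuasiOrder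

universe u v

variable {α : Type u} {β : Type v}

/-- A set is partially well-ordered if it maps to a partially well-ordered set by a map which
reflects the relation. -/
lemma pwo_of_map {r : α → α → Prop} {r' : β → β → Prop} {s : Set α} {t : Set β} (f : α → β)
    (ht : t.PartiallyWellOrderedOn r') (hf : ∀ x ∈ s, f x ∈ t)
    (h : ∀ x ∈ s, ∀ y ∈ s, r' (f x) (f y) → r x y) : s.PartiallyWellOrderedOn r := by
  rw [Set.partiallyWellOrderedOn_iff_exists_lt]
  intro g hg
  obtain ⟨m, n, hmn, hr⟩ := ht.exists_lt (f := fun n => f (g n)) fun n => hf _ (hg n)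
  exact ⟨m, n, hmn, h _ (hg m) _ (hg n) hr⟩

/-- A version of `pwo_of_map` for a choice of data attached to the elements of the set. -/
lemma pwo_of_rel {r : α → α → Prop} {r' : β → β → Prop} {s : Set α} {t : Set β}
    (D : α → β → Prop) (ht : t.PartiallyWellOrderedOn r') (hD : ∀ x ∈ s, ∃ d ∈ t, D x d)
    (h : ∀ x ∈ s, ∀ y ∈ s, ∀ d e, D x d → D y e → r' d e → r x y) :
    s.PartiallyWellOrderedOn r := by
  rw [Set.partiallyWellOrderedOn_iff_exists_lt]
  intro g hg
  choose d hdt hd using fun n => hD _ (hg n)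
  obtain ⟨m, n, hmn, hr⟩ := ht.exists_lt hdt
  exact ⟨m, n, hmn, h _ (hg m) _ (hg n) _ _ (hd m) (hd n) hr⟩

/-- The minimal bad sequence argument: if for every partially well-ordered `T` the elements of `s`
all of whose pieces are in `T` are partially well-ordered, then `s` is partially well-ordered. -/
theorem pwo_of_pieces {r : α → α → Prop} (htrans : ∀ x y z, r x y → r y z → r x z) (rk : α → ℕ)
    {s : Set α} (piece : α → Set α)
    (hpiece : ∀ x ∈ s, ∀ y ∈ piece x, y ∈ s ∧ r y x ∧ rk y < rk x)
    (h : ∀ T ⊆ s, T.PartiallyWellOrderedOn r →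
      {x ∈ s | piece x ⊆ T}.PartiallyWellOrderedOn r) : s.PartiallyWellOrderedOn r := by
  rw [Set.PartiallyWellOrderedOn.iff_not_exists_isMinBadSeq rk]
  rintro ⟨f, hf, hmin⟩
  set T : Set α := ⋃ n, piece (f n) with hT
  have hTs : T ⊆ s := by
    intro y hy
    obtain ⟨n, hn⟩ := Set.mem_iUnion.mp hy
    exact (hpiece _ (hf.1 n) y hn).1
  have hpwo : T.PartiallyWellOrderedOn r := by
    rw [Set.PartiallyWellOrderedOn.iff_forall_not_isBadSeq]
    intro g hg
    choose n hn using fun i => Set.mem_iUnion.mp (hg.1 i)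
    obtain ⟨i₀, hi₀⟩ : ∃ i₀, ∀ i, n i₀ ≤ n i := by
      obtain ⟨m, ⟨i, hi⟩, hmin⟩ := WellFounded.has_min (wellFounded_lt (α := ℕ)) (Set.range n)
        ⟨_, ⟨0, rfl⟩⟩
      exact ⟨i, fun j => hi ▸ not_lt.mp (hmin _ ⟨j, rfl⟩)⟩
    refine hmin (n i₀) (fun k => if k < n i₀ then f k else g (i₀ + (k - n i₀)))
      (fun m hm => by simp [hm]) ?_ ⟨fun k => ?_, fun k l hkl hr => ?_⟩
    · simpa using (hpiece _ (hf.1 _) _ (hn i₀)).2.2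
    · by_cases hk : k < n i₀
      · simpa [hk] using hf.1 k
      · simpa [hk] using hTs (hg.1 _)
    · by_cases hl : l < n i₀
      · simp only [hl, hkl.trans hl, if_true] at hr
        exact hf.2 k l hkl hr
      · by_cases hk : k < n i₀
        · simp only [hk, hl, if_true, if_false] at hr
          exact hf.2 k _ (hk.trans_le (hi₀ _)) (htrans _ _ _ hr (hpiece _ (hf.1 _) _ (hn _)).2.1)
        · simp only [hk, hl, if_false] at hr
          exact hg.2 _ _ (by omega) hr
  obtain ⟨m, n, hmn, hr⟩ := (h T hTs hpwo).exists_lt (f := f)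
    fun n => ⟨hf.1 n, fun y hy => Set.mem_iUnion.mpr ⟨n, hy⟩⟩
  exact hf.2 m n hmn hr

lemma pwo_prod {r : α → α → Prop} {r' : β → β → Prop} (hrefl : ∀ x, r x x)
    (htrans : ∀ x y z, r x y → r y z → r x z) {s : Set α} {t : Set β}
    (hs : s.PartiallyWellOrderedOn r) (ht : t.PartiallyWellOrderedOn r') :
    (s ×ˢ t).PartiallyWellOrderedOn fun x y : α × β => r x.1 y.1 ∧ r' x.2 y.2 := by
  have : IsPreorder α r := { refl := hrefl, trans := htrans }
  exact hs.prod ht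

lemma pwo_univ_prop {r : Prop → Prop → Prop} (h : ∀ p, r p p) :
    (Set.univ : Set Prop).PartiallyWellOrderedOn r := by
  have : Std.Refl r := ⟨h⟩
  exact Set.finite_univ.partiallyWellOrderedOn

end WellQuasiOrder

section LabelledGraphs

universe u

/-- A finite graph with labelled vertices. -/
structure LGraph (L : Type u) : Type (max 1 u) where
  V : Type
  fin : Finite V
  graph : SimpleGraph V
  lab : V → L

attribute [instance] LGraph.fin

variable {L : Type u}

/-- A labelled induced minor model. The label of a vertex is compared by `R` with the set of labels
of its branch set. -/
structure LModel (R : L → Set L → Prop) (H K : LGraph L) (μ : H.V → Set K.V) : Prop where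
  conn : ∀ a, Conn K.graph (μ a)
  disj : ∀ a b, a ≠ b → Disjoint (μ a) (μ b)
  touch : ∀ a b, a ≠ b → (Touch K.graph (μ a) (μ b) ↔ H.graph.Adj a b)
  lab : ∀ a, R (H.lab a) (Set.image K.lab (μ a))

/-- The labelled induced minor relation. -/
def LGraph.Le (R : L → Set L → Prop) (H K : LGraph L) : Prop := ∃ μ, LModel R H K μ

/-- The properties of a comparison of labels with sets of labels which make the labelled induced
minor relation a quasi-order. -/
structure LabelRel (R : L → Set L → Prop) : Prop where
  refl : ∀ l, R l {l}
  trans : ∀ (l : L) (ι : Type) (f : ι → L) (g : ι → Set L), R l (Set.range f) →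
    (∀ i, R (f i) (g i)) → R l (⋃ i, g i)

/-- Some label of the set dominates the given label. -/
def exLab (r : L → L → Prop) (l : L) (S : Set L) : Prop := ∃ s ∈ S, r l s

lemma labelRel_exLab {r : L → L → Prop} (hrefl : ∀ x, r x x)
    (htrans : ∀ x y z, r x y → r y z → r x z) : LabelRel (exLab r) where
  refl l := ⟨l, rfl, hrefl l⟩
  trans l ι f g h1 h2 := by
    obtain ⟨_, ⟨i, rfl⟩, hi⟩ := h1
    obtain ⟨s, hs, h⟩ := h2 i
    exact ⟨s, Set.mem_iUnion.mpr ⟨i, hs⟩, htrans _ _ _ hi h⟩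

lemma Conn.biUnion {V W : Type*} {K : SimpleGraph V} {G : SimpleGraph W} {S : Set V}
    (hS : Conn K S) {ν : V → Set W} (hν : ∀ x ∈ S, Conn G (ν x))
    (h : ∀ x ∈ S, ∀ y ∈ S, K.Adj x y → Touch G (ν x) (ν y)) : Conn G (⋃ x ∈ S, ν x) := by
  refine ⟨?_, fun A hA hne hA' => ?_⟩
  · obtain ⟨x, hx⟩ := hS.1
    exact (hν x hx).1.mono (Set.subset_biUnion_of_mem hx)
  by_cases hx : ∃ x ∈ S, (A ∩ ν x).Nonempty ∧ A ∩ ν x ≠ ν x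
  · obtain ⟨x, hx, h1, h2⟩ := hx
    refine ((hν x hx).2 _ Set.inter_subset_right h1 h2).mono Set.inter_subset_left ?_
    rintro y ⟨hy, hy'⟩
    exact ⟨Set.mem_biUnion hx hy, fun hyA => hy' ⟨hyA, hy⟩⟩
  push Not at hx
  have hsub : ∀ x ∈ S, (A ∩ ν x).Nonempty → ν x ⊆ A := fun x hxS hn =>
    Set.inter_eq_right.mp (hx x hxS hn)
  obtain ⟨x, hx, y, hy, hxy⟩ := hS.2 {x ∈ S | ν x ⊆ A} (fun x hx => hx.1) (by
    obtain ⟨a, ha⟩ := hne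
    obtain ⟨x, hx, hax⟩ := Set.mem_iUnion₂.mp (hA ha)
    exact ⟨x, hx, hsub x hx ⟨a, ha, hax⟩⟩) (by
    intro heq
    refine hA' (Set.Subset.antisymm hA (Set.iUnion₂_subset fun x hx => ?_))
    exact ((Set.ext_iff.mp heq x).mpr hx).2)
  obtain ⟨p, hp, q, hq, hpq⟩ := h x hx.1 y hy.1 hxy
  refine ⟨p, hx.2 hp, q, ⟨Set.mem_biUnion hy.1 hq, fun hqA => hy.2 ⟨hy.1, ?_⟩⟩, hpq⟩
  exact hsub y hy.1 ⟨q, hqA, hq⟩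

variable {R : L → Set L → Prop}

lemma LGraph.Le.of_embedding {H K : LGraph L} (φ : H.V → K.V)
    (hinj : Function.Injective φ) (hadj : ∀ a b, K.graph.Adj (φ a) (φ b) ↔ H.graph.Adj a b)
    (hlab : ∀ a, R (H.lab a) {K.lab (φ a)}) : H.Le R K := by
  refine ⟨fun a => {φ a}, fun a => conn_singleton _, fun a b hab => ?_, fun a b _ => ?_,
    fun a => ?_⟩
  · rw [Set.disjoint_singleton]; exact fun h => hab (hinj h)
  · rw [touch_singleton, hadj]
  · rw [Set.image_singleton]; exact hlab a

lemma LGraph.Le.refl (hR : LabelRel R) (H : LGraph L) : H.Le R H :=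
  LGraph.Le.of_embedding id Function.injective_id (fun _ _ => Iff.rfl) fun _ => hR.refl _

lemma LGraph.Le.trans (hR : LabelRel R) {H K M : LGraph L} (h1 : H.Le R K) (h2 : K.Le R M) :
    H.Le R M := by
  obtain ⟨μ, hμ⟩ := h1
  obtain ⟨ν, hν⟩ := h2
  have hdisj : ∀ {a b}, a ≠ b → ∀ x ∈ μ a, ∀ y ∈ μ b, x ≠ y := by
    rintro a b hab x hx y hy rfl
    exact Set.disjoint_left.mp (hμ.disj a b hab) hx hy
  refine ⟨fun a => ⋃ x ∈ μ a, ν x, fun a => ?_, fun a b hab => ?_, fun a b hab => ?_, fun a => ?_⟩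
  · exact (hμ.conn a).biUnion (fun x _ => hν.conn x)
      fun x _ y _ hxy => (hν.touch x y hxy.ne).mpr hxy
  · simp only [Set.disjoint_iUnion_left, Set.disjoint_iUnion_right]
    exact fun y hy x hx => hν.disj _ _ (hdisj hab x hx y hy)
  · rw [← hμ.touch a b hab]
    constructor
    · rintro ⟨p, hp, q, hq, hpq⟩
      obtain ⟨x, hx, hpx⟩ := Set.mem_iUnion₂.mp hp
      obtain ⟨y, hy, hqy⟩ := Set.mem_iUnion₂.mp hq
      exact ⟨x, hx, y, hy, (hν.touch x y (hdisj hab x hx y hy)).mp ⟨p, hpx, q, hqy, hpq⟩⟩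
    · rintro ⟨x, hx, y, hy, hxy⟩
      exact ((hν.touch x y hxy.ne).mpr hxy).mono (Set.subset_biUnion_of_mem hx)
        (Set.subset_biUnion_of_mem hy)
  · have := hR.trans (H.lab a) (μ a) (fun x => K.lab x) (fun x => M.lab '' ν x)
      (by convert hμ.lab a; ext; simp) fun x => hν.lab x
    convert this
    simp only [Set.image_iUnion, Set.iUnion_coe_set]

/-- The labelled induced subgraph. -/
def LGraph.ind (H : LGraph L) (S : Set H.V) : LGraph L :=
  ⟨S, inferInstance, H.graph.induce S, fun x => H.lab x⟩

lemma LGraph.ind_le (hR : LabelRel R) (H : LGraph L) (S : Set H.V) : (H.ind S).Le R H :=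
  LGraph.Le.of_embedding (fun x : S => (x : H.V)) Subtype.val_injective (fun _ _ => Iff.rfl)
    fun _ => hR.refl _

lemma card_ind_lt (H : LGraph L) {S : Set H.V} (hS : Sᶜ.Nonempty) :
    Nat.card (H.ind S).V < Nat.card H.V := by
  obtain ⟨x, hx⟩ := hS
  exact Set.ncard_lt_card (fun h => hx (h ▸ Set.mem_univ x))

lemma conn_induce {V : Type*} {G : SimpleGraph V} {S : Set V} {T : Set S} :
    Conn (G.induce S) T ↔ Conn G (Subtype.val '' T) := by
  constructor
  · intro h
    have := h.biUnion (G := G) (ν := fun x => {(x : V)}) (fun x _ => conn_singleton _)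
      fun x _ y _ hxy => touch_singleton.mpr hxy
    convert this
    ext; simp
  · intro h
    refine ⟨by simpa using h.1, fun A hA hne hA' => ?_⟩
    obtain ⟨_, ⟨x, hx, rfl⟩, _, ⟨⟨y, hy, rfl⟩, hy'⟩, hxy⟩ := h.2 (Subtype.val '' A)
      (Set.image_mono hA) (hne.image _)
      fun h => hA' (Subtype.val_injective.image_injective h)
    exact ⟨x, hx, y, ⟨hy, fun hyA => hy' ⟨y, hyA, rfl⟩⟩, hxy⟩

lemma touch_induce {V : Type*} {G : SimpleGraph V} {S : Set V} {T U : Set S} :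
    Touch (G.induce S) T U ↔ Touch G (Subtype.val '' T) (Subtype.val '' U) := by
  simp [Touch]

end LabelledGraphs

section Splitting

universe u

variable {L : Type u} {R : L → Set L → Prop}

/-- The adjacency between `S` and its complement is constantly `c`. -/
def Homog {V : Type*} (G : SimpleGraph V) (S : Set V) (c : Prop) : Prop :=
  S.Nonempty ∧ Sᶜ.Nonempty ∧ ∀ x ∈ S, ∀ y ∉ S, (G.Adj x y ↔ c)

lemma Homog.compl {V : Type*} {G : SimpleGraph V} {S : Set V} {c : Prop} (h : Homog G S c) :
    Homog G Sᶜ c :=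
  ⟨h.2.1, by simpa using h.1, fun x hx y hy => by
    rw [G.adj_comm]; exact h.2.2 y (not_not.mp hy) x hx⟩

open Classical in
lemma LGraph.Le.glue {H K : LGraph L} {A : Set H.V} {B : Set K.V} {c : Prop}
    (hA : Homog H.graph A c) (hB : Homog K.graph B c)
    (h1 : (H.ind A).Le R (K.ind B)) (h2 : (H.ind Aᶜ).Le R (K.ind Bᶜ)) : H.Le R K := by
  obtain ⟨μ, hμ⟩ := h1
  obtain ⟨ν, hν⟩ := h2
  change A → Set B at μ
  change (Aᶜ : Set H.V) → Set (Bᶜ : Set K.V) at ν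
  have hcross : ∀ (a : A) (b : (Aᶜ : Set H.V)), Disjoint (Subtype.val '' μ a) (Subtype.val '' ν b)
      ∧ (Touch K.graph (Subtype.val '' μ a) (Subtype.val '' ν b) ↔ H.graph.Adj a b) := by
    intro a b
    constructor
    · rw [Set.disjoint_left]
      rintro _ ⟨x, _, rfl⟩ ⟨y, _, hy⟩
      exact y.2 (hy ▸ x.2)
    · rw [hA.2.2 a a.2 b b.2]
      constructor
      · rintro ⟨_, ⟨x, _, rfl⟩, _, ⟨y, _, rfl⟩, hxy⟩
        exact (hB.2.2 x x.2 y y.2).mp hxy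
      · intro hc
        have hμa : (μ a).Nonempty := (hμ.conn a).1
        have hνb : (ν b).Nonempty := (hν.conn b).1
        obtain ⟨x, hx⟩ := hμa
        obtain ⟨y, hy⟩ := hνb
        exact ⟨x, ⟨x, hx, rfl⟩, y, ⟨y, hy, rfl⟩, (hB.2.2 x x.2 y y.2).mpr hc⟩
  refine ⟨fun x => if hx : x ∈ A then Subtype.val '' μ ⟨x, hx⟩ else Subtype.val '' ν ⟨x, hx⟩,
    fun x => ?_, fun x y hxy => ?_, fun x y hxy => ?_, fun x => ?_⟩
  · by_cases hx : x ∈ A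
    · simpa only [hx, dif_pos] using conn_induce.mp (hμ.conn ⟨x, hx⟩)
    · simpa only [hx, dif_neg, not_false_eq_true] using conn_induce.mp (hν.conn ⟨x, hx⟩)
  · by_cases hx : x ∈ A <;> by_cases hy : y ∈ A <;>
      simp only [hx, hy, dif_pos, dif_neg, not_false_eq_true]
    · rw [Set.disjoint_image_iff Subtype.val_injective]
      exact hμ.disj ⟨x, hx⟩ ⟨y, hy⟩ fun h => hxy (congrArg Subtype.val h)
    · exact (hcross ⟨x, hx⟩ ⟨y, hy⟩).1
    · exact (hcross ⟨y, hy⟩ ⟨x, hx⟩).1.symm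
    · rw [Set.disjoint_image_iff Subtype.val_injective]
      exact hν.disj ⟨x, hx⟩ ⟨y, hy⟩ fun h => hxy (congrArg Subtype.val h)
  · by_cases hx : x ∈ A <;> by_cases hy : y ∈ A <;>
      simp only [hx, hy, dif_pos, dif_neg, not_false_eq_true]
    · rw [← touch_induce]
      exact hμ.touch ⟨x, hx⟩ ⟨y, hy⟩ fun h => hxy (congrArg Subtype.val h)
    · exact (hcross ⟨x, hx⟩ ⟨y, hy⟩).2
    · rw [touch_comm, H.graph.adj_comm]
      exact (hcross ⟨y, hy⟩ ⟨x, hx⟩).2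
    · rw [← touch_induce]
      exact hν.touch ⟨x, hx⟩ ⟨y, hy⟩ fun h => hxy (congrArg Subtype.val h)
  · by_cases hx : x ∈ A <;> simp only [hx, dif_pos, dif_neg, not_false_eq_true]
    · have := hμ.lab ⟨x, hx⟩
      rw [Set.image_image]
      exact this
    · have := hν.lab ⟨x, hx⟩
      rw [Set.image_image]
      exact this

/-- A class of labelled graphs closed under splitting along homogeneous cuts is partially
well-ordered if its graphs without homogeneous cuts are. -/
theorem pwo_of_homog (hR : LabelRel R) (C : Prop → Prop) {P : LGraph L → Prop}
    (hP : ∀ H S c, P H → C c → Homog H.graph S c → P (H.ind S))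
    (hbase : {H | P H ∧ ∀ S c, C c → ¬ Homog H.graph S c}.PartiallyWellOrderedOn (LGraph.Le R)) :
    {H | P H}.PartiallyWellOrderedOn (LGraph.Le R) := by
  refine pwo_of_pieces (r := LGraph.Le R) (fun _ _ _ => LGraph.Le.trans hR)
    (fun H : LGraph L => Nat.card H.V)
    (fun H : LGraph L => {K | ∃ S c, C c ∧ Homog H.graph S c ∧ K = H.ind S}) ?_ fun T hTs hT => ?_
  · rintro H hH _ ⟨S, c, hc, hS, rfl⟩
    exact ⟨hP H S c hH hc hS, H.ind_le hR S, card_ind_lt H hS.2.1⟩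
  have hpair : {H | ∃ S c, C c ∧ Homog H.graph S c ∧ H.ind S ∈ T ∧
      H.ind Sᶜ ∈ T}.PartiallyWellOrderedOn (LGraph.Le R) := by
    refine pwo_of_rel (t := T ×ˢ (T ×ˢ (Set.univ : Set Prop)))
      (fun H d => ∃ S, Homog H.graph S d.2.2 ∧ d.1 = H.ind S ∧ d.2.1 = H.ind Sᶜ)
      (pwo_prod (LGraph.Le.refl hR) (fun _ _ _ => LGraph.Le.trans hR) hT
        (pwo_prod (LGraph.Le.refl hR) (fun _ _ _ => LGraph.Le.trans hR) hT
          (pwo_univ_prop (r := Eq) fun _ => rfl))) ?_ ?_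
    · rintro H ⟨S, c, -, hS, h1, h2⟩
      exact ⟨(H.ind S, H.ind Sᶜ, c), ⟨h1, h2, trivial⟩, S, hS, rfl, rfl⟩
    · rintro H - K - ⟨_, _, c⟩ ⟨_, _, c'⟩ ⟨S, hS, rfl, rfl⟩ ⟨S', hS', rfl, rfl⟩ ⟨h1, h2, rfl⟩
      exact LGraph.Le.glue hS hS' h1 h2
  refine (hbase.union hpair).mono ?_
  rintro H ⟨hH, hpc⟩
  by_cases h : ∃ S c, C c ∧ Homog H.graph S c
  · obtain ⟨S, c, hc, hS⟩ := h
    exact Or.inr ⟨S, c, hc, hS, hpc ⟨S, c, hc, hS, rfl⟩, hpc ⟨Sᶜ, c, hc, hS.compl, rfl⟩⟩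
  · push Not at h
    exact Or.inl ⟨hH, h⟩

lemma pwo_of_card_eq (hR : LabelRel R) (hw : WellQuasiOrdered fun l l' => R l {l'}) (k : ℕ) :
    {H : LGraph L | Nat.card H.V = k}.PartiallyWellOrderedOn (LGraph.Le R) := by
  have hrefl : ∀ l, R l {l} := hR.refl
  have htrans : ∀ x y z, R x {y} → R y {z} → R x {z} := fun x y z h1 h2 => by
    have := hR.trans x Unit (fun _ => y) (fun _ => {z}) (by simpa using h1) fun _ => h2
    simpa using this
  have hpre : IsPreorder L fun l l' => R l {l'} := { refl := hrefl, trans := htrans }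
  have hpi := WellQuasiOrdered.pi (ι := Fin k) (fun _ => hw)
  have hadj : (Set.univ : Set (Fin k → Fin k → Prop)).PartiallyWellOrderedOn Eq :=
    Set.finite_univ.partiallyWellOrderedOn
  refine pwo_of_rel (fun H d => ∃ e : Fin k ≃ H.V, d.1 = (fun i => H.lab (e i)) ∧
      d.2 = fun i j => H.graph.Adj (e i) (e j))
    (pwo_prod (fun _ _ => hrefl _) (fun _ _ _ h1 h2 i => htrans _ _ _ (h1 i) (h2 i))
      (Set.partiallyWellOrderedOn_univ_iff.mpr hpi) hadj) ?_ ?_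
  · intro H hH
    exact ⟨(_, _), ⟨trivial, trivial⟩, (Finite.equivFinOfCardEq hH).symm, rfl, rfl⟩
  · rintro H - K - ⟨_, _⟩ ⟨_, _⟩ ⟨e, rfl, rfl⟩ ⟨f, rfl, rfl⟩ ⟨h1, h2⟩
    refine LGraph.Le.of_embedding (fun x => f (e.symm x))
      (f.injective.comp e.symm.injective) (fun a b => ?_) fun a => ?_
    · have := congrFun (congrFun h2 (e.symm a)) (e.symm b)
      simpa using this.symm
    · have := h1 (e.symm a)
      simpa using this

lemma pwo_of_card_le (hR : LabelRel R) (hw : WellQuasiOrdered fun l l' => R l {l'}) (k : ℕ) :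
    {H : LGraph L | Nat.card H.V ≤ k}.PartiallyWellOrderedOn (LGraph.Le R) := by
  induction k with
  | zero => exact (pwo_of_card_eq hR hw 0).mono fun H hH => Nat.le_zero.mp hH
  | succ k ih =>
    refine (ih.union (pwo_of_card_eq hR hw (k + 1))).mono fun H hH => ?_
    rcases Nat.le_succ_iff.mp hH with h | h
    · exact Or.inl h
    · exact Or.inr h

end Splitting

section Cographs

variable {V : Type*} {G : SimpleGraph V}

lemma isCograph_iff : IsCograph G ↔ ∀ a b c d, G.Adj a b → G.Adj b c → G.Adj c d →
    ¬ G.Adj a c → ¬ G.Adj a d → G.Adj b d := by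
  constructor
  · intro h a b c d hab hbc hcd hac had
    by_contra hbd
    have h1 : a ≠ c := by rintro rfl; exact had hcd
    have h2 : a ≠ d := by rintro rfl; exact hac hcd.symm
    have h3 : b ≠ d := by rintro rfl; exact had hab
    refine h ![a, b, c, d] ?_ ?_
    · intro i j hij
      fin_cases i <;> fin_cases j <;>
        simp_all [hab.ne, hbc.ne, hcd.ne, hab.ne', hbc.ne', hcd.ne', h1.symm, h2.symm, h3.symm]
    · intro i j
      fin_cases i <;> fin_cases j <;>
        simp [pathGraph_adj, hab, hbc, hcd, hac, had, hbd, hab.symm, hbc.symm, hcd.symm,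
          mt G.adj_symm hac, mt G.adj_symm had, mt G.adj_symm hbd]
  · intro h f hf hadj
    have := h (f 0) (f 1) (f 2) (f 3)
    simp [hadj, pathGraph_adj] at this

lemma IsCograph.compl (h : IsCograph G) : IsCograph Gᶜ := by
  rw [isCograph_iff] at h ⊢
  intro a b c d hab hbc hcd hac had
  have h1 : a ≠ c := by rintro rfl; exact had hcd
  have h2 : a ≠ d := by rintro rfl; exact hac hcd.symm
  rw [compl_adj] at *
  by_contra hbd
  have h3 : b ≠ d := by rintro rfl; exact had hab
  have hac' : G.Adj a c := by tauto
  have had' : G.Adj a d := by tauto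
  have hbd' : G.Adj b d := by tauto
  exact hab.2 (h c a d b hac'.symm had' hbd'.symm hcd.2 fun h => hbc.2 h.symm)

lemma IsCograph.induce (h : IsCograph G) (S : Set V) : IsCograph (G.induce S) := by
  rw [isCograph_iff] at h ⊢
  exact fun a b c d => h a b c d

/-- The set `S` has a proper nonempty part whose adjacency to the rest of `S` is constant. -/
def Splits (G : SimpleGraph V) (S : Set V) : Prop :=
  ∃ A ⊆ S, A.Nonempty ∧ (S \ A).Nonempty ∧ ∃ c, ∀ x ∈ A, ∀ y ∈ S \ A, (G.Adj x y ↔ c)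

lemma Splits.compl {S : Set V} (h : Splits G S) : Splits Gᶜ S := by
  obtain ⟨A, hA, hne, hne', c, hc⟩ := h
  refine ⟨A, hA, hne, hne', ¬ c, fun x hx y hy => ?_⟩
  rw [compl_adj, hc x hx y hy]
  have : x ≠ y := by rintro rfl; exact hy.2 hx
  tauto

lemma splits_insert_of_not_conn (h : IsCograph G) {S : Set V} {v : V} (hv : v ∉ S)
    (hne : S.Nonempty) (hS : ¬ Conn G S) : Splits G (insert v S) := by
  by_cases hall : ∀ x ∈ S, G.Adj v x
  · refine ⟨{v}, by simp, ⟨v, rfl⟩, ?_, True, ?_⟩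
    · obtain ⟨x, hx⟩ := hne
      exact ⟨x, Or.inr hx, by rintro rfl; exact hv hx⟩
    · rintro x hx y ⟨hy | hy, hyx⟩
      · exact absurd hy hyx
      · rw [Set.mem_singleton_iff.mp hx]
        simp [hall y hy]
  by_cases hcomp : ∃ C, IsComp G S C ∧ ∀ x ∈ C, ¬ G.Adj v x
  · obtain ⟨C, hC, hvC⟩ := hcomp
    refine ⟨C, fun x hx => Or.inr (hC.1 hx), hC.2.1.1, ⟨v, Or.inl rfl, fun h => hv (hC.1 h)⟩,
      False, ?_⟩
    rintro x hx y ⟨hy | hy, hyx⟩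
    · rw [hy]
      simpa using fun h => hvC x hx (G.adj_symm h)
    · simpa using fun h => hyx (hC.mem_of_adj hx hy h)
  push Not at hall hcomp
  obtain ⟨x, hx, hvx⟩ := hall
  obtain ⟨C, hC, hxC⟩ := exists_isComp (G := G) hx
  obtain ⟨y, hyC, hvy⟩ := hcomp C hC
  obtain ⟨y, ⟨hyC, hvy⟩, x, ⟨hxC, hvx⟩, hyx⟩ := hC.2.1.2 {y ∈ C | G.Adj v y} (fun _ h => h.1)
    ⟨y, hyC, hvy⟩ fun heq => hvx ((Set.ext_iff.mp heq x).mpr hxC).2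
  have hCS : C ≠ S := by rintro rfl; exact hS hC.2.1
  obtain ⟨z, hz, hzC⟩ : ∃ z ∈ S, z ∉ C := by
    by_contra hcon
    push Not at hcon
    exact hCS (Set.Subset.antisymm hC.1 hcon)
  obtain ⟨C', hC', hzC'⟩ := exists_isComp (G := G) hz
  obtain ⟨z, hzC', hvz⟩ := hcomp C' hC'
  have hnt := hC.not_touch_of_ne hC' (by rintro rfl; contradiction)
  have := isCograph_iff.mp h x y v z hyx.symm hvy.symm hvz
    (fun h' => hvx ⟨hxC, h'.symm⟩) (fun h' => hnt ⟨x, hxC, z, hzC', h'⟩)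
  exact absurd ⟨y, hyC, z, hzC', this⟩ hnt

lemma IsCograph.splits (h : IsCograph G) {S : Set V} (hfin : S.Finite) (hS : S.Nontrivial) :
    Splits G S := by
  induction S, hfin using Set.Finite.induction_on with
  | empty => simp at hS
  | @insert v S hv hfin ih =>
    rcases S.eq_empty_or_nonempty with rfl | hne
    · simp at hS
    rcases hne.exists_eq_singleton_or_nontrivial with ⟨x, rfl⟩ | hnt
    · refine ⟨{v}, by simp, ⟨v, rfl⟩, ⟨x, Or.inr rfl, fun h => hv h.symm⟩, G.Adj v x, ?_⟩
      rintro y hy z ⟨hz | hz, hzy⟩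
      · exact absurd hz hzy
      · rw [Set.mem_singleton_iff.mp hy, Set.mem_singleton_iff.mp hz]
    obtain ⟨A, hA, hA1, hA2, c, hc⟩ := ih hnt
    have hAS : A ≠ S := by rintro rfl; simp at hA2
    by_cases hcc : c
    · rw [← compl_compl G]
      refine (splits_insert_of_not_conn h.compl hv hne fun hconn => ?_).compl
      obtain ⟨x, hx, y, hy, hxy⟩ := hconn.2 A hA hA1 hAS
      rw [compl_adj] at hxy
      exact hxy.2 ((hc x hx y hy).mpr hcc)
    · refine splits_insert_of_not_conn h hv hne fun hconn => ?_
      obtain ⟨x, hx, y, hy, hxy⟩ := hconn.2 A hA hA1 hAS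
      exact hcc ((hc x hx y hy).mp hxy)

/-- Labelled cographs are well-quasi-ordered. -/
theorem pwo_isCograph {L : Type*} {R : L → Set L → Prop} (hR : LabelRel R)
    (hw : WellQuasiOrdered fun l l' => R l {l'}) :
    {H : LGraph L | IsCograph H.graph}.PartiallyWellOrderedOn (LGraph.Le R) := by
  refine pwo_of_homog hR (fun _ => True) (P := fun H => IsCograph H.graph)
    (fun H S c hH _ _ => hH.induce S) ((pwo_of_card_le hR hw 1).mono ?_)
  rintro H ⟨hH, hhom⟩
  change Nat.card H.V ≤ 1
  by_contra hcard
  have hnt : Nontrivial H.V := Finite.one_lt_card_iff_nontrivial.mp (by omega)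
  obtain ⟨A, -, h1, h2, c, hc⟩ := hH.splits Set.finite_univ Set.nontrivial_univ
  refine hhom A c trivial ⟨h1, by simpa [Set.compl_eq_univ_sdiff] using h2, fun x hx y hy => ?_⟩
  exact hc x hx y ⟨trivial, hy⟩

end Cographs

section Paths

universe u

variable {L : Type u} {r : L → L → Prop}

/-- Comparison of labels carrying two marks: the marks of a branch set are recorded exactly. -/
def cutLab (r : L → L → Prop) (l : L × Prop × Prop) (S : Set (L × Prop × Prop)) : Prop :=
  (∃ s ∈ S, r l.1 s.1) ∧ (l.2.1 ↔ ∃ s ∈ S, s.2.1) ∧ (l.2.2 ↔ ∃ s ∈ S, s.2.2)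

lemma labelRel_cutLab (hrefl : ∀ x, r x x) (htrans : ∀ x y z, r x y → r y z → r x z) :
    LabelRel (cutLab r) where
  refl l := ⟨⟨l, rfl, hrefl _⟩, by simp, by simp⟩
  trans l ι f g h1 h2 := by
    obtain ⟨⟨_, ⟨i, rfl⟩, hi⟩, hu, hv⟩ := h1
    refine ⟨?_, ?_, ?_⟩
    · obtain ⟨s, hs, h⟩ := (h2 i).1
      exact ⟨s, Set.mem_iUnion.mpr ⟨i, hs⟩, htrans _ _ _ hi h⟩
    · rw [hu]
      simp only [Set.exists_range_iff, (h2 _).2.1, Set.mem_iUnion]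
      grind
    · rw [hv]
      simp only [Set.exists_range_iff, (h2 _).2.2, Set.mem_iUnion]
      grind

lemma wqo_cutLab (hrefl : ∀ x, r x x) (htrans : ∀ x y z, r x y → r y z → r x z)
    (hw : WellQuasiOrdered r) : WellQuasiOrdered fun l l' => cutLab r l {l'} := by
  have hpre : IsPreorder L r := { refl := hrefl, trans := htrans }
  have hP : WellQuasiOrdered (Eq : Prop × Prop → Prop × Prop → Prop) :=
    Set.partiallyWellOrderedOn_univ_iff.mp Set.finite_univ.partiallyWellOrderedOn
  intro f
  obtain ⟨m, n, hmn, h1, h2⟩ := (hw.prod hP) f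
  exact ⟨m, n, hmn, ⟨_, rfl, h1⟩, by simp [h2], by simp [h2]⟩

/-- An embedding of words gives a surjective nondecreasing map between their positions. -/
lemma exists_retraction_of_sublistForall₂ {w w' : List L} (h : List.SublistForall₂ r w w')
    (hne : w ≠ []) : ∃ g : ℕ → ℕ, g 0 = 0 ∧ g (w'.length - 1) = w.length - 1 ∧
      (∀ j, g j ≤ g (j + 1) ∧ g (j + 1) ≤ g j + 1) ∧
      ∀ i a, w[i]? = some a → ∃ j b, w'[j]? = some b ∧ g j = i ∧ r a b := by
  induction h with
  | nil => exact absurd rfl hne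
  | @cons a b l l' hab hl ih =>
    by_cases hnil : l = []
    · subst hnil
      refine ⟨fun _ => 0, rfl, rfl, by simp, fun i c hi => ⟨0, b, rfl, ?_⟩⟩
      rcases i with _ | i
      · simp at hi; exact ⟨rfl, hi ▸ hab⟩
      · simp at hi
    obtain ⟨g, h0, hlast, hstep, hlab⟩ := ih hnil
    have hl0 : 0 < l.length := List.length_pos_of_ne_nil hnil
    have hl0' : 0 < l'.length := by
      obtain ⟨j, b, hj, -⟩ := hlab 0 l[0] (by simp)
      have := (List.getElem?_eq_some_iff.mp hj).1
      omega
    refine ⟨fun j => if j = 0 then 0 else g (j - 1) + 1, by simp, ?_, ?_, ?_⟩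
    · simp only [List.length_cons, Nat.add_sub_cancel]
      rw [if_neg hl0'.ne', hlast]
      omega
    · rintro (_ | j)
      · simp [h0]
      · simpa using hstep j
    · rintro (_ | i) c hi
      · simp at hi
        exact ⟨0, b, rfl, by simp, hi ▸ hab⟩
      · obtain ⟨j, d, hj, hg, hr⟩ := hlab i c (by simpa using hi)
        exact ⟨j + 1, d, by simpa using hj, by simpa using hg, hr⟩
  | @cons_right b l l' hl ih =>
    obtain ⟨g, h0, hlast, hstep, hlab⟩ := ih hne
    have hl0 : 0 < l.length := List.length_pos_of_ne_nil hne
    have hl0' : 0 < l'.length := by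
      obtain ⟨j, b, hj, -⟩ := hlab 0 l[0] (by simp)
      have := (List.getElem?_eq_some_iff.mp hj).1
      omega
    refine ⟨fun j => if j = 0 then 0 else g (j - 1), by simp, ?_, ?_, ?_⟩
    · simp only [List.length_cons, Nat.add_sub_cancel]
      rw [if_neg hl0'.ne', hlast]
    · rintro (_ | j)
      · simp [h0]
      · simpa using hstep j
    · intro i c hi
      obtain ⟨j, d, hj, hg, hr⟩ := hlab i c hi
      exact ⟨j + 1, d, by simpa using hj, by simpa using hg, hr⟩

/-- The sequence `q` enumerates `C` as a path with the marks at its ends. -/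
structure PathEnum (H : LGraph (L × Prop × Prop)) (C : Set H.V) (k : ℕ) (q : ℕ → H.V) : Prop where
  pos : 0 < k
  mem : ∀ x, x ∈ C ↔ ∃ i < k, q i = x
  inj : ∀ i < k, ∀ j < k, q i = q j → i = j
  adj : ∀ i < k, ∀ j < k, (H.graph.Adj (q i) (q j) ↔ j = i + 1 ∨ i = j + 1)
  left : ∀ i < k, ((H.lab (q i)).2.1 ↔ i = 0)
  right : ∀ i < k, ((H.lab (q i)).2.2 ↔ i = k - 1)

lemma PathEnum.le {H K : LGraph (L × Prop × Prop)} {m k : ℕ} {p : ℕ → H.V} {q : ℕ → K.V}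
    (hp : PathEnum H Set.univ m p) (hq : PathEnum K Set.univ k q) {g : ℕ → ℕ} (h0 : g 0 = 0)
    (hlast : g (k - 1) = m - 1) (hstep : ∀ j, g j ≤ g (j + 1) ∧ g (j + 1) ≤ g j + 1)
    (hlab : ∀ i < m, ∃ j < k, g j = i ∧ r (H.lab (p i)).1 (K.lab (q j)).1) :
    H.Le (cutLab r) K := by
  have hmono : Monotone g := monotone_nat_of_le_succ fun j => (hstep j).1
  have hk := hq.pos
  have hm := hp.pos
  have hlt : ∀ j < k, g j < m := fun j hj => by
    have := hmono (show j ≤ k - 1 by omega)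
    omega
  have hex : ∀ x, ∃ i < m, p i = x := fun x => (hp.mem x).mp trivial
  have hbag : ∀ j < k, ∀ i < m, (p (g j) = p i ↔ g j = i) := fun j hj i hi =>
    ⟨hp.inj _ (hlt j hj) _ hi, fun h => h ▸ rfl⟩
  have hsucc : ∀ i, i + 1 < m → ∃ j, j + 1 < k ∧ g j = i ∧ g (j + 1) = i + 1 := by
    intro i hi
    classical
    have hex : ∃ j, g j = i + 1 := by
      obtain ⟨j, -, hj, -⟩ := hlab (i + 1) hi
      exact ⟨j, hj⟩
    obtain ⟨j', hj', hgj', -⟩ := hlab (i + 1) hi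
    have h1 := Nat.find_spec hex
    have h2 : Nat.find hex ≤ j' := Nat.find_min' hex hgj'
    obtain ⟨j, hj⟩ : ∃ j, Nat.find hex = j + 1 := by
      refine Nat.exists_eq_succ_of_ne_zero fun h => ?_
      rw [h] at h1
      omega
    have h3 : g j ≠ i + 1 := Nat.find_min hex (by omega)
    rw [hj] at h1 h2
    have := hstep j
    exact ⟨j, by omega, by omega, h1⟩
  refine ⟨fun x => {y | ∃ j < k, q j = y ∧ p (g j) = x}, fun x => ?_, fun x y hxy => ?_,
    fun x y hxy => ?_, fun x => ?_⟩
  · obtain ⟨i, hi, rfl⟩ := hex x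
    have hfin : {j | j < k ∧ g j = i}.Finite := (Set.finite_lt_nat k).subset fun j hj => hj.1
    have hne : {j | j < k ∧ g j = i}.Nonempty := by
      obtain ⟨j, hj, hg, -⟩ := hlab i hi
      exact ⟨j, hj, hg⟩
    obtain ⟨a, ⟨ha, hga⟩, hamin⟩ := Set.exists_min_image _ id hfin hne
    obtain ⟨b, ⟨hb, hgb⟩, hbmax⟩ := Set.exists_max_image _ id hfin hne
    have : {y | ∃ j < k, q j = y ∧ p (g j) = p i} = seg q a b := by
      ext y
      rw [mem_seg]
      constructor
      · rintro ⟨j, hj, rfl, hg⟩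
        rw [hbag j hj i hi] at hg
        exact ⟨j, hamin j ⟨hj, hg⟩, hbmax j ⟨hj, hg⟩, rfl⟩
      · rintro ⟨j, h1, h2, rfl⟩
        have h3 := hmono h1
        have h4 := hmono h2
        have hj : j < k := by omega
        exact ⟨j, hj, rfl, (hbag j hj i hi).mpr (by omega)⟩
    rw [this]
    exact conn_seg (hamin b ⟨hb, hgb⟩) fun j _ hjb =>
      (hq.adj j (by omega) (j + 1) (by omega)).mpr (Or.inl rfl)
  · rw [Set.disjoint_left]
    rintro _ ⟨j, hj, rfl, h1⟩ ⟨j', hj', h2, h3⟩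
    rw [hq.inj _ hj' _ hj h2] at h3
    exact hxy (h1.symm.trans h3)
  · obtain ⟨i, hi, rfl⟩ := hex x
    obtain ⟨i', hi', rfl⟩ := hex y
    rw [hp.adj i hi i' hi']
    constructor
    · rintro ⟨_, ⟨j, hj, rfl, h1⟩, _, ⟨j', hj', rfl, h2⟩, h3⟩
      rw [hbag j hj i hi] at h1
      rw [hbag j' hj' i' hi'] at h2
      have hii : i ≠ i' := fun h => hxy (h ▸ rfl)
      have hs := hstep j
      have hs' := hstep j'
      rcases (hq.adj j hj j' hj').mp h3 with rfl | rfl <;> omega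
    · rintro (rfl | rfl)
      · obtain ⟨j, hj, h1, h2⟩ := hsucc i hi'
        exact ⟨q j, ⟨j, by omega, rfl, by rw [h1]⟩, q (j + 1), ⟨j + 1, hj, rfl, by rw [h2]⟩,
          (hq.adj j (by omega) (j + 1) hj).mpr (Or.inl rfl)⟩
      · obtain ⟨j, hj, h1, h2⟩ := hsucc i' hi
        exact ⟨q (j + 1), ⟨j + 1, hj, rfl, by rw [h2]⟩, q j, ⟨j, by omega, rfl, by rw [h1]⟩,
          (hq.adj (j + 1) hj j (by omega)).mpr (Or.inr rfl)⟩
  · obtain ⟨i, hi, rfl⟩ := hex x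
    refine ⟨?_, ?_, ?_⟩
    · obtain ⟨j, hj, hg, hr⟩ := hlab i hi
      exact ⟨_, ⟨q j, ⟨j, hj, rfl, by rw [hg]⟩, rfl⟩, hr⟩
    · rw [hp.left i hi]
      constructor
      · rintro rfl
        exact ⟨_, ⟨q 0, ⟨0, hk, rfl, by rw [h0]⟩, rfl⟩, (hq.left 0 hk).mpr rfl⟩
      · rintro ⟨_, ⟨_, ⟨j, hj, rfl, hg⟩, rfl⟩, h⟩
        rw [hq.left j hj] at h
        rw [hbag j hj i hi, h, h0] at hg
        exact hg.symm
    · rw [hp.right i hi]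
      constructor
      · rintro rfl
        exact ⟨_, ⟨q (k - 1), ⟨k - 1, by omega, rfl, by rw [hlast]⟩, rfl⟩,
          (hq.right (k - 1) (by omega)).mpr rfl⟩
      · rintro ⟨_, ⟨_, ⟨j, hj, rfl, hg⟩, rfl⟩, h⟩
        rw [hq.right j hj] at h
        rw [hbag j hj i hi, h, hlast] at hg
        exact hg.symm

lemma pwo_pathEnum (hrefl : ∀ x, r x x) (htrans : ∀ x y z, r x y → r y z → r x z)
    (hw : WellQuasiOrdered r) :
    {H : LGraph (L × Prop × Prop) | ∃ k q, PathEnum H Set.univ k q}.PartiallyWellOrderedOn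
      (LGraph.Le (cutLab r)) := by
  have hpre : IsPreorder L r := { refl := hrefl, trans := htrans }
  refine pwo_of_rel (fun H w => ∃ k q, PathEnum H Set.univ k q ∧
      w = (List.range k).map fun i => (H.lab (q i)).1)
    (Set.PartiallyWellOrderedOn.partiallyWellOrderedOn_sublistForall₂ r
      (Set.partiallyWellOrderedOn_univ_iff.mpr hw)) ?_ ?_
  · rintro H ⟨k, q, h⟩
    exact ⟨_, fun _ _ => trivial, k, q, h, rfl⟩
  · rintro H - K - _ _ ⟨m, p, hp, rfl⟩ ⟨k, q, hq, rfl⟩ h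
    obtain ⟨g, h0, hlast, hstep, hlab⟩ := exists_retraction_of_sublistForall₂ h (by
      have := hp.pos
      simp only [ne_eq, List.map_eq_nil_iff, List.range_eq_nil]
      omega)
    simp only [List.length_map, List.length_range] at hlast
    refine hp.le hq h0 hlast hstep fun i hi => ?_
    obtain ⟨j, b, hj, hg, hr⟩ := hlab i (H.lab (p i)).1 (by simp [hi])
    obtain ⟨hj1, rfl⟩ := List.getElem?_eq_some_iff.mp hj
    simp only [List.length_map, List.length_range] at hj1
    exact ⟨j, hj1, hg, by simpa using hr⟩

end Paths

section GoodCuts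

universe u

variable {L : Type u} {r : L → L → Prop}

lemma isComp_univ_image {V : Type*} {G : SimpleGraph V} {S : Set V} {C : Set S}
    (hC : IsComp (G.induce S) Set.univ C) : IsComp G S (Subtype.val '' C) := by
  refine ⟨by rintro _ ⟨x, -, rfl⟩; exact x.2, conn_induce.mp hC.2.1, ?_⟩
  rintro ⟨_, ⟨x, hx, rfl⟩, y, ⟨hy, hyC⟩, hxy⟩
  exact hC.2.2 ⟨x, hx, ⟨y, hy⟩, ⟨trivial, fun h => hyC ⟨_, h, rfl⟩⟩, hxy⟩

lemma isCograph_induce_of_image {V : Type*} {G : SimpleGraph V} {S : Set V} {C : Set S}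
    (h : IsCograph (G.induce (Subtype.val '' C))) : IsCograph ((G.induce S).induce C) := by
  rw [isCograph_iff] at h ⊢
  exact fun a b c d => h ⟨a, _, a.2, rfl⟩ ⟨b, _, b.2, rfl⟩ ⟨c, _, c.2, rfl⟩ ⟨d, _, d.2, rfl⟩

lemma exists_lift {V : Type*} {S : Set V} {C : Set S} {k : ℕ} {q : ℕ → V} (hk : 0 < k)
    (hq : ∀ x, x ∈ Subtype.val '' C ↔ ∃ i < k, q i = x) :
    ∃ q' : ℕ → S, (∀ i < k, (q' i : V) = q i) ∧ ∀ x, x ∈ C ↔ ∃ i < k, q' i = x := by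
  classical
  have hmem : ∀ i < k, q i ∈ S := fun i hi => by
    obtain ⟨x, -, hx⟩ := (hq (q i)).mpr ⟨i, hi, rfl⟩
    exact hx ▸ x.2
  have hval : ∀ i < k, ((if h : q i ∈ S then ⟨q i, h⟩ else ⟨q 0, hmem 0 hk⟩ : S) : V) = q i :=
    fun i hi => by rw [dif_pos (hmem i hi)]
  refine ⟨fun i => if h : q i ∈ S then ⟨q i, h⟩ else ⟨q 0, hmem 0 hk⟩, hval, fun x => ?_⟩
  rw [← Subtype.val_injective.mem_set_image, hq]
  refine exists_congr fun i => and_congr_right fun hi => ?_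
  rw [← hval i hi, Subtype.val_inj]

/-- Every component is a path marked at its ends, or a cograph. -/
def GoodRest (H : LGraph (L × Prop × Prop)) : Prop :=
  ∀ C, IsComp H.graph Set.univ C → (∃ k q, PathEnum H C k q) ∨ IsCograph (H.graph.induce C)

lemma pwo_goodRest (hrefl : ∀ x, r x x) (htrans : ∀ x y z, r x y → r y z → r x z)
    (hw : WellQuasiOrdered r) :
    {H : LGraph (L × Prop × Prop) | GoodRest H}.PartiallyWellOrderedOn
      (LGraph.Le (cutLab r)) := by
  have hR := labelRel_cutLab hrefl htrans
  have hw' := wqo_cutLab hrefl htrans hw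
  refine pwo_of_homog hR (fun c => ¬ c) (P := GoodRest) (fun H S c hH hc hS C hC => ?_)
    (((pwo_of_card_le hR hw' 0).union ((pwo_pathEnum hrefl htrans hw).union
      (pwo_isCograph hR hw'))).mono ?_)
  · change Set S at C
    have hC' : IsComp H.graph S (Subtype.val '' C) := isComp_univ_image hC
    have hC'' : IsComp H.graph Set.univ (Subtype.val '' C) := by
      refine ⟨Set.subset_univ _, hC'.2.1, ?_⟩
      rintro ⟨x, hx, y, ⟨-, hy⟩, hxy⟩
      by_cases hyS : y ∈ S
      · exact hC'.2.2 ⟨x, hx, y, ⟨hyS, hy⟩, hxy⟩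
      · exact hc ((hS.2.2 x (hC'.1 hx) y hyS).mp hxy)
    rcases hH _ hC'' with ⟨k, q, hq⟩ | hco
    · left
      obtain ⟨q', hval, hmem⟩ := exists_lift hq.pos hq.mem
      refine ⟨k, q', hq.pos, hmem, fun i hi j hj h => hq.inj i hi j hj ?_, fun i hi j hj => ?_,
        fun i hi => ?_, fun i hi => ?_⟩
      · rw [← hval i hi, ← hval j hj, h]
      · rw [← hq.adj i hi j hj, ← hval i hi, ← hval j hj]
        rfl
      · rw [← hq.left i hi, ← hval i hi]
        rfl
      · rw [← hq.right i hi, ← hval i hi]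
        rfl
    · exact Or.inr (isCograph_induce_of_image hco)
  · rintro H ⟨hH, hhom⟩
    rcases isEmpty_or_nonempty H.V with hV | ⟨⟨x⟩⟩
    · left
      simp
    right
    obtain ⟨C, hC, hxC⟩ := exists_isComp (G := H.graph) (Set.mem_univ x)
    have hCu : C = Set.univ := by
      by_contra hne
      refine hhom C False not_false ⟨⟨x, hxC⟩, Set.nonempty_compl.mpr hne, fun y hy z hz => ?_⟩
      simpa using fun h => hz (hC.mem_of_adj hy trivial h)
    subst hCu
    rcases hH _ hC with h | h
    · exact Or.inl h
    · right
      change IsCograph H.graph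
      rw [isCograph_iff] at h ⊢
      exact fun a b c d => h ⟨a, trivial⟩ ⟨b, trivial⟩ ⟨c, trivial⟩ ⟨d, trivial⟩

/-- The graph obtained by deleting two vertices and recording adjacency to them in the labels. -/
def LGraph.cut (H : LGraph L) (u v : H.V) : LGraph (L × Prop × Prop) :=
  ⟨({u, v}ᶜ : Set H.V), inferInstance, H.graph.induce _,
    fun x => (H.lab x, H.graph.Adj u x, H.graph.Adj v x)⟩

open Classical in
lemma LGraph.Le.of_cut {H K : LGraph L} {u v : H.V} {u' v' : K.V} (huv : u ≠ v) (huv' : u' ≠ v')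
    (hu : r (H.lab u) (K.lab u')) (hv : r (H.lab v) (K.lab v'))
    (hadj : H.graph.Adj u v ↔ K.graph.Adj u' v')
    (h : (H.cut u v).Le (cutLab r) (K.cut u' v')) : H.Le (exLab r) K := by
  obtain ⟨μ, hμ⟩ := h
  change ({u, v}ᶜ : Set H.V) → Set ({u', v'}ᶜ : Set K.V) at μ
  have hmem : ∀ {x}, x ≠ u → x ≠ v → x ∈ ({u, v}ᶜ : Set H.V) := by simp +contextual
  let ν : H.V → Set K.V := fun x => if hxu : x = u then {u'} else if hxv : x = v then {v'} else
    Subtype.val '' μ ⟨x, hmem hxu hxv⟩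
  have hνu : ν u = {u'} := by simp [ν]
  have hνv : ν v = {v'} := by simp [ν, huv.symm]
  have hν : ∀ x (hxu : x ≠ u) (hxv : x ≠ v), ν x = Subtype.val '' μ ⟨x, hmem hxu hxv⟩ :=
    fun x hxu hxv => by simp [ν, hxu, hxv]
  have hu' : ∀ S : Set ({u', v'}ᶜ : Set K.V), Disjoint {u'} (Subtype.val '' S) := fun S => by
    rw [Set.disjoint_singleton_left]
    rintro ⟨x, -, hx⟩
    exact x.2 (by simp [hx])
  have hv' : ∀ S : Set ({u', v'}ᶜ : Set K.V), Disjoint {v'} (Subtype.val '' S) := fun S => by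
    rw [Set.disjoint_singleton_left]
    rintro ⟨x, -, hx⟩
    exact x.2 (by simp [hx])
  have htu : ∀ x, Touch K.graph {u'} (Subtype.val '' μ x) ↔ H.graph.Adj u x := fun x => by
    rw [touch_singleton_left]
    refine Iff.trans ?_ (hμ.lab x).2.1.symm
    constructor
    · rintro ⟨_, ⟨y, hy, rfl⟩, h⟩
      exact ⟨_, ⟨y, hy, rfl⟩, h⟩
    · rintro ⟨_, ⟨y, hy, rfl⟩, h⟩
      exact ⟨_, ⟨y, hy, rfl⟩, h⟩
  have htv : ∀ x, Touch K.graph {v'} (Subtype.val '' μ x) ↔ H.graph.Adj v x := fun x => by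
    rw [touch_singleton_left]
    refine Iff.trans ?_ (hμ.lab x).2.2.symm
    constructor
    · rintro ⟨_, ⟨y, hy, rfl⟩, h⟩
      exact ⟨_, ⟨y, hy, rfl⟩, h⟩
    · rintro ⟨_, ⟨y, hy, rfl⟩, h⟩
      exact ⟨_, ⟨y, hy, rfl⟩, h⟩
  have key : ∀ x y, x ≠ y → Disjoint (ν x) (ν y) ∧
      (Touch K.graph (ν x) (ν y) ↔ H.graph.Adj x y) := by
    intro x y hxy
    by_cases hxu : x = u
    · subst hxu
      by_cases hyv : y = v
      · subst hyv
        rw [hνu, hνv, Set.disjoint_singleton, touch_singleton, hadj]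
        exact ⟨huv', Iff.rfl⟩
      · rw [hνu, hν y hxy.symm hyv]
        exact ⟨hu' _, htu _⟩
    by_cases hxv : x = v
    · subst hxv
      by_cases hyu : y = u
      · subst hyu
        rw [hνu, hνv, Set.disjoint_singleton, touch_singleton, H.graph.adj_comm, hadj,
          K.graph.adj_comm]
        exact ⟨huv'.symm, Iff.rfl⟩
      · rw [hνv, hν y hyu hxy.symm]
        exact ⟨hv' _, htv _⟩
    rw [hν x hxu hxv]
    by_cases hyu : y = u
    · subst hyu
      rw [hνu, touch_comm, H.graph.adj_comm]
      exact ⟨(hu' _).symm, htu _⟩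
    by_cases hyv : y = v
    · subst hyv
      rw [hνv, touch_comm, H.graph.adj_comm]
      exact ⟨(hv' _).symm, htv _⟩
    rw [hν y hyu hyv, Set.disjoint_image_iff Subtype.val_injective, ← touch_induce]
    have hne : (⟨x, hmem hxu hxv⟩ : ({u, v}ᶜ : Set H.V)) ≠ ⟨y, hmem hyu hyv⟩ :=
      fun h => hxy (congrArg Subtype.val h)
    exact ⟨hμ.disj _ _ hne, hμ.touch _ _ hne⟩
  refine ⟨ν, fun x => ?_, fun x y hxy => (key x y hxy).1, fun x y hxy => (key x y hxy).2,
    fun x => ?_⟩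
  · by_cases hxu : x = u
    · rw [hxu, hνu]; exact conn_singleton _
    by_cases hxv : x = v
    · rw [hxv, hνv]; exact conn_singleton _
    rw [hν x hxu hxv]
    exact conn_induce.mp (hμ.conn _)
  · by_cases hxu : x = u
    · rw [hxu, hνu]; exact ⟨_, ⟨u', rfl, rfl⟩, hu⟩
    by_cases hxv : x = v
    · rw [hxv, hνv]; exact ⟨_, ⟨v', rfl, rfl⟩, hv⟩
    rw [hν x hxu hxv]
    obtain ⟨_, ⟨y, hy, rfl⟩, h⟩ := (hμ.lab ⟨x, hmem hxu hxv⟩).1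
    exact ⟨_, ⟨_, ⟨y, hy, rfl⟩, rfl⟩, h⟩

lemma isCograph_of_hub {V : Type*} {G : SimpleGraph V} (hG : ¬ IsInducedMinor gem G) {D : Set V}
    {u : V} (h : ∀ x ∈ D, G.Adj u x) : IsCograph (G.induce D) := by
  rw [isCograph_iff]
  intro a b c d hab hbc hcd hac had
  by_contra hbd
  have h1 : a ≠ c := by rintro rfl; exact had hcd
  have h2 : a ≠ d := by rintro rfl; exact hac hcd.symm
  have h3 : b ≠ d := by rintro rfl; exact had hab
  have hval : ∀ {x y : D}, x ≠ y → Disjoint ({(x : V)} : Set V) {(y : V)} := fun hxy => by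
    rw [Set.disjoint_singleton]; exact fun h => hxy (Subtype.val_injective h)
  have hu : ∀ x : D, Disjoint ({u} : Set V) {(x : V)} := fun x => by
    rw [Set.disjoint_singleton]; exact (h x x.2).ne
  refine hG (isInducedMinor_gem (H := {u}) (A := {(a : V)}) (B := {(b : V)}) (C := {(c : V)})
    (D := {(d : V)}) (conn_singleton _) (conn_singleton _) (conn_singleton _) (conn_singleton _)
    (conn_singleton _) (hu _) (hu _) (hu _) (hu _) (hval hab.ne) (hval h1) (hval h2) (hval hbc.ne)
    (hval h3) (hval hcd.ne) ?_ ?_ ?_ ?_ ?_ ?_ ?_ ?_ ?_ ?_) <;> rw [touch_singleton]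
  all_goals first | exact h _ (Subtype.property _) | assumption

lemma IsGoodCut.goodRest {H : LGraph L} (hG : ¬ IsInducedMinor gem H.graph) {u v : H.V}
    (h : IsGoodCut H.graph u v) : GoodRest (H.cut u v) := by
  intro C hC
  change Set ({u, v}ᶜ : Set H.V) at C
  rcases h.2 _ (isComp_univ_image hC) with ⟨k, q, hq, hD⟩ | hco
  · left
    have hmem : ∀ x, x ∈ Subtype.val '' C ↔ ∃ i < k, q (i + 1) = x := fun x => by
      rw [hD, mem_seg]
      constructor
      · rintro ⟨i, h1, h2, h3⟩
        exact ⟨i - 1, by omega, by rwa [Nat.sub_add_cancel h1]⟩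
      · rintro ⟨i, h1, h2⟩
        exact ⟨i + 1, by omega, by omega, h2⟩
    obtain ⟨q', hval, hmem'⟩ := exists_lift hq.pos hmem
    have hadj : ∀ i j, i < j → j < k → (H.graph.Adj (q (i + 1)) (q (j + 1)) ↔ j = i + 1) :=
      fun i j hij hj => by
        rw [hq.adj (i + 1) (j + 1) (by omega) (by omega) (by omega)]
        omega
    refine ⟨k, q', hq.pos, hmem', fun i hi j hj hij => ?_, fun i hi j hj => ?_, fun i hi => ?_,
      fun i hi => ?_⟩
    · have heq : q (i + 1) = q (j + 1) := by rw [← hval i hi, ← hval j hj, hij]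
      rcases lt_trichotomy i j with hlt | rfl | hlt
      · exact absurd heq (hq.inj _ _ (by omega) (by omega))
      · rfl
      · exact absurd heq.symm (hq.inj _ _ (by omega) (by omega))
    · change H.graph.Adj (q' i) (q' j) ↔ _
      rw [hval i hi, hval j hj]
      rcases lt_trichotomy i j with hlt | rfl | hlt
      · rw [hadj i j hlt hj]; omega
      · simp
      · rw [H.graph.adj_comm, hadj j i hlt hi]; omega
    · change H.graph.Adj u (q' i) ↔ _
      rw [hval i hi, ← hq.zero, hq.adj 0 (i + 1) (by omega) (by omega) (by omega)]
      omega
    · change H.graph.Adj v (q' i) ↔ _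
      rw [hval i hi, H.graph.adj_comm, ← hq.last,
        hq.adj (i + 1) (k + 1) (by omega) (by omega) (by omega)]
      omega
  · exact Or.inr (isCograph_induce_of_image (isCograph_of_hub hG fun x hx => (hco x hx).1))

/-- Gem-free graphs without cutvertices and with well-quasi-ordered labels are
well-quasi-ordered. -/
theorem pwo_biconn (hrefl : ∀ x, r x x) (htrans : ∀ x y z, r x y → r y z → r x z)
    (hw : WellQuasiOrdered r) :
    {H : LGraph L | Biconn H.graph ∧ ¬ IsInducedMinor gem H.graph}.PartiallyWellOrderedOn
      (LGraph.Le (exLab r)) := by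
  have hR := labelRel_exLab hrefl htrans
  have hw' : WellQuasiOrdered fun l l' => exLab r l {l'} := by
    simpa only [exLab, Set.mem_singleton_iff, exists_eq_left] using hw
  have hwu := Set.partiallyWellOrderedOn_univ_iff.mpr hw
  have hcut : {H : LGraph L | ¬ IsInducedMinor gem H.graph ∧
      ∃ u v, IsGoodCut H.graph u v}.PartiallyWellOrderedOn (LGraph.Le (exLab r)) := by
    refine pwo_of_rel (fun H d => ∃ u v, u ≠ v ∧ d = (H.lab u, H.lab v, H.graph.Adj u v, H.cut u v))
      (pwo_prod hrefl htrans hwu (pwo_prod hrefl htrans hwu (pwo_prod (r := Eq) (fun _ => rfl)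
        (fun _ _ _ => Eq.trans) (pwo_univ_prop fun _ => rfl)
        (pwo_goodRest hrefl htrans hw)))) ?_ ?_
    · rintro H ⟨hG, u, v, huv⟩
      exact ⟨(H.lab u, H.lab v, H.graph.Adj u v, H.cut u v),
        ⟨trivial, trivial, trivial, huv.goodRest hG⟩, u, v, huv.1, rfl⟩
    · rintro H - K - _ _ ⟨u, v, huv, rfl⟩ ⟨u', v', huv', rfl⟩ ⟨h1, h2, h3, h4⟩
      exact LGraph.Le.of_cut huv huv' h1 h2 (iff_of_eq h3) h4
  refine ((pwo_isCograph hR hw').union ((pwo_of_card_le hR hw' 6).union hcut)).mono ?_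
  rintro H ⟨hB, hG⟩
  rcases hB.structure hG with h | h | h
  · exact Or.inl h
  · exact Or.inr (Or.inl h)
  · exact Or.inr (Or.inr ⟨hG, h⟩)

end GoodCuts

section Rooted

variable {V : Type*} {G : SimpleGraph V}

lemma IsInducedMinor.of_induce {W : Type*} {F : SimpleGraph W} {S : Set V}
    (h : IsInducedMinor F (G.induce S)) : IsInducedMinor F G := by
  obtain ⟨μ, hne, hdisj, hconn, hadj⟩ := h
  refine ⟨fun a => Subtype.val '' μ a, fun a => (hne a).image _, fun a b hab => ?_, fun a => ?_,
    fun a b hab => ?_⟩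
  · rw [Set.disjoint_image_iff Subtype.val_injective]
    exact hdisj a b hab
  · rw [← conn_iff_induce_connected, ← conn_induce, conn_iff_induce_connected]
    exact hconn a
  · rw [← hadj a b hab]
    exact touch_induce.symm

lemma Conn.image_of_adj {S : Set V} (hS : Conn G S) {f : V → V}
    (hf : ∀ x ∈ S, ∀ y ∈ S, G.Adj x y → f x = f y ∨ G.Adj (f x) (f y)) : Conn G (f '' S) := by
  refine ⟨hS.1.image f, fun A hA hne hA' => ?_⟩
  obtain ⟨x, ⟨hx, hxA⟩, y, ⟨hy, hyA⟩, hxy⟩ := hS.2 {x ∈ S | f x ∈ A} (fun x hx => hx.1) (by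
    obtain ⟨a, ha⟩ := hne
    obtain ⟨x, hx, rfl⟩ := hA ha
    exact ⟨x, hx, ha⟩) (by
    intro heq
    refine hA' (Set.Subset.antisymm hA ?_)
    rintro _ ⟨x, hx, rfl⟩
    exact ((Set.ext_iff.mp heq x).mpr hx).2)
  have hyA' : f y ∉ A := fun h => hyA ⟨hy, h⟩
  refine ⟨f x, hxA, f y, ⟨⟨y, hy, rfl⟩, hyA'⟩, ?_⟩
  rcases hf x hx y hy hxy with h | h
  · exact absurd (h ▸ hxA) hyA'
  · exact h

/-- The label marks exactly the vertex `s`. -/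
def Rooted (H : LGraph Prop) (s : H.V) : Prop := ∀ x, H.lab x ↔ x = s

/-- Connected rooted gem-free graphs. -/
def RootedGemFree (H : LGraph Prop) : Prop :=
  Conn H.graph Set.univ ∧ ¬ IsInducedMinor gem H.graph ∧ ∃ s, Rooted H s

/-- Implication of marks. -/
abbrev markLab : Prop → Set Prop → Prop := exLab fun p q => p → q

lemma labelRel_markLab : LabelRel markLab :=
  labelRel_exLab (fun _ => id) fun _ _ _ h1 h2 => h2 ∘ h1

lemma wqo_markLab : WellQuasiOrdered fun l l' => markLab l {l'} := by
  have h := pwo_univ_prop (r := fun p q => p → q) fun _ => id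
  rw [Set.partiallyWellOrderedOn_univ_iff] at h
  simpa only [markLab, exLab, Set.mem_singleton_iff, exists_eq_left] using h

lemma markLab_iff {H K : LGraph Prop} {s : H.V} {t : K.V} (hs : Rooted H s) (ht : Rooted K t)
    {a : H.V} {S : Set K.V} (hS : S.Nonempty) :
    markLab (H.lab a) (K.lab '' S) ↔ (a = s → t ∈ S) := by
  rw [hs a]
  constructor
  · rintro ⟨_, ⟨x, hx, rfl⟩, h⟩ ha
    rwa [← (ht x).mp (h ha)]
  · intro h
    by_cases ha : a = s
    · exact ⟨_, ⟨t, h ha, rfl⟩, fun _ => (ht t).mpr rfl⟩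
    · obtain ⟨x, hx⟩ := hS
      exact ⟨_, ⟨x, hx, rfl⟩, fun h => absurd h ha⟩

/-- The set `S` is attached to the rest of the graph, which contains the root `r`, only at `s`. -/
structure IsPiece (G : SimpleGraph V) (r : V) (S : Set V) (s : V) : Prop where
  conn : Conn G S
  mem : s ∈ S
  proper : Sᶜ.Nonempty
  rest : Conn G (insert s Sᶜ)
  root : r ∈ insert s Sᶜ
  sep : ∀ x ∈ S, x ≠ s → ∀ y ∉ S, ¬ G.Adj x y

/-- The subgraph induced by `S`, rooted at `s`. -/
def LGraph.piece {L : Type*} (H : LGraph L) (S : Set H.V) (s : H.V) : LGraph Prop :=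
  ⟨S, inferInstance, H.graph.induce S, fun x => (x : H.V) = s⟩

lemma rooted_piece {L : Type*} (H : LGraph L) {S : Set H.V} {s : H.V} (hs : s ∈ S) :
    Rooted (H.piece S s) (⟨s, hs⟩ : S) :=
  fun x => (Subtype.ext_iff (a1 := (x : S)) (a2 := ⟨s, hs⟩)).symm

lemma conn_induce_univ {S : Set V} : Conn (G.induce S) Set.univ ↔ Conn G S := by
  rw [conn_induce, Set.image_univ, Subtype.range_coe]

lemma IsPiece.rootedGemFree {H : LGraph Prop} (hH : RootedGemFree H) {r s : H.V} {S : Set H.V}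
    (h : IsPiece H.graph r S s) : RootedGemFree (H.piece S s) :=
  ⟨conn_induce_univ.mpr h.conn, fun hg => hH.2.1 hg.of_induce, _, rooted_piece H h.mem⟩

open Classical in
lemma IsPiece.le {H : LGraph Prop} {r s : H.V} (hr : Rooted H r) {S : Set H.V}
    (h : IsPiece H.graph r S s) : (H.piece S s).Le markLab H := by
  have hdt : ∀ x ∈ S, x ≠ s → Disjoint (insert s Sᶜ) {x} ∧
      (Touch H.graph (insert s Sᶜ) {x} ↔ H.graph.Adj s x) := by
    intro x hx hxs
    constructor
    · rw [Set.disjoint_singleton_right]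
      rintro (h1 | h1)
      · exact hxs h1
      · exact h1 hx
    · rw [touch_singleton_right]
      constructor
      · rintro ⟨y, hy | hy, hyx⟩
        · rwa [← hy]
        · exact absurd hyx.symm (h.sep x hx hxs y hy)
      · exact fun h => ⟨s, Or.inl rfl, h⟩
  let μ : S → Set H.V := fun x => if (x : H.V) = s then insert s Sᶜ else {(x : H.V)}
  have hμs : ∀ x : S, (x : H.V) = s → μ x = insert s Sᶜ := fun x hx => if_pos hx
  have hμ : ∀ x : S, (x : H.V) ≠ s → μ x = {(x : H.V)} := fun x hx => if_neg hx
  have key : ∀ x y : S, x ≠ y →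
      Disjoint (μ x) (μ y) ∧ (Touch H.graph (μ x) (μ y) ↔ H.graph.Adj x y) := by
    intro x y hxy
    have hxy' : (x : H.V) ≠ y := fun h => hxy (Subtype.ext h)
    by_cases hx : (x : H.V) = s
    · have hy : (y : H.V) ≠ s := fun h => hxy' (hx.trans h.symm)
      rw [hμs x hx, hμ y hy, hx]
      exact hdt y y.2 hy
    · rw [hμ x hx]
      by_cases hy : (y : H.V) = s
      · rw [hμs y hy, hy, touch_comm, H.graph.adj_comm]
        exact ⟨(hdt x x.2 hx).1.symm, (hdt x x.2 hx).2⟩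
      · rw [hμ y hy, Set.disjoint_singleton, touch_singleton]
        exact ⟨hxy', Iff.rfl⟩
  have hconn : ∀ x : S, Conn H.graph (μ x) := fun x => by
    by_cases hx : (x : H.V) = s
    · rw [hμs x hx]; exact h.rest
    · rw [hμ x hx]; exact conn_singleton _
  refine ⟨μ, hconn, fun x y hxy => (key x y hxy).1, fun x y hxy => (key x y hxy).2, fun x => ?_⟩
  refine (markLab_iff (rooted_piece H h.mem) hr (hconn x).1).mpr fun hx => ?_
  rw [hμs x (congrArg Subtype.val hx)]
  exact h.root

/-- Gluing two models at a cutvertex which is the root. -/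
lemma LGraph.Le.glue_root {H K : LGraph Prop} {r : H.V} {r' : K.V} (hr : Rooted H r)
    (hr' : Rooted K r') {A : Set H.V} {A' : Set K.V} (hrA : r ∉ A) (hrA' : r' ∉ A')
    (hA : ∀ x ∈ A, ∀ y ∉ A, y ≠ r → ¬ H.graph.Adj x y)
    (hA' : ∀ x ∈ A', ∀ y ∉ A', y ≠ r' → ¬ K.graph.Adj x y)
    (h1 : (H.piece (insert r A) r).Le markLab (K.piece (insert r' A') r'))
    (h2 : (H.piece Aᶜ r).Le markLab (K.piece A'ᶜ r')) : H.Le markLab K := by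
  obtain ⟨μ, hμ⟩ := h1
  obtain ⟨ν, hν⟩ := h2
  change ↥(insert r A : Set H.V) → Set ↥(insert r' A' : Set K.V) at μ
  change (Aᶜ : Set H.V) → Set (A'ᶜ : Set K.V) at ν
  let M : H.V → Set K.V := fun x => {y | ∃ hx hy, ⟨y, hy⟩ ∈ μ ⟨x, hx⟩}
  let N : H.V → Set K.V := fun x => {y | ∃ hx hy, ⟨y, hy⟩ ∈ ν ⟨x, hx⟩}
  have hM : ∀ x (hx : x ∈ insert r A), M x = Subtype.val '' μ ⟨x, hx⟩ := fun x hx =>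
    Set.ext fun _ => ⟨fun ⟨_, _, h⟩ => ⟨_, h, rfl⟩, fun ⟨y, h, hy⟩ => hy ▸ ⟨hx, y.2, h⟩⟩
  have hN : ∀ x (hx : x ∈ Aᶜ), N x = Subtype.val '' ν ⟨x, hx⟩ := fun x hx =>
    Set.ext fun _ => ⟨fun ⟨_, _, h⟩ => ⟨_, h, rfl⟩, fun ⟨y, h, hy⟩ => hy ▸ ⟨hx, y.2, h⟩⟩
  have hM0 : ∀ x ∉ insert r A, M x = ∅ := fun x hx =>
    Set.eq_empty_of_forall_notMem fun _ hy => hx hy.1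
  have hN0 : ∀ x ∈ A, N x = ∅ := fun x hx =>
    Set.eq_empty_of_forall_notMem fun _ hy => hy.1 hx
  have hMc : ∀ x ∈ insert r A, Conn K.graph (M x) := fun x hx => by
    rw [hM x hx]; exact conn_induce.mp (hμ.conn _)
  have hNc : ∀ x ∉ A, Conn K.graph (N x) := fun x hx => by
    rw [hN x hx]; exact conn_induce.mp (hν.conn _)
  have hMr : r' ∈ M r := by
    have := (markLab_iff (rooted_piece H (Set.mem_insert r A))
      (rooted_piece K (Set.mem_insert r' A')) (hμ.conn _).1).mp (hμ.lab _) rfl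
    exact ⟨_, _, this⟩
  have hNr : r' ∈ N r := by
    have := (markLab_iff (rooted_piece H (S := Aᶜ) hrA)
      (rooted_piece K (S := A'ᶜ) hrA') (hν.conn _).1).mp (hν.lab _) rfl
    exact ⟨_, _, this⟩
  have hMd : ∀ x ∈ insert r A, ∀ y ∈ insert r A, x ≠ y →
      Disjoint (M x) (M y) ∧ (Touch K.graph (M x) (M y) ↔ H.graph.Adj x y) := by
    intro x hx y hy hxy
    rw [hM x hx, hM y hy, Set.disjoint_image_iff Subtype.val_injective, ← touch_induce]
    have hne : (⟨x, hx⟩ : (insert r A : Set H.V)) ≠ ⟨y, hy⟩ := fun h => hxy (congrArg Subtype.val h)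
    exact ⟨hμ.disj _ _ hne, hμ.touch _ _ hne⟩
  have hNd : ∀ x ∉ A, ∀ y ∉ A, x ≠ y →
      Disjoint (N x) (N y) ∧ (Touch K.graph (N x) (N y) ↔ H.graph.Adj x y) := by
    intro x hx y hy hxy
    rw [hN x hx, hN y hy, Set.disjoint_image_iff Subtype.val_injective, ← touch_induce]
    have hne : (⟨x, hx⟩ : (Aᶜ : Set H.V)) ≠ ⟨y, hy⟩ := fun h => hxy (congrArg Subtype.val h)
    exact ⟨hν.disj _ _ hne, hν.touch _ _ hne⟩
  have hMA : ∀ x ∈ A, M x ⊆ A' := by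
    rintro x hx y hy
    have hyr : y ≠ r' := by
      rintro rfl
      exact Set.disjoint_left.mp (hMd x (Or.inr hx) r (Or.inl rfl) (by
        rintro rfl; exact hrA hx)).1 hy hMr
    obtain ⟨-, h | h, -⟩ := hy
    · exact absurd h hyr
    · exact h
  have hNA : ∀ x, N x ⊆ A'ᶜ := fun x y hy => hy.2.1
  have hNA' : ∀ x ∉ A, x ≠ r → r' ∉ N x := fun x hx hxr h =>
    Set.disjoint_left.mp (hNd x hx r hrA hxr).1 h hNr
  have hMs : ∀ x, M x ⊆ insert r' A' := fun x y hy => hy.2.1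
  have key : ∀ x y, x ≠ y → x ∈ A ∨ (x = r ∧ y ∉ A) ∨ (x ∉ A ∧ x ≠ r ∧ y ∉ A ∧ y ≠ r) →
      Disjoint (M x ∪ N x) (M y ∪ N y) ∧
      (Touch K.graph (M x ∪ N x) (M y ∪ N y) ↔ H.graph.Adj x y) := by
    rintro x y hxy (hx | ⟨rfl, hy⟩ | ⟨hx, hxr, hy, hyr⟩)
    · rw [hN0 x hx, Set.union_empty]
      by_cases hy : y ∈ A
      · rw [hN0 y hy, Set.union_empty]
        exact hMd x (Or.inr hx) y (Or.inr hy) hxy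
      by_cases hyr : y = r
      · subst hyr
        have hd := hMd x (Or.inr hx) y (Or.inl rfl) hxy
        refine ⟨Set.disjoint_union_right.mpr ⟨hd.1, ?_⟩, ?_⟩
        · exact Set.disjoint_left.mpr fun z h1 h2 => hNA y h2 (hMA x hx h1)
        · rw [touch_union_right, ← hd.2]
          refine ⟨fun h => h.elim id ?_, Or.inl⟩
          rintro ⟨p, hp, q, hq, hpq⟩
          by_cases hqr : q = r'
          · exact ⟨p, hp, r', hMr, hqr ▸ hpq⟩
          · exact absurd hpq (hA' p (hMA x hx hp) q (hNA y hq) hqr)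
      · have hyA : y ∉ insert r A := by rintro (h | h) <;> contradiction
        rw [hM0 y hyA, Set.empty_union]
        refine ⟨Set.disjoint_left.mpr fun z h1 h2 => hNA y h2 (hMA x hx h1),
          iff_of_false ?_ (hA x hx y hy hyr)⟩
        rintro ⟨p, hp, q, hq, hpq⟩
        exact hA' p (hMA x hx hp) q (hNA y hq) (fun h => hNA' y hy hyr (h ▸ hq)) hpq
    · have hyA : y ∉ insert x A := by
        rintro (h | h)
        · exact hxy h.symm
        · exact hy h
      rw [hM0 y hyA, Set.empty_union]
      have hd := hNd x hrA y hy hxy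
      have hyr := hNA' y hy hxy.symm
      refine ⟨Set.disjoint_union_left.mpr ⟨?_, hd.1⟩, ?_⟩
      · refine Set.disjoint_left.mpr fun z h1 h2 => ?_
        rcases hMs x h1 with h | h
        · exact hyr (h ▸ h2)
        · exact hNA y h2 h
      · rw [touch_union_left, ← hd.2]
        refine ⟨fun h => h.elim ?_ id, Or.inr⟩
        rintro ⟨p, hp, q, hq, hpq⟩
        rcases hMs x hp with h | h
        · exact ⟨r', hNr, q, hq, h ▸ hpq⟩
        · exact absurd hpq (hA' p h q (hNA y hq) fun h => hyr (h ▸ hq))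
    · have hxA : x ∉ insert r A := by rintro (h | h) <;> contradiction
      have hyA : y ∉ insert r A := by rintro (h | h) <;> contradiction
      rw [hM0 x hxA, hM0 y hyA, Set.empty_union, Set.empty_union]
      exact hNd x hx y hy hxy
  have key' : ∀ x y, x ≠ y → Disjoint (M x ∪ N x) (M y ∪ N y) ∧
      (Touch K.graph (M x ∪ N x) (M y ∪ N y) ↔ H.graph.Adj x y) := by
    intro x y hxy
    by_cases h : x ∈ A ∨ (x = r ∧ y ∉ A) ∨ (x ∉ A ∧ x ≠ r ∧ y ∉ A ∧ y ≠ r)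
    · exact key x y hxy h
    · have := key y x hxy.symm (by grind)
      rwa [disjoint_comm, touch_comm, H.graph.adj_comm]
  have hconn : ∀ x, Conn K.graph (M x ∪ N x) := by
    intro x
    by_cases hx : x ∈ A
    · rw [hN0 x hx, Set.union_empty]
      exact hMc x (Or.inr hx)
    by_cases hxr : x = r
    · subst hxr
      exact (hMc x (Or.inl rfl)).union_of_inter (hNc x hx) hMr hNr
    · have hxA : x ∉ insert r A := by rintro (h | h) <;> contradiction
      rw [hM0 x hxA, Set.empty_union]
      exact hNc x hx
  refine ⟨fun x => M x ∪ N x, hconn, fun x y hxy => (key' x y hxy).1,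
    fun x y hxy => (key' x y hxy).2, fun x => ?_⟩
  refine (markLab_iff hr hr' (hconn x).1).mpr ?_
  rintro rfl
  exact Or.inl hMr

end Rooted

section Retractions

variable {V : Type*} {G : SimpleGraph V}

/-- The map `π` contracts connected pieces of the graph to the vertices at which they are attached,
and the root `r` forms a piece on its own. -/
structure Retr (G : SimpleGraph V) (r : V) (π : V → V) : Prop where
  idem : ∀ x, π (π x) = π x
  conn : ∀ b, π b = b → Conn G {y | π y = b}
  adj : ∀ x y, G.Adj x y → π x ≠ π y → π x = x ∧ π y = y
  root : ∀ x, π x = r ↔ x = r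

lemma retr_id (r : V) : Retr G r id where
  idem _ := rfl
  conn b _ := conn_singleton b
  adj _ _ _ _ := ⟨rfl, rfl⟩
  root _ := Iff.rfl

variable {r : V} {π : V → V}

lemma Retr.conn_range (h : Retr G r π) (hG : Conn G Set.univ) : Conn G (Set.range π) := by
  rw [← Set.image_univ]
  refine hG.image_of_adj fun x _ y _ hxy => ?_
  by_cases heq : π x = π y
  · exact Or.inl heq
  · obtain ⟨h1, h2⟩ := h.adj x y hxy heq
    rw [h1, h2]
    exact Or.inr hxy

open Classical in
lemma Retr.isPiece (h : Retr G r π) (hG : Conn G Set.univ) [Nontrivial V] {b : V}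
    (hb : π b = b) : IsPiece G r {y | π y = b} b := by
  have hr : π r = r := (h.root r).mpr rfl
  have hconn : Conn G (insert b {y | π y = b}ᶜ) := by
    have := hG.image_of_adj (f := fun x => if π x = b then b else x) fun x _ y _ hxy => by
      by_cases hx : π x = b <;> by_cases hy : π y = b <;> simp only [hx, hy, if_true, if_false]
      · exact Or.inl trivial
      · obtain ⟨h1, -⟩ := h.adj x y hxy (by rw [hx]; exact fun h => hy h.symm)
        rw [← hx, h1]
        exact Or.inr hxy
      · obtain ⟨-, h1⟩ := h.adj x y hxy (by rwa [hy])
        rw [← hy, h1]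
        exact Or.inr hxy
      · exact Or.inr hxy
    convert this
    ext x
    constructor
    · rintro (rfl | hx)
      · exact ⟨x, trivial, by simp [hb]⟩
      · exact ⟨x, trivial, if_neg hx⟩
    · rintro ⟨y, -, hy⟩
      by_cases hyb : π y = b
      · simp only [hyb, if_true] at hy
        exact Or.inl hy.symm
      · simp only [hyb, if_false] at hy
        exact Or.inr (hy ▸ hyb)
  refine ⟨h.conn b hb, hb, ?_, hconn, ?_, fun x hx hxb y hy hxy => ?_⟩
  · by_cases hbr : b = r
    · obtain ⟨x, hx⟩ := exists_ne r
      exact ⟨x, fun hx' => hx ((h.root x).mp (hbr ▸ hx'))⟩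
    · exact ⟨r, fun hx => hbr (by rw [← hr]; exact hx.symm)⟩
  · by_cases hbr : b = r
    · exact Or.inl hbr.symm
    · exact Or.inr fun hx => hbr (by rw [← hr]; exact hx.symm)
  · have := (h.adj x y hxy (by rw [hx]; exact fun h => hy h.symm)).1
    exact hxb (this.symm.trans hx)

open Classical in
/-- A retraction whose image is separated at a vertex other than the root can be shortened. -/
lemma Retr.shorten (h : Retr G r π) (hG : Conn G Set.univ) {c : V} {A : Set V}
    (hA : A ⊆ Set.range π) (hne : A.Nonempty) (hc : π c = c) (hcA : c ∉ A) (hcr : c ≠ r)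
    (hrA : r ∉ A) (hsep : ∀ x ∈ A, ∀ y, π y = y → y ∉ A → y ≠ c → ¬ G.Adj x y) :
    ∃ π', Retr G r π' ∧ π' c = c ∧ Set.range π' ⊂ Set.range π := by
  have hfix : ∀ x ∈ A, π x = x := fun x hx => by
    obtain ⟨y, rfl⟩ := hA hx
    exact h.idem y
  have hr : π r = r := (h.root r).mpr rfl
  have hconnA : Conn G (insert c A) := by
    have := (h.conn_range hG).image_of_adj (f := fun x => if x ∈ A then x else c)
      fun x hx y hy hxy => by
        obtain ⟨x, rfl⟩ := hx
        obtain ⟨y, rfl⟩ := hy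
        by_cases hxA : π x ∈ A <;> by_cases hyA : π y ∈ A <;>
          simp only [hxA, hyA, if_true, if_false]
        · exact Or.inr hxy
        · by_cases hyc : π y = c
          · exact Or.inr (hyc ▸ hxy)
          · exact absurd hxy (hsep _ hxA _ (h.idem y) hyA hyc)
        · by_cases hxc : π x = c
          · exact Or.inr (hxc ▸ hxy)
          · exact absurd hxy.symm (hsep _ hyA _ (h.idem x) hxA hxc)
        · exact Or.inl trivial
    convert this
    ext x
    constructor
    · rintro (rfl | hx)
      · exact ⟨x, ⟨x, hc⟩, if_neg hcA⟩
      · exact ⟨x, hA hx, if_pos hx⟩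
    · rintro ⟨y, -, hy⟩
      by_cases hyA : y ∈ A
      · simp only [hyA, if_true] at hy
        exact Or.inr (hy ▸ hyA)
      · simp only [hyA, if_false] at hy
        exact Or.inl hy.symm
  let π' : V → V := fun z => if π z ∈ A then c else π z
  have hin : ∀ z, π z ∈ A → π' z = c := fun z hz => if_pos hz
  have hout : ∀ z, π z ∉ A → π' z = π z := fun z hz => if_neg hz
  have hc' : π' c = c := by rw [hout c (by rwa [hc]), hc]
  have hnot : ∀ z, π' z ∉ A := fun z => by
    by_cases hz : π z ∈ A
    · rwa [hin z hz]
    · rwa [hout z hz]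
  have hadj : ∀ z w, π z ∈ A → π w ∉ A → π w ≠ c → ¬ G.Adj z w := by
    intro z w hz hw hwc hzw
    obtain ⟨h1, h2⟩ := h.adj z w hzw fun heq => hw (heq ▸ hz)
    exact hsep (π z) hz (π w) (h.idem w) hw hwc (by rwa [h1, h2])
  refine ⟨π', ⟨fun x => ?_, fun b hb => ?_, fun x y hxy hne => ?_, fun x => ?_⟩, hc', ?_, ?_⟩
  · by_cases hx : π x ∈ A
    · rw [hin x hx, hc']
    · rw [hout x hx, hout _ (by rwa [h.idem]), h.idem]
  · have hbA : b ∉ A := hb ▸ hnot b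
    have hbfix : π b = b := by
      by_cases hbA' : π b ∈ A
      · rw [hin b hbA'] at hb
        rw [← hb, hc]
      · rwa [← hout b hbA']
    by_cases hbc : b = c
    · subst hbc
      have := hconnA.biUnion (G := G) (ν := fun x => {y | π y = x}) (fun x hx => h.conn x (by
        rcases hx with rfl | hx
        · exact hc
        · exact hfix x hx)) fun x hx y hy hxy => ⟨x, by
          rcases hx with rfl | hx
          · exact hc
          · exact hfix x hx, y, by
          rcases hy with rfl | hy
          · exact hc
          · exact hfix y hy, hxy⟩
      convert this
      ext y
      simp only [Set.mem_iUnion, Set.mem_ofPred_eq, exists_prop, exists_eq_right']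
      constructor
      · intro hy
        by_cases hyA : π y ∈ A
        · exact Or.inr hyA
        · exact Or.inl (by rwa [← hout y hyA])
      · rintro (hy | hy)
        · rw [hout y (by rwa [hy]), hy]
        · exact hin y hy
    · convert h.conn b hbfix using 1
      ext y
      simp only [Set.mem_ofPred_eq]
      by_cases hyA : π y ∈ A
      · rw [hin y hyA]
        exact iff_of_false (fun h => hbc h.symm) fun h => hbA (h ▸ hyA)
      · rw [hout y hyA]
  · by_cases hx : π x ∈ A <;> by_cases hy : π y ∈ A
    · exact absurd ((hin x hx).trans (hin y hy).symm) hne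
    · rw [hin x hx, hout y hy] at hne
      exact absurd hxy (hadj x y hx hy hne.symm)
    · rw [hin y hy, hout x hx] at hne
      exact absurd hxy.symm (hadj y x hy hx hne)
    · rw [hout x hx, hout y hy] at hne ⊢
      exact h.adj x y hxy hne
  · by_cases hx : π x ∈ A
    · rw [hin x hx]
      refine iff_of_false hcr fun hxr => hrA ?_
      rwa [hxr, hr] at hx
    · rw [hout x hx, h.root]
  · rintro _ ⟨x, rfl⟩
    by_cases hx : π x ∈ A
    · rw [hin x hx]; exact ⟨c, hc⟩
    · rw [hout x hx]; exact ⟨x, rfl⟩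
  · intro hsub
    obtain ⟨a, ha⟩ := hne
    obtain ⟨x, hx⟩ := hsub (hA ha)
    exact hnot x (hx ▸ ha)

/-- If the root is not a cutvertex then some retraction has a block containing the root as its
image. -/
lemma exists_retr_biconn [Finite V] (hG : Conn G Set.univ) [Nontrivial V]
    (hr : ∀ A : Set V, A.Nonempty → r ∉ A → (∃ y, y ∉ A ∧ y ≠ r) →
      ∃ a ∈ A, ∃ b, b ∉ A ∧ b ≠ r ∧ G.Adj a b) :
    ∃ π, Retr G r π ∧ Biconn (G.induce (Set.range π)) := by
  have hex : {π | Retr G r π ∧ ∃ c, c ≠ r ∧ π c = c}.Nonempty := by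
    obtain ⟨c, hc⟩ := exists_ne r
    exact ⟨id, retr_id r, c, hc, rfl⟩
  obtain ⟨π, ⟨h, -⟩, hmin⟩ := Set.exists_min_image _ (fun π => (Set.range π).ncard)
    (Set.toFinite _) hex
  refine ⟨π, h, conn_induce_univ.mpr (h.conn_range hG), ?_⟩
  have hπr : π r = r := (h.root r).mpr rfl
  have hfix : ∀ x : Set.range π, π x = x := by
    rintro ⟨_, x, rfl⟩
    exact h.idem x
  have key : ∀ (x : Set.range π) (A : Set (Set.range π)), A.Nonempty → x ∉ A →
      (∃ y, y ∉ A ∧ y ≠ x) → ⟨r, r, hπr⟩ ∉ A → ∃ a ∈ A, ∃ b, b ∉ A ∧ b ≠ x ∧ G.Adj a b := by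
    rintro x A hne hxA ⟨y, hyA, hyx⟩ hrA
    by_contra hcon
    push Not at hcon
    have hmem : ∀ z (hz : π z = z), z ∈ Subtype.val '' A ↔ ⟨z, z, hz⟩ ∈ A := fun z hz =>
      ⟨fun ⟨w, hw, hwz⟩ => by
        have : w = ⟨z, z, hz⟩ := Subtype.ext hwz
        exact this ▸ hw, fun h => ⟨_, h, rfl⟩⟩
    by_cases hxr : (x : V) = r
    · obtain ⟨a, ha, b, hb, hbr, hab⟩ := hr {z | π z ∈ Subtype.val '' A} (by
        obtain ⟨a, ha⟩ := hne
        exact ⟨a, a, ha, (hfix a).symm⟩) (by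
        rintro ⟨a, ha, har⟩
        rw [hπr] at har
        exact hrA ((Subtype.ext har : a = ⟨r, r, hπr⟩) ▸ ha)) ⟨y, by
        rintro ⟨a, ha, hay⟩
        rw [hfix] at hay
        exact hyA ((Subtype.ext hay : a = y) ▸ ha),
        fun hyr => hyx (Subtype.ext (hyr.trans hxr.symm))⟩
      rw [Set.mem_ofPred_eq] at ha hb
      obtain ⟨h1, h2⟩ := h.adj a b hab fun heq => hb (heq ▸ ha)
      rw [h1, hmem a h1] at ha
      rw [h2, hmem b h2] at hb
      exact hcon _ ha _ hb (fun heq => hbr ((congrArg Subtype.val heq).trans hxr)) hab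
    · obtain ⟨π', h', hc', hlt⟩ := h.shorten hG (c := x) (A := Subtype.val '' A)
        (by rintro _ ⟨a, -, rfl⟩; exact a.2) (hne.image _) (hfix x)
        (by rwa [Subtype.val_injective.mem_set_image]) hxr
        (by rwa [hmem r hπr]) (by
          rintro _ ⟨a, ha, rfl⟩ y hy hyA hyx
          rw [hmem y hy] at hyA
          exact hcon a ha _ hyA fun heq => hyx (congrArg Subtype.val heq))
      exact absurd (hmin π' ⟨h', x, hxr, hc'⟩) (not_le.mpr (Set.ncard_lt_ncard hlt))
  intro x A hne hxA hy
  by_cases hrA : ⟨r, r, hπr⟩ ∈ A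
  · obtain ⟨y, hyA, hyx⟩ := hy
    obtain ⟨b, ⟨hbA, hbx⟩, a, ha, hax, hab⟩ := key x {y | y ∉ A ∧ y ≠ x} ⟨y, hyA, hyx⟩
      (fun h => h.2 rfl) (by
        obtain ⟨a, ha⟩ := hne
        exact ⟨a, fun h => h.1 ha, by rintro rfl; exact hxA ha⟩) fun h => h.1 hrA
    exact ⟨a, by by_contra haA; exact ha ⟨haA, hax⟩, b, hbA, hbx, hab.symm⟩
  · exact key x A hne hxA hy hrA

end Retractions

section Lifting

open Classical in
/-- A model between the images of two retractions extends to the whole graphs along models between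
the contracted pieces. -/
lemma LGraph.Le.of_retr {H K : LGraph Prop} {r : H.V} {r' : K.V} (hr : Rooted H r)
    (hr' : Rooted K r') {π : H.V → H.V} {π' : K.V → K.V} (hπ : Retr H.graph r π)
    (hπ' : Retr K.graph r' π') {M N : H.V → Set K.V} {w : H.V → K.V}
    (hMc : ∀ b, π b = b → Conn K.graph (M b)) (hMs : ∀ b, π b = b → ∀ p ∈ M b, π' p = p)
    (hMd : ∀ b c, π b = b → π c = c → b ≠ c →
      Disjoint (M b) (M c) ∧ (Touch K.graph (M b) (M c) ↔ H.graph.Adj b c))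
    (hwM : ∀ b, π b = b → w b ∈ M b) (hNc : ∀ x, Conn K.graph (N x))
    (hNs : ∀ x, ∀ p ∈ N x, π' p = w (π x))
    (hNd : ∀ x y, π x = π y → x ≠ y →
      Disjoint (N x) (N y) ∧ (Touch K.graph (N x) (N y) ↔ H.graph.Adj x y))
    (hwN : ∀ b, π b = b → w b ∈ N b) (hwr : w r = r') : H.Le markLab K := by
  let F : H.V → Set K.V := fun x => if π x = x then M x ∪ N x else N x
  have hF : ∀ x, π x = x → F x = M x ∪ N x := fun x hx => if_pos hx
  have hF' : ∀ x, π x ≠ x → F x = N x := fun x hx => if_neg hx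
  have hbag : ∀ x, ∀ p ∈ F x, π' p ∈ M (π x) := by
    intro x p hp
    have hN : p ∈ N x → π' p ∈ M (π x) := fun h => by
      rw [hNs x p h]
      exact hwM _ (hπ.idem x)
    by_cases hx : π x = x
    · rw [hF x hx] at hp
      rcases hp with hp | hp
      · rwa [hMs x hx p hp, hx]
      · exact hN hp
    · rw [hF' x hx] at hp
      exact hN hp
  have hout : ∀ x, π x ≠ x → ∀ p ∈ N x, π' p ≠ p := by
    intro x hx p hp heq
    have h1 := hwN (π x) (hπ.idem x)
    rw [← hNs x p hp, heq] at h1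
    exact Set.disjoint_left.mp (hNd (π x) x (hπ.idem x) hx).1 h1 hp
  have hinM : ∀ x, ∀ p ∈ F x, π' p = p → π x = x := by
    intro x p hp hfix
    by_contra hx
    rw [hF' x hx] at hp
    exact hout x hx p hp hfix
  have hsame : ∀ b x, π b = b → π x = b → x ≠ b →
      Disjoint (F b) (F x) ∧ (Touch K.graph (F b) (F x) ↔ H.graph.Adj b x) := by
    intro b x hb hx hxb
    have hx' : π x ≠ x := fun h => hxb (h.symm.trans hx)
    have hd := hNd b x (hb.trans hx.symm) hxb.symm
    rw [hF b hb, hF' x hx']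
    refine ⟨Set.disjoint_union_left.mpr ⟨?_, hd.1⟩, ?_⟩
    · exact Set.disjoint_left.mpr fun p h1 h2 => hout x hx' p h2 (hMs b hb p h1)
    · rw [touch_union_left, ← hd.2]
      refine ⟨fun h => h.elim ?_ id, Or.inr⟩
      rintro ⟨p, hp, q, hq, hpq⟩
      have hpf := hMs b hb p hp
      by_cases heq : π' p = π' q
      · rw [hpf, hNs x q hq, hx] at heq
        exact ⟨p, heq ▸ hwN b hb, q, hq, hpq⟩
      · exact absurd (hπ'.adj p q hpq heq).2 (hout x hx' q hq)
  have key : ∀ x y, x ≠ y →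
      Disjoint (F x) (F y) ∧ (Touch K.graph (F x) (F y) ↔ H.graph.Adj x y) := by
    intro x y hxy
    by_cases hπxy : π x = π y
    · by_cases hx : π x = x
      · exact hsame x y hx (hπxy.symm.trans hx) hxy.symm
      by_cases hy : π y = y
      · have := hsame y x hy (hπxy.trans hy) hxy
        rwa [disjoint_comm, touch_comm, H.graph.adj_comm]
      · rw [hF' x hx, hF' y hy]
        exact hNd x y hπxy hxy
    · have hd := hMd (π x) (π y) (hπ.idem x) (hπ.idem y) hπxy
      refine ⟨Set.disjoint_left.mpr fun p h1 h2 =>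
        Set.disjoint_left.mp hd.1 (hbag x p h1) (hbag y p h2), ?_, fun hadj => ?_⟩
      · rintro ⟨p, hp, q, hq, hpq⟩
        have hne : π' p ≠ π' q := fun heq =>
          Set.disjoint_left.mp hd.1 (hbag x p hp) (heq ▸ hbag y q hq)
        obtain ⟨h1, h2⟩ := hπ'.adj p q hpq hne
        have hx := hinM x p hp h1
        have hy := hinM y q hq h2
        rw [hx, hy] at hd
        have hp' := hbag x p hp
        have hq' := hbag y q hq
        rw [h1, hx] at hp'
        rw [h2, hy] at hq'
        exact hd.2.mp ⟨p, hp', q, hq', hpq⟩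
      · obtain ⟨hx, hy⟩ := hπ.adj x y hadj hπxy
        rw [hx, hy] at hd
        rw [hF x hx, hF y hy]
        exact (hd.2.mpr hadj).mono Set.subset_union_left Set.subset_union_left
  have hconn : ∀ x, Conn K.graph (F x) := by
    intro x
    by_cases hx : π x = x
    · rw [hF x hx]
      exact (hMc x hx).union_of_inter (hNc x) (hwM x hx) (hwN x hx)
    · rw [hF' x hx]
      exact hNc x
  refine ⟨F, hconn, fun x y hxy => (key x y hxy).1, fun x y hxy => (key x y hxy).2, fun x => ?_⟩
  refine (markLab_iff hr hr' (hconn x).1).mpr ?_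
  rintro rfl
  have hx : π x = x := (hπ.root x).mpr rfl
  rw [hF x hx, ← hwr]
  exact Or.inl (hwM x hx)

/-- Labels recording a rooted graph of the set `T` and a mark. -/
abbrev PieceLab (T : Set (LGraph Prop)) : Type 1 := T × Prop

/-- Comparison of labels recording rooted graphs. -/
def pieceLe (T : Set (LGraph Prop)) (l m : PieceLab T) : Prop :=
  (l.1 : LGraph Prop).Le markLab m.1 ∧ (l.2 → m.2)

/-- The image of a retraction, labelled by the contracted pieces and by the root. -/
def blockGraph (T : Set (LGraph Prop)) (H : LGraph Prop) (r : H.V) (π : H.V → H.V)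
    (hT : ∀ b : Set.range π, H.piece {y | π y = b} b ∈ T) : LGraph (PieceLab T) :=
  ⟨Set.range π, inferInstance, H.graph.induce _, fun b => (⟨_, hT b⟩, (b : H.V) = r)⟩

lemma LGraph.Le.of_blockGraph {T : Set (LGraph Prop)} {H K : LGraph Prop} {r : H.V} {r' : K.V}
    (hr : Rooted H r) (hr' : Rooted K r') {π : H.V → H.V} {π' : K.V → K.V}
    (hπ : Retr H.graph r π) (hπ' : Retr K.graph r' π')
    (hT : ∀ b : Set.range π, H.piece {y | π y = b} b ∈ T)
    (hT' : ∀ b : Set.range π', K.piece {y | π' y = b} b ∈ T)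
    (h : (blockGraph T H r π hT).Le (exLab (pieceLe T)) (blockGraph T K r' π' hT')) :
    H.Le markLab K := by
  obtain ⟨μ, hμ⟩ := h
  change Set.range π → Set (Set.range π') at μ
  have hfix : ∀ b : Set.range π, π b = b := by
    rintro ⟨_, x, rfl⟩
    exact hπ.idem x
  have hfix' : ∀ b : Set.range π', π' b = b := by
    rintro ⟨_, x, rfl⟩
    exact hπ'.idem x
  have hlab : ∀ b : Set.range π, ∃ c ∈ μ b, (H.piece {y | π y = b} b).Le markLab
      (K.piece {y | π' y = c} c) ∧ ((b : H.V) = r → (c : K.V) = r') := by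
    intro b
    obtain ⟨_, ⟨c, hc, rfl⟩, h1, h2⟩ := hμ.lab b
    exact ⟨c, hc, h1, h2⟩
  choose w hwμ hle hwr using hlab
  choose ν hν using hle
  change ∀ b : Set.range π, {y | π y = b} → Set {y | π' y = w b} at ν
  have hidx : ∀ (b : Set.range π) x (hx : π x = b),
      w ⟨π x, x, rfl⟩ = w b ∧
        Subtype.val '' ν ⟨π x, x, rfl⟩ ⟨x, rfl⟩ = Subtype.val '' ν b ⟨x, hx⟩ := by
    rintro ⟨b, hb⟩ x hx
    change π x = b at hx
    subst hx
    exact ⟨rfl, rfl⟩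
  refine LGraph.Le.of_retr hr hr' hπ hπ' (M := fun b => Subtype.val '' μ ⟨π b, b, rfl⟩)
    (N := fun x => Subtype.val '' ν ⟨π x, x, rfl⟩ ⟨x, rfl⟩) (w := fun b => w ⟨π b, b, rfl⟩)
    (fun b _ => conn_induce.mp (hμ.conn _)) ?_ (fun b c hb hc hbc => ?_)
    (fun b _ => ⟨_, hwμ _, rfl⟩) (fun x => conn_induce.mp ((hν _).conn _)) (fun x => ?_)
    (fun x y hxy hne => ?_) (fun b hb => ?_) ?_
  · rintro b - _ ⟨p, -, rfl⟩
    exact hfix' p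
  · have hne : (⟨π b, b, rfl⟩ : Set.range π) ≠ ⟨π c, c, rfl⟩ := fun h =>
      hbc (hb.symm.trans ((congrArg Subtype.val h).trans hc))
    rw [Set.disjoint_image_iff Subtype.val_injective, ← touch_induce]
    refine ⟨hμ.disj _ _ hne, (hμ.touch _ _ hne).trans ?_⟩
    change H.graph.Adj (π b) (π c) ↔ _
    rw [hb, hc]
  · rintro _ ⟨p, -, rfl⟩
    rw [(hidx ⟨π x, x, rfl⟩ (π x) (hπ.idem x)).1]
    exact p.2
  · have hy := hidx ⟨π x, x, rfl⟩ y hxy.symm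
    have hne' : (⟨x, rfl⟩ : {y | π y = π x}) ≠ ⟨y, hxy.symm⟩ := fun h =>
      hne (congrArg Subtype.val h)
    rw [hy.2]
    rw [Set.disjoint_image_iff Subtype.val_injective, ← touch_induce]
    exact ⟨(hν _).disj _ _ hne', (hν _).touch _ _ hne'⟩
  · obtain ⟨q, hq, hqw⟩ : ∃ q ∈ ν ⟨π b, b, rfl⟩ ⟨b, rfl⟩, (q : K.V) = w ⟨π b, b, rfl⟩ := by
      have h1 := (hν ⟨π b, b, rfl⟩).lab (⟨b, rfl⟩ : {y | π y = π b})
      have h2 := (markLab_iff (rooted_piece H (S := {y | π y = π b}) (hfix ⟨π b, b, rfl⟩))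
        (rooted_piece K (S := {y | π' y = w ⟨π b, b, rfl⟩}) (hfix' _))
        ((hν ⟨π b, b, rfl⟩).conn (⟨b, rfl⟩ : {y | π y = π b})).1).mp h1
      exact ⟨_, h2 (Subtype.ext hb.symm), rfl⟩
    exact ⟨q, hq, hqw⟩
  · exact hwr ⟨π r, r, rfl⟩ ((hπ.root r).mpr rfl)

end Lifting

section Gluing

/-- The two sides of a cutvertex are pieces. -/
lemma isPiece_of_cut {V : Type*} {G : SimpleGraph V} (hG : Conn G Set.univ) {r : V} {A : Set V}
    (hne : A.Nonempty) (hrA : r ∉ A) (hy : ∃ y, y ∉ A ∧ y ≠ r)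
    (hA : ∀ x ∈ A, ∀ y ∉ A, y ≠ r → ¬ G.Adj x y) :
    IsPiece G r (insert r A) r ∧ IsPiece G r Aᶜ r := by
  classical
  have hconn : Conn G (insert r A) := by
    have := hG.image_of_adj (f := fun x => if x ∈ A then x else r) fun x _ y _ hxy => by
      by_cases hx : x ∈ A <;> by_cases hy : y ∈ A <;> simp only [hx, hy, if_true, if_false]
      · exact Or.inr hxy
      · refine Or.inr ?_
        rwa [← not_ne_iff.mp fun h => hA x hx y hy h hxy]
      · refine Or.inr ?_
        rwa [← not_ne_iff.mp fun h => hA y hy x hx h hxy.symm]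
      · exact Or.inl trivial
    convert this using 1
    ext x
    simp only [Set.mem_insert_iff, Set.image_univ, Set.mem_range]
    constructor
    · rintro (rfl | hx)
      · exact ⟨x, if_neg hrA⟩
      · exact ⟨x, if_pos hx⟩
    · rintro ⟨y, rfl⟩
      by_cases hy : y ∈ A <;> simp [hy]
  have hconn' : Conn G Aᶜ := by
    have := hG.image_of_adj (f := fun x => if x ∈ A then r else x) fun x _ y _ hxy => by
      by_cases hx : x ∈ A <;> by_cases hy : y ∈ A <;> simp only [hx, hy, if_true, if_false]
      · exact Or.inl trivial
      · exact Or.inl (not_ne_iff.mp fun h => hA x hx y hy h hxy).symm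
      · exact Or.inl (not_ne_iff.mp fun h => hA y hy x hx h hxy.symm)
      · exact Or.inr hxy
    convert this using 1
    ext x
    simp only [Set.mem_compl_iff, Set.image_univ, Set.mem_range]
    constructor
    · intro hx
      exact ⟨x, if_neg hx⟩
    · rintro ⟨y, rfl⟩
      by_cases hy : y ∈ A <;> simp [hy, hrA]
  have h1 : insert r (insert r A)ᶜ = Aᶜ := by
    ext x
    simp only [Set.mem_insert_iff, Set.mem_compl_iff]
    by_cases hx : x = r
    · simp [hx, hrA]
    · simp [hx]
  refine ⟨⟨hconn, Set.mem_insert _ _, ?_, by rwa [h1], Set.mem_insert _ _, ?_⟩,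
    ⟨hconn', hrA, by rwa [compl_compl], by rwa [compl_compl], Set.mem_insert _ _, ?_⟩⟩
  · obtain ⟨y, hyA, hyr⟩ := hy
    exact ⟨y, by simp [hyA, hyr]⟩
  · rintro x (hx | hx) hxr y hy
    · exact absurd hx hxr
    · exact hA x hx y (fun h => hy (Or.inr h)) fun h => hy (Or.inl h)
  · intro x hx hxr y hy hxy
    exact hA y (not_not.mp hy) x hx hxr hxy.symm

/-- The graphs rooted at a cutvertex both of whose sides are in a well-quasi-ordered set. -/
lemma pwo_rooted_cut {T : Set (LGraph Prop)} (hT : T.PartiallyWellOrderedOn (LGraph.Le markLab)) :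
    {H : LGraph Prop | ∃ r A, Rooted H r ∧ r ∉ A ∧
      (∀ x ∈ A, ∀ y ∉ A, y ≠ r → ¬ H.graph.Adj x y) ∧ H.piece (insert r A) r ∈ T ∧
      H.piece Aᶜ r ∈ T}.PartiallyWellOrderedOn (LGraph.Le markLab) := by
  refine pwo_of_rel (fun H d => ∃ r A, Rooted H r ∧ r ∉ A ∧
      (∀ x ∈ A, ∀ y ∉ A, y ≠ r → ¬ H.graph.Adj x y) ∧ d = (H.piece (insert r A) r, H.piece Aᶜ r))
    (pwo_prod (LGraph.Le.refl labelRel_markLab) (fun _ _ _ => LGraph.Le.trans labelRel_markLab)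
      hT hT) ?_ ?_
  · rintro H ⟨r, A, hr, hrA, hA, h1, h2⟩
    exact ⟨(H.piece (insert r A) r, H.piece Aᶜ r), ⟨h1, h2⟩, r, A, hr, hrA, hA, rfl⟩
  · rintro H - K - _ _ ⟨r, A, hr, hrA, hA, rfl⟩ ⟨r', A', hr', hrA', hA', rfl⟩ ⟨h1, h2⟩
    exact LGraph.Le.glue_root hr hr' hrA hrA' hA hA' h1 h2

/-- The gem-free graphs which retract to a graph without cutvertices, with all contracted pieces
in a well-quasi-ordered set. -/
lemma pwo_rooted_retr {T : Set (LGraph Prop)}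
    (hT : T.PartiallyWellOrderedOn (LGraph.Le markLab)) :
    {H : LGraph Prop | ¬ IsInducedMinor gem H.graph ∧ ∃ r π, Rooted H r ∧ Retr H.graph r π ∧
      Biconn (H.graph.induce (Set.range π)) ∧
      ∀ b : Set.range π, H.piece {y | π y = b} b ∈ T}.PartiallyWellOrderedOn
        (LGraph.Le markLab) := by
  have hw : WellQuasiOrdered (pieceLe T) := by
    rw [← Set.partiallyWellOrderedOn_univ_iff]
    refine pwo_of_map (fun l : PieceLab T => ((l.1 : LGraph Prop), l.2))
      (pwo_prod (LGraph.Le.refl labelRel_markLab) (fun _ _ _ => LGraph.Le.trans labelRel_markLab)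
      hT (pwo_univ_prop (r := fun p q => p → q) fun _ => id)) (fun l _ => ⟨l.1.2, trivial⟩)
      fun l _ l' _ h => h
  refine pwo_of_rel (fun H d => ∃ (r : H.V) (π : H.V → H.V),
      ∃ hπ : ∀ b : Set.range π, H.piece {y | π y = b} b ∈ T, Rooted H r ∧
        Retr H.graph r π ∧ d = blockGraph T H r π hπ)
    (pwo_biconn (r := pieceLe T) (fun l => ⟨LGraph.Le.refl labelRel_markLab _, id⟩)
      (fun _ _ _ h1 h2 => ⟨LGraph.Le.trans labelRel_markLab h1.1 h2.1, h2.2 ∘ h1.2⟩) hw) ?_ ?_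
  · rintro H ⟨hG, r, π, hr, hπ, hB, hπT⟩
    exact ⟨blockGraph T H r π hπT, ⟨hB, fun h => hG h.of_induce⟩, r, π, hπT, hr, hπ, rfl⟩
  · rintro H - K - _ _ ⟨r, π, hπT, hr, hπ, rfl⟩ ⟨r', π', hπT', hr', hπ', rfl⟩ h
    exact LGraph.Le.of_blockGraph hr hr' hπ hπ' hπT hπT' h

theorem pwo_rootedGemFree :
    {H : LGraph Prop | RootedGemFree H}.PartiallyWellOrderedOn (LGraph.Le markLab) := by
  refine pwo_of_pieces (r := LGraph.Le markLab) (fun _ _ _ => LGraph.Le.trans labelRel_markLab)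
    (fun H => Nat.card H.V)
    (fun H => {K | ∃ r S s, Rooted H r ∧ IsPiece H.graph r S s ∧ K = H.piece S s}) ?_
    fun T _ hT => ?_
  · rintro H hH _ ⟨r, S, s, hr, h, rfl⟩
    exact ⟨h.rootedGemFree hH, h.le hr, card_ind_lt H h.proper⟩
  refine ((pwo_of_card_le labelRel_markLab wqo_markLab 1).union
    ((pwo_rooted_cut hT).union (pwo_rooted_retr hT))).mono ?_
  rintro H ⟨⟨hconn, hG, r, hr⟩, hHT⟩
  by_cases hcard : Nat.card H.V ≤ 1
  · exact Or.inl hcard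
  have hnt : Nontrivial H.V := Finite.one_lt_card_iff_nontrivial.mp (by omega)
  right
  by_cases hcut : ∀ A : Set H.V, A.Nonempty → r ∉ A → (∃ y, y ∉ A ∧ y ≠ r) →
      ∃ a ∈ A, ∃ b, b ∉ A ∧ b ≠ r ∧ H.graph.Adj a b
  · obtain ⟨π, hπ, hB⟩ := exists_retr_biconn hconn hcut
    refine Or.inr ⟨hG, r, π, hr, hπ, hB, ?_⟩
    rintro ⟨_, x, rfl⟩
    exact hHT ⟨r, _, _, hr, hπ.isPiece hconn (hπ.idem x), rfl⟩
  · push Not at hcut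
    obtain ⟨A, hne, hrA, hy, hA⟩ := hcut
    obtain ⟨h1, h2⟩ := isPiece_of_cut hconn hne hrA hy hA
    exact Or.inl ⟨r, A, hr, hrA, hA, hHT ⟨r, _, _, hr, h1, rfl⟩, hHT ⟨r, _, _, hr, h2, rfl⟩⟩

/-- The comparison of trivial labels. -/
abbrev unitLab : Unit → Set Unit → Prop := exLab fun _ _ => True

theorem pwo_gemFree :
    {H : LGraph Unit | ¬ IsInducedMinor gem H.graph}.PartiallyWellOrderedOn
      (LGraph.Le unitLab) := by
  have hR : LabelRel unitLab := labelRel_exLab (fun _ => trivial) fun _ _ _ _ _ => trivial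
  have hw : WellQuasiOrdered fun l l' => unitLab l {l'} :=
    fun _ => ⟨0, 1, Nat.zero_lt_one, hR.refl _⟩
  have hconn : {H : LGraph Unit | ¬ IsInducedMinor gem H.graph ∧
      Conn H.graph Set.univ}.PartiallyWellOrderedOn (LGraph.Le unitLab) := by
    refine pwo_of_rel (fun H d => ∃ r : H.V, d = ⟨H.V, H.fin, H.graph, fun x => x = r⟩)
      pwo_rootedGemFree ?_ ?_
    · rintro H ⟨hG, hc⟩
      obtain ⟨r, -⟩ := hc.1
      exact ⟨⟨H.V, H.fin, H.graph, fun x => x = r⟩, ⟨hc, hG, r, fun _ => Iff.rfl⟩, r, rfl⟩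
    · rintro H - K - _ _ ⟨r, rfl⟩ ⟨r', rfl⟩ ⟨μ, hμ⟩
      refine ⟨μ, hμ.conn, hμ.disj, hμ.touch, fun a => ?_⟩
      obtain ⟨x, hx⟩ := (hμ.conn a).1
      exact ⟨K.lab x, ⟨x, hx, rfl⟩, trivial⟩
  refine pwo_of_homog hR (fun c => ¬ c) (fun _ _ _ hH _ _ h => hH h.of_induce)
    (((pwo_of_card_le hR hw 0).union hconn).mono ?_)
  rintro H ⟨hG, hhom⟩
  rcases isEmpty_or_nonempty H.V with hV | hV
  · exact Or.inl (Nat.card_of_isEmpty).le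
  refine Or.inr ⟨hG, Set.univ_nonempty, fun A _ hne hA => ?_⟩
  by_contra htouch
  refine hhom A False id ⟨hne, Set.nonempty_compl.mpr hA, fun x hx y hy => ?_⟩
  exact iff_of_false (fun hxy => htouch ⟨x, hx, y, ⟨trivial, hy⟩, hxy⟩) id

end Gluing

/-- The class of gem-induced minor-free finite graphs is well-quasi-ordered
by the induced minor relation. -/
theorem gem_free_wqo :
    WqoClass (fun G => ¬ IsInducedMinor gem G.2) := by
  intro f hf
  obtain ⟨i, j, hij, μ, hμ⟩ := pwo_gemFree.exists_lt
    (f := fun n => ⟨Fin (f n).1, inferInstance, (f n).2, fun _ => ()⟩) hf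
  exact ⟨i, j, hij, μ, fun a => (hμ.conn a).1, hμ.disj,
    fun a => conn_iff_induce_connected.mp (hμ.conn a), hμ.touch⟩

end IMWQO
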